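/- Let δ ∈ (0.713611, 0.713614) be a real number satisfying 0 = 1 + ∫₀^∞ (ξ(v) − (v+2)e^{−2γ}) (v+1)^{−δ−1} dv + e^{−2γ}/δ + e^{−2γ}/(δ−1). Then there exist absolute positive constants c, C such that uniformly for x ≥ t ≥ 2, with v = log x / log t: c x v^δ log t ≤ T(x,t) ≤ C x v^δ log t, and c v^δ log x ≤ T(x,t)/D(x,t) ≤ C v^δ log x. -/

import Mathlib

open Real MeasureTheory

/-- `n` is `t`-dense: `n ≥ 1` and the ratios of consecutive divisors of `n` are all `≤ t`,
i.e. every divisor `d < n` is followed by another divisor in the interval `(d, t·d]`. -/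
def IsDense (n : ℕ) (t : ℝ) : Prop :=
  0 < n ∧ ∀ d : ℕ, d ∣ n → d < n → ∃ e : ℕ, e ∣ n ∧ d < e ∧ (e : ℝ) ≤ t * d

open Classical in
/-- `T x t = ∑_{n ≤ x, n t-dense} τ(n)`. -/
noncomputable def T (x t : ℝ) : ℝ :=
  ∑ n ∈ (Finset.Icc 1 ⌊x⌋₊).filter (fun n => IsDense n t), (n.divisors.card : ℝ)

open Classical in
/-- `D x t = #{n ≤ x : n t-dense}`. -/
noncomputable def D (x t : ℝ) : ℝ :=
  (((Finset.Icc 1 ⌊x⌋₊).filter (fun n => IsDense n t)).card : ℝ)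

/-- prime-prefix characterization of density -/
def PD (n : ℕ) (t : ℝ) : Prop :=
  n ≠ 0 ∧ ∀ p : ℕ, p.Prime → p ∣ n → ∃ m : ℕ, m ∣ n ∧ m ∈ Nat.smoothNumbers p ∧ (p : ℝ) ≤ t * m

lemma IsDense.pd {n : ℕ} {t : ℝ} (h : IsDense n t) : PD n t := by
  obtain ⟨h0, h⟩ := h
  refine ⟨h0.ne', fun p hp hpn => ?_⟩
  classical
  obtain ⟨d, hd, hmax⟩ := Finset.exists_max_image
    (n.divisors.filter (fun d => d ∈ Nat.smoothNumbers p)) id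
    ⟨1, by simp [h0.ne', Nat.mem_smoothNumbers, -Nat.mem_primeFactorsList', -Nat.mem_primeFactorsList]⟩
  simp only [Finset.mem_filter, Nat.mem_divisors, id] at hd hmax
  obtain ⟨⟨hdn, -⟩, hds⟩ := hd
  refine ⟨d, hdn, hds, ?_⟩
  by_contra hlt
  push Not at hlt
  have hne : d ≠ n := by
    rintro rfl
    exact lt_irrefl _ (Nat.mem_smoothNumbers'.1 hds p hp hpn)
  obtain ⟨e, he, hde, hle⟩ := h d hdn (lt_of_le_of_ne (Nat.le_of_dvd h0 hdn) hne)
  have hep : e < p := by exact_mod_cast hle.trans_lt hlt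
  have := hmax e ⟨⟨he, h0.ne'⟩, Nat.mem_smoothNumbers_of_lt (by omega) hep⟩
  omega

lemma PD.mul_pow_iff {m q a : ℕ} {t : ℝ} (hq : q.Prime) (hm : m ∈ Nat.smoothNumbers q)
    (ha : a ≠ 0) : PD (q ^ a * m) t ↔ PD m t ∧ (q : ℝ) ≤ t * m := by
  have hm0 : m ≠ 0 := Nat.ne_zero_of_mem_smoothNumbers hm
  constructor
  · rintro ⟨h0, h⟩
    refine ⟨⟨hm0, fun p hp hpm => ?_⟩, ?_⟩
    · obtain ⟨m', h1, h2, h3⟩ := h p hp (hpm.mul_left _)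
      refine ⟨m', ?_, h2, h3⟩
      have hpq : p < q := Nat.mem_smoothNumbers'.1 hm p hp hpm
      have : Nat.Coprime q m' := hq.smoothNumbers_coprime (Nat.smoothNumbers_mono hpq.le h2)
      exact (Nat.Coprime.pow_left a this).symm.dvd_of_dvd_mul_left h1
    · obtain ⟨m', h1, h2, h3⟩ := h q hq ((dvd_pow_self q ha).mul_right _)
      have : Nat.Coprime q m' := hq.smoothNumbers_coprime h2
      have hd : m' ∣ m := (Nat.Coprime.pow_left a this).symm.dvd_of_dvd_mul_left h1
      have hle : (m' : ℝ) ≤ m := by exact_mod_cast Nat.le_of_dvd (Nat.pos_of_ne_zero hm0) hd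
      have ht : 0 ≤ t := by
        by_contra hneg
        push Not at hneg
        have : t * m' ≤ 0 := mul_nonpos_of_nonpos_of_nonneg hneg.le (by positivity)
        have : (0:ℝ) < q := by exact_mod_cast hq.pos
        linarith
      exact h3.trans (by gcongr)
  · rintro ⟨⟨_, h⟩, hqt⟩
    refine ⟨mul_ne_zero (pow_ne_zero _ hq.ne_zero) hm0, fun p hp hpm => ?_⟩
    rcases (hp.dvd_mul).1 hpm with h1 | h1
    · have : p = q := (Nat.prime_dvd_prime_iff_eq hp hq).1 (hp.dvd_of_dvd_pow h1)
      subst this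
      exact ⟨m, dvd_mul_left _ _, hm, hqt⟩
    · obtain ⟨m', h1, h2, h3⟩ := h p hp h1
      exact ⟨m', h1.mul_left _, h2, h3⟩

lemma IsDense.mul_pow {m q : ℕ} {t : ℝ} (hq : q.Prime) (hm : IsDense m t) (a : ℕ)
    (hqt : (q : ℝ) ≤ t * m) : IsDense (q ^ a * m) t := by
  obtain ⟨h0, h⟩ := hm
  refine ⟨Nat.mul_pos (pow_pos hq.pos _) h0, fun d hd hlt => ?_⟩
  obtain ⟨x, y, hx, hy, rfl⟩ := exists_dvd_and_dvd_of_dvd_mul hd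
  obtain ⟨i, hi, rfl⟩ := (Nat.dvd_prime_pow hq).1 hx
  have hqi : 0 < q ^ i := pow_pos hq.pos _
  have hy0 : y ≤ m := Nat.le_of_dvd h0 hy
  rcases lt_or_eq_of_le hy0 with hym | rfl
  · obtain ⟨e, he1, he2, he3⟩ := h y hy hym
    refine ⟨q ^ i * e, mul_dvd_mul hx he1, Nat.mul_lt_mul_of_pos_left he2 hqi, ?_⟩
    push_cast
    have : (0:ℝ) ≤ (q:ℝ) ^ i := by positivity
    nlinarith
  · have hia : i < a := by
      rcases lt_or_eq_of_le hi with h | rfl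
      · exact h
      · exact absurd hlt (lt_irrefl _)
    suffices ∃ d', d' ∣ y ∧ y < q * d' ∧ (q * d' : ℝ) ≤ t * y by
      obtain ⟨d', h1, h2, h3⟩ := this
      refine ⟨q ^ (i+1) * d', mul_dvd_mul (pow_dvd_pow q hia) h1, ?_, ?_⟩
      · rw [pow_succ, mul_assoc]; exact Nat.mul_lt_mul_of_pos_left h2 hqi
      · push_cast
        have : (0:ℝ) ≤ (q:ℝ) ^ i := by positivity
        rw [pow_succ]
        nlinarith
    rcases lt_or_ge y q with hyq | hyq
    · exact ⟨1, one_dvd _, by simpa using hyq, by simpa using hqt⟩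
    · classical
      obtain ⟨d, hd', hmax⟩ := Finset.exists_max_image
        (y.divisors.filter (fun d => q * d ≤ y)) id ⟨1, by simp [h0.ne', hyq]⟩
      simp only [Finset.mem_filter, Nat.mem_divisors, id] at hd' hmax
      obtain ⟨⟨hdy, -⟩, hqd⟩ := hd'
      have hdpos : 0 < d := Nat.pos_of_dvd_of_pos hdy h0
      have hdlt : d < y := by
        have := hq.two_le
        nlinarith
      obtain ⟨e, he1, he2, he3⟩ := h d hdy hdlt
      refine ⟨e, he1, ?_, ?_⟩
      · by_contra hc
        push Not at hc
        have := hmax e ⟨⟨he1, h0.ne'⟩, hc⟩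
        omega
      · have h1 : (q:ℝ) * d ≤ y := by exact_mod_cast hqd
        have h2 : (0:ℝ) < d := by exact_mod_cast hdpos
        have hq0 : (0:ℝ) < q := by exact_mod_cast hq.pos
        have h3 : (d:ℝ) < e := by exact_mod_cast he2
        have ht : 0 ≤ t := by
          by_contra hneg
          push Not at hneg
          nlinarith
        nlinarith

lemma PD.isDense {t : ℝ} : ∀ (N n : ℕ), n ∈ Nat.smoothNumbers N → PD n t → IsDense n t := by
  intro N
  induction N with
  | zero =>
    intro n hn _
    rw [Nat.smoothNumbers_zero, Set.mem_singleton_iff] at hn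
    subst hn
    exact ⟨one_pos, fun d hd hlt => by
      have := Nat.dvd_one.1 hd
      omega⟩
  | succ N ih =>
    intro n hn hpd
    by_cases hN : N.Prime
    · obtain ⟨⟨a, m, hm⟩, hx⟩ := (Nat.equivProdNatSmoothNumbers hN).surjective ⟨n, hn⟩
      have hx' : N ^ a * m = n := by
        have := congrArg Subtype.val hx
        simpa using this
      subst hx'
      by_cases ha : a = 0
      · subst ha
        simp only [pow_zero, one_mul] at hpd ⊢
        exact ih m hm hpd
      · obtain ⟨h1, h2⟩ := (PD.mul_pow_iff hN hm ha).1 hpd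
        exact (ih m hm h1).mul_pow hN a h2
    · rw [Nat.smoothNumbers_succ hN] at hn
      exact ih n hn hpd

lemma isDense_iff_pd {n : ℕ} {t : ℝ} : IsDense n t ↔ PD n t :=
  ⟨IsDense.pd, fun h => PD.isDense (n+1) n
    (Nat.mem_smoothNumbers_of_lt (Nat.pos_of_ne_zero h.1) (Nat.lt_succ_self n)) h⟩

lemma isDense_mul_pow_iff {m q a : ℕ} {t : ℝ} (hq : q.Prime) (hm : m ∈ Nat.smoothNumbers q)
    (ha : a ≠ 0) : IsDense (q ^ a * m) t ↔ IsDense m t ∧ (q : ℝ) ≤ t * m := by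
  rw [isDense_iff_pd, isDense_iff_pd, PD.mul_pow_iff hq hm ha]

lemma IsDense.mul_prime {m q : ℕ} {t : ℝ} (hq : q.Prime) (hm : IsDense m t)
    (hqt : (q : ℝ) ≤ t * m) : IsDense (m * q) t := by
  have := hm.mul_pow hq 1 hqt
  rwa [pow_one, mul_comm] at this

lemma isDense_one (t : ℝ) : IsDense 1 t :=
  ⟨one_pos, fun d hd hlt => by
    have := Nat.dvd_one.1 hd
    omega⟩

lemma IsDense.mono {n : ℕ} {t t' : ℝ} (h : IsDense n t) (htt : t ≤ t') : IsDense n t' :=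
  ⟨h.1, fun d hd hlt => by
    obtain ⟨e, h1, h2, h3⟩ := h.2 d hd hlt
    exact ⟨e, h1, h2, h3.trans (by gcongr)⟩⟩

lemma IsDense.two_pow_mul {n J : ℕ} {t t0 : ℝ} (h : IsDense n t0) (ht : 2 ≤ t)
    (hJ : t0 ≤ 2 ^ J) : IsDense (2 ^ J * n) t := by
  rw [isDense_iff_pd] at h ⊢
  obtain ⟨h0, h⟩ := h
  refine ⟨by positivity, fun p hp hpn => ?_⟩
  rcases hp.eq_two_or_odd' with rfl | hodd
  · exact ⟨1, one_dvd _, by simp [Nat.mem_smoothNumbers, -Nat.mem_primeFactorsList', -Nat.mem_primeFactorsList], by simpa using ht⟩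
  · have hp2 : 2 < p := lt_of_le_of_ne hp.two_le (by rintro rfl; exact absurd hodd (by decide))
    rcases hp.dvd_mul.1 hpn with h1 | h1
    · have := (Nat.prime_dvd_prime_iff_eq hp Nat.prime_two).1 (hp.dvd_of_dvd_pow h1)
      omega
    · obtain ⟨m, hm1, hm2, hm3⟩ := h p hp h1
      refine ⟨2 ^ J * m, mul_dvd_mul_left _ hm1, ?_, ?_⟩
      · rw [Nat.mem_smoothNumbers'] at hm2 ⊢
        intro q hq hqd
        rcases hq.dvd_mul.1 hqd with h2 | h2
        · have := (Nat.prime_dvd_prime_iff_eq hq Nat.prime_two).1 (hq.dvd_of_dvd_pow h2)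
          omega
        · exact hm2 q hq h2
      · push_cast
        have hm0 : (0:ℝ) ≤ m := by positivity
        have : (0:ℝ) < 2 ^ J := by positivity
        calc (p:ℝ) ≤ t0 * m := hm3
          _ ≤ 2 ^ J * m := by gcongr
          _ ≤ t * (2 ^ J * m) := by nlinarith [mul_nonneg this.le hm0]

/-- prefix decomposition -/
lemma IsDense.exists_prefix {n : ℕ} {t y : ℝ} (h : IsDense n t) (hy1 : 1 < y) (hyn : y ≤ n) :
    ∃ a c : ℕ, n = a * c ∧ IsDense a t ∧ (a : ℝ) < y ∧ c ≠ 1 ∧ (y ≤ a * c.minFac) ∧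
      (∀ p, p.Prime → p ∣ a → p ≤ c.minFac) ∧ (c.minFac : ℝ) ≤ t * a ∧
      IsDense (a * c.minFac) t := by
  classical
  have hn0 : n ≠ 0 := h.1.ne'
  have hpd := isDense_iff_pd.1 h
  obtain ⟨a, ha, hmax⟩ := Finset.exists_max_image
    (n.divisors.filter (fun a => IsDense a t ∧ (a:ℝ) < y ∧
      ∀ p q, p.Prime → q.Prime → p ∣ a → q ∣ n / a → p ≤ q)) id
    ⟨1, by
      simp only [Finset.mem_filter, Nat.mem_divisors]
      refine ⟨⟨one_dvd _, hn0⟩, isDense_one t, by simpa using hy1, ?_⟩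
      intro p q hp _ hp1
      exact absurd (Nat.dvd_one.1 hp1) hp.one_lt.ne'⟩
  simp only [Finset.mem_filter, Nat.mem_divisors, id] at ha hmax
  obtain ⟨⟨⟨c, rfl⟩, -⟩, had, hay, hpq⟩ := ha
  have ha0 : 0 < a := had.1
  have hc0 : 0 < c := Nat.pos_of_ne_zero (right_ne_zero_of_mul hn0)
  rw [Nat.mul_div_cancel_left _ ha0] at hpq
  have hc1 : c ≠ 1 := by
    rintro rfl
    simp only [mul_one] at hyn
    linarith
  have hp := Nat.minFac_prime hc1
  obtain ⟨c', hc'⟩ := Nat.minFac_dvd c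
  have hpt : (c.minFac : ℝ) ≤ t * a := by
    obtain ⟨m, hm1, hm2, hm3⟩ := hpd.2 c.minFac hp ((Nat.minFac_dvd c).mul_left _)
    have hcop : Nat.Coprime m c := by
      refine Nat.Coprime.symm (Nat.coprime_of_dvd fun k hk hkc hkm => ?_)
      have h1 := Nat.mem_smoothNumbers'.1 hm2 k hk hkm
      have h2 := Nat.minFac_le_of_dvd hk.two_le hkc
      omega
    have hma : m ∣ a := hcop.dvd_of_dvd_mul_right hm1
    have : (m:ℝ) ≤ a := by exact_mod_cast Nat.le_of_dvd ha0 hma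
    have ht : 0 ≤ t := by
      by_contra hneg
      push Not at hneg
      have : t * m ≤ 0 := mul_nonpos_of_nonpos_of_nonneg hneg.le (by positivity)
      have : (0:ℝ) < c.minFac := by exact_mod_cast hp.pos
      linarith
    exact hm3.trans (by gcongr)
  have hd2 : IsDense (a * c.minFac) t := had.mul_prime hp hpt
  refine ⟨a, c, rfl, had, hay, hc1, ?_, fun p h1 h2 => hpq p _ h1 hp h2 (Nat.minFac_dvd c), hpt, hd2⟩
  by_contra hlt
  push Not at hlt
  have := hmax (a * c.minFac) ⟨⟨mul_dvd_mul_left _ (Nat.minFac_dvd c), hn0⟩, hd2,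
    by push_cast; exact hlt, ?_⟩
  · have := hp.two_le
    nlinarith
  · intro p q hp' hq hpa hqd
    have e1 : a * c / (a * c.minFac) = c' := by
      rw [Nat.mul_div_mul_left _ _ ha0]
      exact Nat.div_eq_of_eq_mul_right hp.pos hc'
    rw [e1] at hqd
    have hqc : q ∣ c := by rw [hc']; exact hqd.mul_left _
    rcases hp'.dvd_mul.1 hpa with h3 | h3
    · exact hpq p q hp' hq h3 hqc
    · have : p = c.minFac := (Nat.prime_dvd_prime_iff_eq hp' hp).1 h3
      rw [this]
      exact Nat.minFac_le_of_dvd hq.two_le hqc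

/-- weight: `fw 1 = 1`, `fw 2 = τ`. -/
noncomputable def fw (k n : ℕ) : ℝ := (n.divisors.card : ℝ) ^ (k - 1)

noncomputable def PP (y s : ℝ) : ℝ := ∏ p ∈ Nat.primesLE ⌊y⌋₊, (1 - (p : ℝ) ^ (-s))

lemma fw_nonneg (k n : ℕ) : 0 ≤ fw k n := by unfold fw; positivity

lemma one_le_fw (k : ℕ) {n : ℕ} (hn : n ≠ 0) : 1 ≤ fw k n := by
  unfold fw
  apply one_le_pow₀
  have : 0 < n.divisors.card := Finset.card_pos.mpr ⟨1, by simp [hn]⟩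
  exact_mod_cast this

lemma fw_mul {k m n : ℕ} (h : m.Coprime n) : fw k (m * n) = fw k m * fw k n := by
  unfold fw
  rw [Nat.Coprime.card_divisors_mul h, Nat.cast_mul, mul_pow]

lemma fw_one (k : ℕ) : fw k 1 = 1 := by simp [fw]

lemma fw_prime_pow {k q : ℕ} (hq : q.Prime) (a : ℕ) : fw k (q ^ a) = ((a : ℝ) + 1) ^ (k - 1) := by
  unfold fw
  rw [Nat.divisors_prime_pow hq]; simp

lemma card_divisors_mul_le (m n : ℕ) : (m * n).divisors.card ≤ m.divisors.card * n.divisors.card := by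
  rw [Nat.divisors_mul]
  exact Finset.card_mul_le

lemma fw_mul_le (k m n : ℕ) : fw k (m * n) ≤ fw k m * fw k n := by
  unfold fw
  rw [← mul_pow]
  apply pow_le_pow_left₀ (by positivity)
  exact_mod_cast card_divisors_mul_le m n

lemma fw_le (k n : ℕ) (hk : k = 1 ∨ k = 2) (hn : n ≠ 0) : fw k n ≤ n := by
  unfold fw
  rcases hk with rfl | rfl
  · simp; omega
  · simp; exact Nat.card_divisors_le_self n

lemma hasSum_fw {k q : ℕ} (hk : k = 1 ∨ k = 2) (hq : q.Prime) {z : ℝ} (h0 : 0 ≤ z) (h1 : z < 1) :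
    HasSum (fun a : ℕ => fw k (q ^ a) * z ^ a) (((1 - z) ^ k)⁻¹) := by
  have h := hasSum_choose_mul_geometric_of_norm_lt_one (𝕜 := ℝ) (k - 1) (r := z)
    (by rw [Real.norm_eq_abs, abs_of_nonneg h0]; exact h1)
  rcases hk with rfl | rfl
  · simpa [fw_prime_pow hq] using h
  · simpa [fw_prime_pow hq] using h

lemma prime_rpow_lt_one {p : ℕ} (hp : p.Prime) {s : ℝ} (hs : 0 < s) : (p : ℝ) ^ (-s) < 1 :=
  Real.rpow_lt_one_of_one_lt_of_neg (by exact_mod_cast hp.one_lt) (by linarith)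

lemma PP_pos {y s : ℝ} (hs : 0 < s) : 0 < PP y s := by
  unfold PP
  apply Finset.prod_pos
  intro p hp
  have := prime_rpow_lt_one (Nat.prime_of_mem_primesLE hp) hs
  linarith

lemma PP_le_one {y s : ℝ} (hs : 0 < s) : PP y s ≤ 1 := by
  unfold PP
  apply Finset.prod_le_one
  · intro p hp
    have := prime_rpow_lt_one (Nat.prime_of_mem_primesLE hp) hs
    linarith
  · intro p hp
    have : 0 ≤ (p : ℝ) ^ (-s) := by positivity
    linarith

lemma PP_anti {y z s : ℝ} (hs : 0 < s) (h : y ≤ z) : PP z s ≤ PP y s := by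
  have hsub : Nat.primesLE ⌊y⌋₊ ⊆ Nat.primesLE ⌊z⌋₊ := by
    intro p hp
    rw [Nat.mem_primesLE] at hp ⊢
    exact ⟨hp.1.trans (Nat.floor_mono h), hp.2⟩
  have h1 := (PP_pos (y := y) hs).le
  unfold PP at h1 ⊢
  rw [← Finset.prod_sdiff hsub]
  refine mul_le_of_le_one_left h1 (Finset.prod_le_one ?_ ?_)
  · intro p hp
    have := prime_rpow_lt_one (Nat.prime_of_mem_primesLE (Finset.sdiff_subset hp)) hs
    linarith
  · intro p hp
    have : 0 ≤ (p : ℝ) ^ (-s) := by positivity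
    linarith

open Classical in
/-- the summand in the finite identity -/
noncomputable def gid (k : ℕ) (t s : ℝ) (N m : ℕ) : ℝ :=
  if IsDense m t ∧ m ∈ Nat.smoothNumbers (N + 1) then
    fw k m * (m : ℝ) ^ (-s) * PP (min (t * m) N) s ^ k else 0

lemma gid_nonneg {k : ℕ} {t s : ℝ} (hs : 0 < s) (N m : ℕ) : 0 ≤ gid k t s N m := by
  unfold gid
  split_ifs
  · have := (PP_pos (y := min (t * m) N) hs).le
    have := fw_nonneg k m
    positivity
  · rfl

lemma PP_min_succ_of_not_prime {N : ℕ} (hN : ¬ (N+1).Prime) (a s : ℝ) :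
    PP (min a ((N + 1 : ℕ) : ℝ)) s = PP (min a N) s := by
  unfold PP
  congr 1
  ext p
  simp only [Nat.mem_primesLE]
  constructor
  · rintro ⟨h1, h2⟩
    refine ⟨?_, h2⟩
    have h3 := (Nat.le_floor_iff' h2.ne_zero).mp h1
    rw [Nat.le_floor_iff' h2.ne_zero, le_min_iff]
    rw [le_min_iff] at h3
    refine ⟨h3.1, ?_⟩
    have : p ≤ N + 1 := by exact_mod_cast h3.2
    have h4 : p ≠ N + 1 := by rintro rfl; exact hN h2
    exact_mod_cast (by omega : p ≤ N)
  · rintro ⟨h1, h2⟩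
    refine ⟨h1.trans (Nat.floor_mono ?_), h2⟩
    apply min_le_min_left; push_cast; linarith

lemma PP_min_succ_of_lt {N : ℕ} {a : ℝ} (ha : a < (N + 1 : ℕ)) (s : ℝ) :
    PP (min a ((N + 1 : ℕ) : ℝ)) s = PP (min a N) s := by
  unfold PP
  congr 1
  ext p
  simp only [Nat.mem_primesLE]
  constructor
  · rintro ⟨h1, h2⟩
    refine ⟨?_, h2⟩
    have h3 := (Nat.le_floor_iff' h2.ne_zero).mp h1
    rw [Nat.le_floor_iff' h2.ne_zero, le_min_iff]
    rw [le_min_iff] at h3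
    refine ⟨h3.1, ?_⟩
    have : p < N + 1 := by exact_mod_cast h3.1.trans_lt ha
    exact_mod_cast (by omega : p ≤ N)
  · rintro ⟨h1, h2⟩
    refine ⟨h1.trans (Nat.floor_mono ?_), h2⟩
    apply min_le_min_left; push_cast; linarith

lemma PP_nat_succ {N : ℕ} (hN : (N+1).Prime) (s : ℝ) :
    PP ((N + 1 : ℕ) : ℝ) s = PP N s * (1 - ((N + 1 : ℕ) : ℝ) ^ (-s)) := by
  unfold PP
  rw [Nat.floor_natCast, Nat.floor_natCast]
  have : Nat.primesLE (N + 1) = insert (N + 1) (Nat.primesLE N) := by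
    ext p
    simp only [Nat.mem_primesLE, Finset.mem_insert]
    constructor
    · rintro ⟨h1, h2⟩
      by_cases h : p = N + 1
      · exact Or.inl h
      · exact Or.inr ⟨by omega, h2⟩
    · rintro (rfl | ⟨h1, h2⟩)
      · exact ⟨le_rfl, hN⟩
      · exact ⟨by omega, h2⟩
  rw [this, Finset.prod_insert (by simp [Nat.mem_primesLE]), mul_comm]

lemma identity_ennreal {k : ℕ} (hk : k = 1 ∨ k = 2) {t s : ℝ} (ht : 1 ≤ t) (hs : 0 < s) (N : ℕ) :
    ∑' m : ℕ, ENNReal.ofReal (gid k t s N m) = 1 := by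
  classical
  induction N with
  | zero =>
    rw [tsum_eq_single 1]
    · have h1 : (1 : ℕ) ∈ Nat.smoothNumbers 1 := by simp
      have : ⌊min t (0:ℝ)⌋₊ = 0 := by
        rw [Nat.floor_eq_zero]; exact (min_le_right _ _).trans_lt one_pos
      simp [gid, isDense_one, fw_one, PP, this]
    · intro m hm
      simp [gid, Nat.smoothNumbers_one, hm]
  | succ N ih =>
    by_cases hN : (N + 1).Prime
    · set q := N + 1 with hq
      have hsub : ∀ (M : ℕ) , ∑' m : ℕ, ENNReal.ofReal (gid k t s M m) =
          ∑' m : Nat.smoothNumbers (M + 1), ENNReal.ofReal (gid k t s M m) := by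
        intro M
        rw [tsum_subtype (Nat.smoothNumbers (M + 1)) (fun m => ENNReal.ofReal (gid k t s M m))]
        congr 1
        ext m
        by_cases h : m ∈ Nat.smoothNumbers (M + 1)
        · simp [h]
        · simp [h, gid]
      rw [hsub, ← (Nat.equivProdNatSmoothNumbers hN).tsum_eq, ENNReal.tsum_prod', ENNReal.tsum_comm,
        ← ih, hsub N]
      congr 1
      ext ⟨m, hm⟩
      simp only [Nat.equivProdNatSmoothNumbers_apply']
      have hm0 : m ≠ 0 := Nat.ne_zero_of_mem_smoothNumbers hm
      have hmpos : (0:ℝ) < m := by positivity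
      have hqpos : (0:ℝ) < q := by rw [hq]; positivity
      have hcop : ∀ a, (q ^ a).Coprime m := fun a =>
        Nat.Coprime.pow_left a (hN.smoothNumbers_coprime hm)
      have hsm : ∀ a, q ^ a * m ∈ Nat.smoothNumbers (q + 1) := fun a => by
        have := (Nat.equivProdNatSmoothNumbers hN (a, ⟨m, hm⟩)).2
        simpa using this
      have hterm : ∀ a, a ≠ 0 → ¬ ((q:ℝ) ≤ t * m) → gid k t s q (q ^ a * m) = 0 := by
        intro a ha hqt
        unfold gid
        rw [if_neg]
        rw [isDense_mul_pow_iff hN hm ha]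
        tauto
      by_cases hqt : (q : ℝ) ≤ t * m
      · by_cases hd : IsDense m t
        · have hq1 : (q:ℝ) ^ (-s) < 1 := prime_rpow_lt_one hN hs
          have hq0 : 0 ≤ (q:ℝ) ^ (-s) := by positivity
          have hg : ∀ a, gid k t s q (q ^ a * m) =
              (fw k m * (m:ℝ) ^ (-s) * PP q s ^ k) * (fw k (q ^ a) * ((q:ℝ) ^ (-s)) ^ a) := by
            intro a
            unfold gid
            have hda : IsDense (q ^ a * m) t := by
              by_cases ha : a = 0
              · simpa [ha] using hd
              · exact (isDense_mul_pow_iff hN hm ha).mpr ⟨hd, hqt⟩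
            rw [if_pos ⟨hda, hsm a⟩, fw_mul (hcop a)]
            have h1 : min (t * ((q ^ a * m : ℕ) : ℝ)) q = q := by
              apply min_eq_right
              refine hqt.trans ?_
              push_cast
              have : (1:ℝ) ≤ (q:ℝ) ^ a := one_le_pow₀ (by exact_mod_cast hN.one_lt.le)
              have := mul_le_mul_of_nonneg_left this (by positivity : 0 ≤ t * m)
              linarith
            rw [h1]
            push_cast
            rw [Real.mul_rpow (by positivity) (by positivity), ← Real.rpow_natCast (q:ℝ) a,
              ← Real.rpow_natCast ((q:ℝ) ^ (-s)) a, ← Real.rpow_mul hqpos.le,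
              ← Real.rpow_mul hqpos.le, mul_comm (a:ℝ) (-s)]
            ring
          simp_rw [hg]
          have hA : 0 ≤ fw k m * (m:ℝ) ^ (-s) * PP q s ^ k := by
            have := (PP_pos (y := q) hs).le
            have := fw_nonneg k m
            positivity
          have hS := hasSum_fw hk hN hq0 hq1
          have hS2 := hS.mul_left (fw k m * (m:ℝ) ^ (-s) * PP q s ^ k)
          rw [← ENNReal.ofReal_tsum_of_nonneg _ hS2.summable, hS2.tsum_eq]
          · congr 1
            unfold gid
            rw [if_pos ⟨hd, hm⟩]
            have h1 : min (t * (m : ℝ)) N = N := by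
              apply min_eq_right
              refine le_trans ?_ hqt
              rw [hq]; push_cast; linarith
            rw [h1, hq, PP_nat_succ hN, ← hq, mul_pow]
            have : (1 - (q:ℝ) ^ (-s)) ^ k ≠ 0 := by
              apply pow_ne_zero; linarith
            field_simp
          · intro a
            have := fw_nonneg k (q ^ a)
            positivity
        · have hg : ∀ a, gid k t s q (q ^ a * m) = 0 := by
            intro a
            unfold gid
            rw [if_neg]
            rintro ⟨h, -⟩
            by_cases ha : a = 0
            · exact hd (by simpa [ha] using h)
            · exact hd ((isDense_mul_pow_iff hN hm ha).mp h).1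
          simp [hg]
          unfold gid
          rw [if_neg (by tauto)]
      · rw [tsum_eq_single 0 (fun a ha => by rw [hterm a ha hqt]; simp)]
        have hm2 := hsm 0
        simp only [pow_zero, one_mul] at hm2 ⊢
        unfold gid
        simp only [hm2, and_true]
        have := PP_min_succ_of_lt (not_le.mp hqt) s
        rw [← hq] at this ⊢
        rw [this]
        simp [hm]
    · rw [← ih]
      congr 1
      ext m
      unfold gid
      rw [PP_min_succ_of_not_prime hN]
      simp only [Nat.smoothNumbers_succ hN]

lemma identity_hasSum {k : ℕ} (hk : k = 1 ∨ k = 2) {t s : ℝ} (ht : 1 ≤ t) (hs : 0 < s) (N : ℕ) :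
    HasSum (gid k t s N) 1 := by
  have h := identity_ennreal hk ht hs N
  have hsum : Summable (gid k t s N) := by
    have := ENNReal.summable_toReal (f := fun m => ENNReal.ofReal (gid k t s N m)) (by rw [h]; simp)
    refine this.congr fun m => ENNReal.toReal_ofReal (gid_nonneg hs N m)
  have h2 := ENNReal.ofReal_tsum_of_nonneg (gid_nonneg (k := k) (t := t) hs N) hsum
  rw [h] at h2
  have h3 : ∑' m, gid k t s N m = 1 := by
    have := congrArg ENNReal.toReal h2
    rwa [ENNReal.toReal_ofReal (tsum_nonneg (gid_nonneg hs N)), ENNReal.toReal_one] at this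
  rw [← h3]; exact hsum.hasSum

lemma summable_card_divisors {s : ℝ} (hs : 1 < s) :
    Summable (fun n : ℕ => (n.divisors.card : ℝ) * (n:ℝ) ^ (-s)) := by
  have h1 : Summable (fun n : ℕ => (n:ℝ) ^ (-s)) := Real.summable_nat_rpow.mpr (by linarith)
  have h2 : Summable (fun n : ℕ+ => ((n:ℕ):ℝ) ^ (-s)) := h1.comp_injective PNat.coe_injective
  have h3 := h2.mul_of_nonneg h2 (fun n => by positivity) (fun n => by positivity)
  have h4 := (sigmaAntidiagonalEquivProd.summable_iff).mpr h3
  have h5 := h4.sigma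
  have h6 : Summable (fun n : ℕ+ => (((n:ℕ).divisors.card : ℝ)) * ((n:ℕ):ℝ) ^ (-s)) := by
    refine h5.congr fun n => ?_
    rw [tsum_fintype]
    have : ∀ c : (n : ℕ).divisorsAntidiagonal, ((fun x : ℕ+ × ℕ+ => ((x.1:ℕ):ℝ) ^ (-s) * ((x.2:ℕ):ℝ) ^ (-s)) ∘ sigmaAntidiagonalEquivProd) ⟨n, c⟩ = ((n:ℕ):ℝ) ^ (-s) := by
      intro c
      have hc := Nat.mem_divisorsAntidiagonal.mp c.2
      simp only [Function.comp, sigmaAntidiagonalEquivProd, Equiv.coe_fn_mk,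
        divisorsAntidiagonalFactors, PNat.mk_coe]
      rw [← Real.mul_rpow (by positivity) (by positivity), ← Nat.cast_mul, hc.1]
    rw [Finset.sum_congr rfl (fun c _ => this c)]
    have hcard : (n:ℕ).divisorsAntidiagonal.card = (n:ℕ).divisors.card := by
      rw [← Nat.map_div_right_divisors, Finset.card_map]
    simp [hcard]
  have h7 := (PNat.coe_injective.summable_iff (f := fun n : ℕ => (n.divisors.card : ℝ) * (n:ℝ) ^ (-s)) (by
    intro x hx
    have : x = 0 := by
      by_contra h
      exact hx ⟨⟨x, Nat.pos_of_ne_zero h⟩, rfl⟩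
    simp [this])).mp h6
  exact h7

lemma summable_fw {k : ℕ} (hk : k = 1 ∨ k = 2) {s : ℝ} (hs : 1 < s) :
    Summable (fun n : ℕ => fw k n * (n:ℝ) ^ (-s)) := by
  rcases hk with rfl | rfl
  · simpa [fw] using Real.summable_nat_rpow.mpr (by linarith : -s < -1)
  · simpa [fw] using summable_card_divisors hs

open Classical in
/-- the summand in the limiting identity -/
noncomputable def gin (k : ℕ) (t s : ℝ) (m : ℕ) : ℝ :=
  if IsDense m t then fw k m * (m : ℝ) ^ (-s) * PP (t * m) s ^ k else 0

lemma gin_nonneg {k : ℕ} {t s : ℝ} (hs : 0 < s) (m : ℕ) : 0 ≤ gin k t s m := by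
  unfold gin
  split_ifs
  · have := (PP_pos (y := t * m) hs).le
    have := fw_nonneg k m
    positivity
  · rfl

lemma identity_inf {k : ℕ} (hk : k = 1 ∨ k = 2) {t s : ℝ} (ht : 1 ≤ t) (hs : 1 < s) :
    HasSum (gin k t s) 1 := by
  have hs0 : 0 < s := by linarith
  have hle : ∀ (a : ℝ) (m : ℕ), fw k m * (m:ℝ) ^ (-s) * PP a s ^ k ≤ fw k m * (m:ℝ) ^ (-s) := by
    intro a m
    have := fw_nonneg k m
    apply mul_le_of_le_one_right (by positivity)
    exact pow_le_one₀ (PP_pos hs0).le (PP_le_one hs0)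
  have hsum : Summable (gin k t s) := by
    refine Summable.of_nonneg_of_le (gin_nonneg hs0) ?_ (summable_fw hk hs)
    intro m
    unfold gin
    split_ifs
    · exact hle _ _
    · have := fw_nonneg k m
      positivity
  have hT : Filter.Tendsto (fun N : ℕ => ∑' m, gid k t s N m) Filter.atTop
      (nhds (∑' m, gin k t s m)) := by
    refine tendsto_tsum_of_dominated_convergence (summable_fw hk hs) ?_ ?_
    · intro m
      apply tendsto_const_nhds.congr'
      filter_upwards [Filter.eventually_ge_atTop (max m ⌈t * m⌉₊)] with N hN
      have h1 : m ≤ N := (le_max_left _ _).trans hN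
      have h2 : t * m ≤ N := (Nat.le_ceil _).trans (by exact_mod_cast (le_max_right _ _).trans hN)
      unfold gin gid
      rw [min_eq_left h2]
      by_cases hd : IsDense m t
      · rw [if_pos hd, if_pos ⟨hd, Nat.mem_smoothNumbers_of_lt hd.1 (by omega)⟩]
      · rw [if_neg hd, if_neg (by tauto)]
    · filter_upwards with N m
      rw [Real.norm_of_nonneg (gid_nonneg hs0 N m)]
      unfold gid
      split_ifs
      · exact hle _ _
      · have := fw_nonneg k m
        positivity
  have h1 : ∀ N, ∑' m, gid k t s N m = 1 := fun N => (identity_hasSum hk ht hs0 N).tsum_eq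
  simp_rw [h1] at hT
  rw [tendsto_nhds_unique tendsto_const_nhds hT]
  exact hsum.hasSum

lemma sum_primesLE_eq (F : ℕ → ℝ) (N : ℕ) :
    ∑ p ∈ Nat.primesLE N, F p = ∑ i ∈ Finset.range N, if (i + 1).Prime then F (i + 1) else 0 := by
  rw [Nat.primesLE_eq_filter_range, Finset.sum_filter, Finset.sum_range_succ']
  simp [Nat.not_prime_zero]

lemma abel_ineq {b g : ℕ → ℝ} {C M : ℝ} (hb : ∀ n, |∑ i ∈ Finset.range n, b i| ≤ C)
    (hg0 : ∀ i, 0 ≤ g i) (N : ℕ) (hM : 0 ≤ M) (hgM : ∀ i < N, g i ≤ M) (hmono : Monotone g ∨ Antitone g) :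
    |∑ i ∈ Finset.range N, g i * b i| ≤ 2 * C * M := by
  have hC : 0 ≤ C := (abs_nonneg _).trans (hb 0)
  rcases Nat.eq_zero_or_pos N with rfl | hN
  · simp
    positivity
  have h := Finset.sum_range_by_parts g b N
  simp only [smul_eq_mul] at h
  rw [h]
  have h1 : |g (N - 1) * ∑ i ∈ Finset.range N, b i| ≤ g (N - 1) * C := by
    rw [abs_mul, abs_of_nonneg (hg0 _)]
    exact mul_le_mul_of_nonneg_left (hb N) (hg0 _)
  have h2 : |∑ i ∈ Finset.range (N - 1), (g (i + 1) - g i) * ∑ j ∈ Finset.range (i + 1), b j| ≤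
      C * ∑ i ∈ Finset.range (N - 1), |g (i + 1) - g i| := by
    refine (Finset.abs_sum_le_sum_abs _ _).trans ?_
    rw [Finset.mul_sum]
    apply Finset.sum_le_sum
    intro i _
    rw [abs_mul, mul_comm C]
    exact mul_le_mul_of_nonneg_left (hb _) (abs_nonneg _)
  have h3 : ∑ i ∈ Finset.range (N - 1), |g (i + 1) - g i| = |g (N - 1) - g 0| := by
    rcases hmono with hm | hm
    · rw [← Finset.sum_range_sub, abs_of_nonneg]
      · apply Finset.sum_congr rfl
        intro i _
        rw [abs_of_nonneg]
        linarith [hm (Nat.le_succ i)]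
      · exact Finset.sum_nonneg fun i _ => by linarith [hm (Nat.le_succ i)]
    · rw [← Finset.sum_range_sub, abs_of_nonpos, ← Finset.sum_neg_distrib]
      · apply Finset.sum_congr rfl
        intro i _
        rw [abs_of_nonpos]
        linarith [hm (Nat.le_succ i)]
      · exact Finset.sum_nonpos fun i _ => by linarith [hm (Nat.le_succ i)]
  have h4 : |g (N - 1) - g 0| ≤ 2 * M - g (N - 1) := by
    have := hgM (N - 1) (by omega)
    have := hgM 0 hN
    have := hg0 0
    have := hg0 (N - 1)
    rw [abs_le]; constructor <;> linarith
  rw [h3] at h2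
  have h5 := abs_sub (g (N - 1) * ∑ i ∈ Finset.range N, b i) (∑ i ∈ Finset.range (N - 1), (g (i + 1) - g i) * ∑ j ∈ Finset.range (i + 1), b j)
  have h6 := mul_le_mul_of_nonneg_left h4 hC
  nlinarith

lemma log_div_aux {p : ℕ} (hp : p.Prime) {a : ℝ} (ha : 3 / 4 ≤ a) :
    0 ≤ log p / ((p:ℝ) ^ a - 1) - log p / (p:ℝ) ^ a ∧
    log p / ((p:ℝ) ^ a - 1) - log p / (p:ℝ) ^ a ≤ 10 * (p:ℝ) ^ (-(5/4) : ℝ) := by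
  have hp2 : (2:ℝ) ≤ p := by exact_mod_cast hp.two_le
  have hp0 : (0:ℝ) < p := by linarith
  have hl : 0 ≤ log p := Real.log_nonneg (by linarith)
  set z := (p:ℝ) ^ a with hz
  have hz1 : (p:ℝ) ^ (3/4:ℝ) ≤ z := Real.rpow_le_rpow_of_exponent_le (by linarith) ha
  have hz2 : (5/3:ℝ) ≤ (2:ℝ) ^ (3/4:ℝ) := by
    have h : ((5/3:ℝ) ^ (4:ℕ)) ^ (1/4:ℝ) ≤ ((2:ℝ) ^ (3:ℕ)) ^ (1/4:ℝ) :=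
      Real.rpow_le_rpow (by norm_num) (by norm_num) (by norm_num)
    rw [← Real.rpow_natCast, ← Real.rpow_natCast, ← Real.rpow_mul (by norm_num),
      ← Real.rpow_mul (by norm_num)] at h
    norm_num at h ⊢
    exact h
  have hz3 : (2:ℝ) ^ (3/4:ℝ) ≤ (p:ℝ) ^ (3/4:ℝ) := Real.rpow_le_rpow (by norm_num) hp2 (by norm_num)
  have hz4 : (5/3:ℝ) ≤ z := by linarith
  have heq : log p / (z - 1) - log p / z = log p / (z * (z - 1)) := by
    have : z - 1 ≠ 0 := by linarith
    have : z ≠ 0 := by linarith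
    field_simp; ring
  rw [heq]
  have hzz : 0 < z * (z - 1) := by nlinarith
  refine ⟨by positivity, ?_⟩
  have h1 : log p ≤ (p:ℝ) ^ (1/4:ℝ) / (1/4) := Real.log_le_rpow_div hp0.le (by norm_num)
  rw [div_le_iff₀ hzz]
  have h2 : (2/5) * ((p:ℝ) ^ (3/4:ℝ)) ^ 2 ≤ z * (z - 1) := by
    have : 0 ≤ (p:ℝ) ^ (3/4:ℝ) := by positivity
    nlinarith
  have h3 : ((p:ℝ) ^ (3/4:ℝ)) ^ 2 = (p:ℝ) ^ (3/2:ℝ) := by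
    rw [← Real.rpow_natCast, ← Real.rpow_mul hp0.le]; norm_num
  have h4 : (p:ℝ) ^ (-(5/4):ℝ) * (p:ℝ) ^ (3/2:ℝ) = (p:ℝ) ^ (1/4:ℝ) := by
    rw [← Real.rpow_add hp0]; norm_num
  have h5 : 0 < (p:ℝ) ^ (-(5/4):ℝ) := by positivity
  rw [h3] at h2
  have h6 := mul_le_mul_of_nonneg_left h2 h5.le
  nlinarith

lemma exists_log_div_bound : ∃ C : ℝ, 0 ≤ C ∧ ∀ (N : ℕ) (a : ℝ), 3 / 4 ≤ a →
    0 ≤ ∑ p ∈ Nat.primesLE N, (log p / ((p:ℝ) ^ a - 1) - log p / (p:ℝ) ^ a) ∧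
    ∑ p ∈ Nat.primesLE N, (log p / ((p:ℝ) ^ a - 1) - log p / (p:ℝ) ^ a) ≤ C := by
  have hs : Summable (fun n : ℕ => 10 * (n:ℝ) ^ (-(5/4) : ℝ)) :=
    (Real.summable_nat_rpow.mpr (by norm_num)).mul_left 10
  refine ⟨∑' n : ℕ, 10 * (n:ℝ) ^ (-(5/4) : ℝ), tsum_nonneg fun n => by positivity, fun N a ha => ⟨?_, ?_⟩⟩
  · exact Finset.sum_nonneg fun p hp => (log_div_aux (Nat.prime_of_mem_primesLE hp) ha).1
  · refine le_trans (Finset.sum_le_sum fun p hp =>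
      (log_div_aux (Nat.prime_of_mem_primesLE hp) ha).2) ?_
    exact hs.sum_le_tsum _ fun n _ => by positivity

lemma log_factorial_eq (N : ℕ) : log (N.factorial : ℕ) =
    ∑ p ∈ Nat.primesLE N, (N.factorial.factorization p : ℝ) * log p := by
  rw [Real.log_nat_eq_sum_factorization, Finsupp.sum]
  apply Finset.sum_subset
  · intro p hp
    rw [Nat.support_factorization, Nat.mem_primeFactors] at hp
    rw [Nat.mem_primesLE]
    exact ⟨(hp.1.dvd_factorial).mp hp.2.1, hp.1⟩
  · intro p hp hp2
    rw [Finsupp.notMem_support_iff] at hp2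
    simp [hp2]

lemma mertens_one : ∃ C : ℝ, 0 ≤ C ∧ ∀ N : ℕ, 1 ≤ N →
    |∑ p ∈ Nat.primesLE N, log p / p - log N| ≤ C := by
  obtain ⟨C, hC, hb⟩ := exists_log_div_bound
  refine ⟨C + 6, by linarith, fun N hN => ?_⟩
  have hN0 : (0:ℝ) < N := by exact_mod_cast hN
  have hlog4 : log 4 ≤ 4 := by
    have := Real.log_le_sub_one_of_pos (show (0:ℝ) < 4 by norm_num); linarith
  have h1 : log (N.factorial : ℕ) ≤ N * log N := by
    rw [← Real.log_pow]
    apply Real.log_le_log (by positivity)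
    exact_mod_cast Nat.factorial_le_pow N
  have h2 : N * log N - N ≤ log (N.factorial : ℕ) := by
    have := Stirling.le_log_factorial_stirling (n := N) (by omega)
    have h3 : 0 ≤ log N := Real.log_nonneg (by exact_mod_cast hN)
    have h4 : 0 ≤ log (2 * π) := Real.log_nonneg (by nlinarith [Real.pi_gt_three])
    linarith
  have hup : N * ∑ p ∈ Nat.primesLE N, log p / p ≤ log (N.factorial : ℕ) + Chebyshev.theta N := by
    rw [log_factorial_eq, Chebyshev.theta_eq_sum_primesLE_log, Finset.mul_sum, ← Finset.sum_add_distrib]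
    apply Finset.sum_le_sum
    intro p hp
    have hpp := Nat.prime_of_mem_primesLE hp
    have hp0 : (0:ℝ) < p := by exact_mod_cast hpp.pos
    have hl : 0 ≤ log p := Real.log_nonneg (by exact_mod_cast hpp.one_lt.le)
    have h5 : N / p ≤ N.factorial.factorization p := by
      have hpN := Nat.le_of_mem_primesLE hp
      rw [Nat.factorization_factorial hpp (Nat.lt_succ_self _)]
      have := Finset.single_le_sum (f := fun i => N / p ^ i) (s := Finset.Ico 1 (Nat.log p N).succ)
        (fun i _ => Nat.zero_le _) (a := 1) (by
          simp; exact ⟨hpN, hpp.one_lt⟩)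
      simpa using this
    have h6 : (N:ℝ) / p ≤ (N.factorial.factorization p : ℝ) + 1 := by
      have h7 : (N:ℝ) / p < ((N / p : ℕ) : ℝ) + 1 := by
        rw [div_lt_iff₀ hp0]
        have := Nat.lt_div_mul_add (a := N) hpp.pos
        have : N < (N / p + 1) * p := by linarith
        exact_mod_cast this
      have h8 : ((N / p : ℕ) : ℝ) ≤ (N.factorial.factorization p : ℝ) := by exact_mod_cast h5
      linarith
    have := mul_le_mul_of_nonneg_right h6 hl
    calc (N:ℝ) * (log p / p) = N / p * log p := by ring
      _ ≤ _ := this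
      _ = _ := by ring
  have hlow : log (N.factorial : ℕ) ≤ N * ∑ p ∈ Nat.primesLE N, log p / (p - 1) := by
    rw [log_factorial_eq, Finset.mul_sum]
    apply Finset.sum_le_sum
    intro p hp
    have hpp := Nat.prime_of_mem_primesLE hp
    have hp1 : (1:ℝ) < p := by exact_mod_cast hpp.one_lt
    have hl : 0 ≤ log p := Real.log_nonneg hp1.le
    have h5 := Nat.factorization_factorial_le_div_pred hpp N
    have h6 : (N.factorial.factorization p : ℝ) ≤ N / (p - 1) := by
      have h7 : ((N / (p - 1) : ℕ) : ℝ) ≤ (N:ℝ) / ((p - 1 : ℕ) : ℝ) := Nat.cast_div_le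
      rw [Nat.cast_sub hpp.one_lt.le, Nat.cast_one] at h7
      exact le_trans (by exact_mod_cast h5) h7
    calc _ ≤ (N:ℝ) / (p - 1) * log p := mul_le_mul_of_nonneg_right h6 hl
      _ = _ := by ring
  have hth := Chebyshev.theta_le_log4_mul_x hN0.le
  have hb1 := (hb N 1 (by norm_num)).2
  simp only [Real.rpow_one] at hb1
  rw [Finset.sum_sub_distrib] at hb1
  set A := ∑ p ∈ Nat.primesLE N, log p / p
  set B := ∑ p ∈ Nat.primesLE N, log p / ((p:ℝ) - 1)
  rw [abs_le]
  constructor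
  · have : N * (log N - 1) ≤ N * B := by linarith
    have := le_of_mul_le_mul_left this hN0
    linarith
  · have : N * A ≤ N * (log N + 4) := by nlinarith
    have := le_of_mul_le_mul_left this hN0
    linarith

noncomputable def e1 (z : ℝ) : ℝ := ∫ r in (0:ℝ)..1, exp (-z * r)

noncomputable def EE (x : ℝ) : ℝ := ∫ z in (0:ℝ)..x, e1 z

lemma e1_continuous : Continuous e1 := by
  unfold e1
  apply intervalIntegral.continuous_parametric_intervalIntegral_of_continuous'
  fun_prop

lemma e1_zero : e1 0 = 1 := by simp [e1]

lemma mul_e1 (z : ℝ) : z * e1 z = 1 - exp (-z) := by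
  unfold e1
  rw [← intervalIntegral.integral_const_mul]
  have h := intervalIntegral.integral_eq_sub_of_hasDerivAt (a := 0) (b := 1)
    (f := fun r => -exp (-z * r)) (f' := fun r => z * exp (-z * r)) (by
      intro r _
      have : HasDerivAt (fun r => -exp (-z * r)) (-(exp (-z * r) * (-z * 1))) r :=
        ((hasDerivAt_id r).const_mul (-z)).exp.neg
      exact this.congr_deriv (by ring)) ((by fun_prop : Continuous fun r => z * exp (-z * r)).intervalIntegrable _ _)
  rw [h]; simp; ring

lemma e1_antitone : Antitone e1 := by
  intro a b hab
  unfold e1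
  apply intervalIntegral.integral_mono_on (by norm_num)
  · exact (by fun_prop : Continuous fun r => exp (-b * r)).intervalIntegrable _ _
  · exact (by fun_prop : Continuous fun r => exp (-a * r)).intervalIntegrable _ _
  · intro r hr
    apply Real.exp_le_exp.mpr
    nlinarith [hr.1]

lemma e1_pos (z : ℝ) : 0 < e1 z := by
  unfold e1
  apply intervalIntegral.intervalIntegral_pos_of_pos
  · exact (by fun_prop : Continuous fun r => exp (-z * r)).intervalIntegrable _ _
  · intro r; positivity
  · norm_num

lemma e1_le_exp {z : ℝ} (hz : -1 ≤ z) : e1 z ≤ exp 1 := by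
  refine (e1_antitone hz).trans ?_
  have := mul_e1 (-1)
  simp at this
  linarith

lemma EE_hasDerivAt (x : ℝ) : HasDerivAt EE (e1 x) x := by
  unfold EE
  exact intervalIntegral.integral_hasDerivAt_right (e1_continuous.intervalIntegrable _ _)
    (e1_continuous.stronglyMeasurableAtFilter _ _) e1_continuous.continuousAt

lemma EE_zero : EE 0 = 0 := by simp [EE]

lemma EE_continuous : Continuous EE :=
  continuous_iff_continuousAt.mpr fun x => (EE_hasDerivAt x).continuousAt

lemma EE_mono : Monotone EE := by
  apply monotone_of_deriv_nonneg (fun x => (EE_hasDerivAt x).differentiableAt)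
  intro x
  rw [(EE_hasDerivAt x).deriv]; exact (e1_pos x).le

lemma EE_le_self {x : ℝ} (hx : 0 ≤ x) : EE x ≤ x := by
  have h : AntitoneOn (fun x => EE x - x) (Set.Ici 0) := by
    have hc : ContinuousOn (fun x => EE x - x) (Set.Ici 0) :=
      (EE_continuous.sub continuous_id).continuousOn
    apply antitoneOn_of_deriv_nonpos (convex_Ici 0) hc
    · intro x _
      exact ((EE_hasDerivAt x).sub (hasDerivAt_id x)).differentiableAt.differentiableWithinAt
    · intro x hx
      rw [(show HasDerivAt (fun x => EE x - x) (e1 x - 1) x from (EE_hasDerivAt x).sub (hasDerivAt_id x)).deriv]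
      rw [interior_Ici] at hx
      have := e1_antitone (le_of_lt hx : (0:ℝ) ≤ x)
      rw [e1_zero] at this
      linarith
  have := h (Set.mem_Ici.mpr le_rfl) (Set.mem_Ici.mpr hx) hx
  simp only [EE_zero] at this
  linarith

lemma EE_log_upper {x : ℝ} (hx : 1 ≤ x) : EE x ≤ log x + 1 := by
  have h : AntitoneOn (fun x => EE x - log x) (Set.Ici 1) := by
    have hd : ∀ x ∈ Set.Ici (1:ℝ), HasDerivAt (fun x => EE x - log x) (e1 x - x⁻¹) x := by
      intro x hx
      have : (1:ℝ) ≤ x := hx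
      exact (EE_hasDerivAt x).sub (Real.hasDerivAt_log (by linarith))
    apply antitoneOn_of_deriv_nonpos (convex_Ici 1)
    · exact fun x hx => (hd x hx).continuousAt.continuousWithinAt
    · intro x hx
      exact (hd x (interior_subset hx)).differentiableAt.differentiableWithinAt
    · intro x hx
      have hx := interior_subset hx
      rw [(hd x hx).deriv]
      have hx1 : (1:ℝ) ≤ x := hx
      have h1 := mul_e1 x
      have h2 := Real.exp_pos (-x)
      rw [sub_nonpos, ← one_div, le_div_iff₀ (by linarith)]
      linarith
  have := h (Set.mem_Ici.mpr le_rfl) (Set.mem_Ici.mpr hx) hx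
  simp only [Real.log_one] at this
  have := EE_le_self (zero_le_one)
  linarith

lemma EE_log_lower {x : ℝ} (hx : 1 ≤ x) : log x - 1 ≤ EE x := by
  have h : MonotoneOn (fun x => EE x - log x - exp (-x)) (Set.Ici 1) := by
    have hd : ∀ x ∈ Set.Ici (1:ℝ), HasDerivAt (fun x => EE x - log x - exp (-x)) (e1 x - x⁻¹ - (exp (-x) * -1)) x := by
      intro x hx
      have : (1:ℝ) ≤ x := hx
      exact ((EE_hasDerivAt x).sub (Real.hasDerivAt_log (by linarith))).sub ((hasDerivAt_neg x).exp)
    apply monotoneOn_of_deriv_nonneg (convex_Ici 1)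
    · exact fun x hx => (hd x hx).continuousAt.continuousWithinAt
    · intro x hx
      exact (hd x (interior_subset hx)).differentiableAt.differentiableWithinAt
    · intro x hx
      have hx := interior_subset hx
      rw [(hd x hx).deriv]
      have hx1 : (1:ℝ) ≤ x := hx
      have h1 := mul_e1 x
      have h2 := Real.exp_pos (-x)
      have : e1 x = (1 - exp (-x)) * x⁻¹ := by
        field_simp; linarith
      rw [this]
      have : x⁻¹ ≤ 1 := inv_le_one_of_one_le₀ hx1
      nlinarith
  have := h (Set.mem_Ici.mpr le_rfl) (Set.mem_Ici.mpr hx) hx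
  simp only [Real.log_one] at this
  have h2 := EE_mono (zero_le_one)
  rw [EE_zero] at h2
  have h3 : exp (-1) ≤ 1 := Real.exp_le_one_iff.mpr (by norm_num)
  have := Real.exp_pos (-x)
  linarith

lemma sum_rpow_approx {N : ℕ} (hN : 1 ≤ N) {w : ℝ} (hw : -1 ≤ w) :
    |∑ i ∈ Finset.range N, ((i:ℝ) + 1) ^ (-1 - w) - log N * e1 (w * log N)| ≤ 1 := by
  have hN0 : (0:ℝ) < N := by exact_mod_cast hN
  have hN1 : (1:ℝ) ≤ N := by exact_mod_cast hN
  have hint : ∫ u in (1:ℝ)..N, u ^ (-1 - w) = log N * e1 (w * log N) := by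
    by_cases hw0 : w = 0
    · subst hw0
      simp only [sub_zero, zero_mul, e1_zero, mul_one]
      simp only [Real.rpow_neg_one]
      rw [integral_inv_of_pos one_pos hN0]; simp
    · rw [integral_rpow]
      · have := mul_e1 (w * log N)
        have h2 : log N * e1 (w * log N) = (1 - exp (-(w * log N))) / w := by
          rw [eq_div_iff hw0, ← this]; ring
        rw [h2, Real.rpow_def_of_pos hN0]
        simp only [Real.one_rpow]
        have : (-1 - w + 1) = -w := by ring
        rw [this]
        have : log N * -w = -(w * log N) := by ring
        rw [this]
        field_simp; ring
      · right
        refine ⟨by intro h; apply hw0; linarith, ?_⟩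
        rw [Set.uIcc_of_le hN1]
        intro h; linarith [h.1]
  have hanti : AntitoneOn (fun u : ℝ => u ^ (-1 - w)) (Set.Icc (1:ℝ) (1 + ((N - 1 : ℕ):ℝ))) := by
    intro a ha b hb hab
    exact Real.rpow_le_rpow_of_nonpos (by linarith [ha.1]) hab (by linarith)
  have h1 := hanti.integral_le_sum
  have h2 := hanti.sum_le_integral
  have hcast : (1:ℝ) + ((N - 1 : ℕ):ℝ) = N := by
    rw [Nat.cast_sub hN]; simp
  rw [hcast, hint] at h1 h2
  obtain ⟨M, rfl⟩ : ∃ M, N = M + 1 := ⟨N - 1, by omega⟩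
  simp only [Nat.add_sub_cancel] at h1 h2
  have e1' : ∑ i ∈ Finset.range (M + 1), ((i:ℝ) + 1) ^ (-1 - w) =
      ∑ i ∈ Finset.range M, ((i:ℝ) + 1) ^ (-1 - w) + ((M:ℝ) + 1) ^ (-1 - w) := Finset.sum_range_succ _ _
  have e2' : ∑ i ∈ Finset.range (M + 1), ((i:ℝ) + 1) ^ (-1 - w) =
      ∑ i ∈ Finset.range M, ((i + 1 : ℕ) + 1 : ℝ) ^ (-1 - w) + ((0 : ℕ) + 1 : ℝ) ^ (-1 - w) := Finset.sum_range_succ' _ _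
  have e3 : ∑ i ∈ Finset.range M, (1 + (i:ℝ)) ^ (-1 - w) = ∑ i ∈ Finset.range M, ((i:ℝ) + 1) ^ (-1 - w) := by
    simp_rw [add_comm]
  have e4 : ∑ i ∈ Finset.range M, (1 + ((i + 1 : ℕ):ℝ)) ^ (-1 - w) = ∑ i ∈ Finset.range M, ((i + 1 : ℕ) + 1 : ℝ) ^ (-1 - w) := by
    apply Finset.sum_congr rfl; intro i _; rw [add_comm]
  have : 0 ≤ ((M:ℝ) + 1) ^ (-1 - w) := by positivity
  simp only [Nat.cast_zero, zero_add, Real.one_rpow] at e2'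
  rw [abs_le]
  constructor
  · linarith
  · linarith

lemma logderiv_bound : ∃ C : ℝ, 0 ≤ C ∧ ∀ (N : ℕ) (w : ℝ), 1 ≤ N → -(1/4) ≤ w → -1 ≤ w * log N →
    |∑ p ∈ Nat.primesLE N, log p / ((p:ℝ) ^ (1 + w) - 1) - log N * e1 (w * log N)| ≤ C := by
  obtain ⟨C1, hC1, hb1⟩ := exists_log_div_bound
  obtain ⟨C2, hC2, hb2⟩ := mertens_one
  refine ⟨C1 + 2 * (C2 + 1) * exp 1 + 1, by positivity, fun N w hN hw hwN => ?_⟩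
  have hN0 : (0:ℝ) < N := by exact_mod_cast hN
  set b : ℕ → ℝ := fun i => (if (i + 1).Prime then log ((i + 1 : ℕ) : ℝ) / ((i + 1 : ℕ) : ℝ) else 0) - ((i:ℝ) + 1)⁻¹ with hbdef
  have hb : ∀ n, |∑ i ∈ Finset.range n, b i| ≤ C2 + 1 := by
    intro n
    rcases Nat.eq_zero_or_pos n with rfl | hn
    · simp; linarith
    rw [hbdef, Finset.sum_sub_distrib, ← sum_primesLE_eq (fun p => log p / p)]
    have h1 := hb2 n hn
    have h2 := log_add_one_le_harmonic n
    have h3 := harmonic_le_one_add_log n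
    have h4 : ((harmonic n : ℚ) : ℝ) = ∑ i ∈ Finset.range n, ((i:ℝ) + 1)⁻¹ := by
      simp [harmonic]
    have h5 : log n ≤ log ((n + 1 : ℕ) : ℝ) := Real.log_le_log (by exact_mod_cast hn) (by push_cast; linarith)
    rw [h4] at h2 h3
    rw [abs_le] at h1 ⊢
    constructor <;> linarith
  set g : ℕ → ℝ := fun i => ((i:ℝ) + 1) ^ (-w) with hgdef
  have hab := abel_ineq (b := b) (g := g) (M := exp 1) hb (fun i => by positivity) N (by positivity)
    (by
      intro i hi
      have hi1 : (i:ℝ) + 1 ≤ N := by exact_mod_cast hi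
      rcases le_total 0 w with h | h
      · refine (Real.rpow_le_one_of_one_le_of_nonpos (by linarith [(Nat.cast_nonneg i : (0:ℝ) ≤ i)]) (by linarith)).trans ?_
        exact Real.one_le_exp (by norm_num)
      · refine (Real.rpow_le_rpow (by positivity) hi1 (by linarith)).trans ?_
        rw [Real.rpow_def_of_pos hN0]
        apply Real.exp_le_exp.mpr; linarith)
    (by
      rcases le_total 0 w with h | h
      · right
        intro i j hij
        apply Real.rpow_le_rpow_of_nonpos (by positivity) _ (by linarith)
        have : (i:ℝ) ≤ j := by exact_mod_cast hij
        linarith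
      · left
        intro i j hij
        apply Real.rpow_le_rpow (by positivity) _ (by linarith)
        have : (i:ℝ) ≤ j := by exact_mod_cast hij
        linarith)
  have hgb : ∑ i ∈ Finset.range N, g i * b i = ∑ p ∈ Nat.primesLE N, log p / (p:ℝ) ^ (1 + w) -
      ∑ i ∈ Finset.range N, ((i:ℝ) + 1) ^ (-1 - w) := by
    rw [sum_primesLE_eq (fun p => log p / (p:ℝ) ^ (1 + w)), ← Finset.sum_sub_distrib]
    apply Finset.sum_congr rfl
    intro i _
    have hi : (0:ℝ) < (i:ℝ) + 1 := by positivity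
    have h1 : ((i:ℝ) + 1) ^ (-1 - w) = ((i:ℝ) + 1) ^ (-w) * ((i:ℝ) + 1)⁻¹ := by
      rw [← Real.rpow_neg_one, ← Real.rpow_add hi]; congr 1; ring
    have h2 : ((i:ℝ) + 1) ^ (1 + w) = ((i:ℝ) + 1) * (((i:ℝ) + 1) ^ (-w))⁻¹ := by
      rw [Real.rpow_neg hi.le, inv_inv, Real.rpow_add hi, Real.rpow_one]
    simp only [hgdef, hbdef]
    rw [h1]
    push_cast
    rw [h2]
    split_ifs
    · have : ((i:ℝ) + 1) ^ (-w) ≠ 0 := by positivity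
      field_simp
    · ring
  rw [hgb] at hab
  have h3 := sum_rpow_approx hN (w := w) (by linarith)
  have h4 := hb1 N (1 + w) (by linarith)
  rw [Finset.sum_sub_distrib] at h4
  rw [abs_le] at hab h3 ⊢
  constructor <;> linarith [h4.1, h4.2, hab.1, hab.2, h3.1, h3.2]

lemma EE_lip {a b : ℝ} (ha : -1 ≤ a) (hb : -1 ≤ b) : |EE a - EE b| ≤ exp 1 * |a - b| := by
  have := Convex.norm_image_sub_le_of_norm_hasDerivWithin_le (f := EE) (f' := e1) (C := exp 1)
    (s := Set.Ici (-1)) (fun x _ => (EE_hasDerivAt x).hasDerivWithinAt)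
    (fun x hx => by rw [Real.norm_of_nonneg (e1_pos x).le]; exact e1_le_exp hx)
    (convex_Ici _) (x := b) (y := a) hb ha
  simpa [Real.norm_eq_abs] using this

lemma log_PP_hasDerivAt (N : ℕ) {w : ℝ} (hw : -1 < w) :
    HasDerivAt (fun w => log (PP N (1 + w))) (∑ p ∈ Nat.primesLE N, log p / ((p:ℝ) ^ (1 + w) - 1)) w := by
  have h1 : ∀ p ∈ Nat.primesLE N, HasDerivAt (fun w => log (1 - (p:ℝ) ^ (-(1 + w))))
      (log p / ((p:ℝ) ^ (1 + w) - 1)) w := by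
    intro p hp
    have hpp := Nat.prime_of_mem_primesLE hp
    have hp0 : (0:ℝ) < p := by exact_mod_cast hpp.pos
    have hlt := prime_rpow_lt_one hpp (s := 1 + w) (by linarith)
    have h2 : HasDerivAt (fun w : ℝ => (p:ℝ) ^ (-(1 + w))) ((p:ℝ) ^ (-(1 + w)) * log p * (-1)) w := by
      have h3 : HasDerivAt (fun w : ℝ => -(1 + w)) (-1) w := ((hasDerivAt_id w).const_add 1).neg
      have h4 := h3.const_rpow hp0
      exact h4.congr_deriv (by ring)
    have h5 := (h2.const_sub 1).log (by linarith)
    refine h5.congr_deriv ?_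
    have h6 : (p:ℝ) ^ (-(1 + w)) = ((p:ℝ) ^ (1 + w))⁻¹ := Real.rpow_neg hp0.le _
    rw [h6] at hlt ⊢
    have h7 : 0 < (p:ℝ) ^ (1 + w) := by positivity
    have h8 : 1 < (p:ℝ) ^ (1 + w) := by
      by_contra h
      exact absurd (one_le_inv_iff₀.mpr ⟨h7, not_lt.mp h⟩) (not_le.mpr hlt)
    have h9 : (p:ℝ) ^ (1 + w) - 1 ≠ 0 := by linarith
    field_simp
  have h2 := HasDerivAt.fun_sum h1
  refine h2.congr_of_eventuallyEq ?_
  filter_upwards [lt_mem_nhds hw] with v hv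
  unfold PP
  rw [Nat.floor_natCast, Real.log_prod]
  intro p hp
  have := prime_rpow_lt_one (Nat.prime_of_mem_primesLE hp) (s := 1 + v) (by linarith)
  linarith

lemma PP_floor (y s : ℝ) : PP y s = PP (⌊y⌋₊ : ℝ) s := by
  unfold PP; rw [Nat.floor_natCast]

lemma PP_expand : ∃ C : ℝ, 0 ≤ C ∧ ∀ y ε : ℝ, 1 ≤ y → -(1/4) ≤ ε → -1 ≤ ε * log y →
    |log (PP y (1 + ε)) - log (PP y 1) - EE (ε * log y)| ≤ C * |ε| := by
  obtain ⟨C, hC, hb⟩ := logderiv_bound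
  refine ⟨C + exp 1, by positivity, fun y ε hy hε hεy => ?_⟩
  rw [PP_floor y, PP_floor y]
  set N := ⌊y⌋₊ with hN
  have hN1 : 1 ≤ N := Nat.le_floor (by simpa using hy)
  have hN0 : (0:ℝ) < N := by exact_mod_cast hN1
  have hNy : (N:ℝ) ≤ y := Nat.floor_le (by linarith)
  have hyN : y < N + 1 := Nat.lt_floor_add_one y
  have hlN : 0 ≤ log N := Real.log_nonneg (by exact_mod_cast hN1)
  have hl1 : log N ≤ log y := Real.log_le_log hN0 hNy
  have hl2 : log y - log N ≤ 1 := by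
    rw [← Real.log_div (by linarith) (by linarith)]
    have h1 : y / N ≤ 2 := by
      rw [div_le_iff₀ hN0]
      have : (1:ℝ) ≤ N := by exact_mod_cast hN1
      linarith
    have := Real.log_le_sub_one_of_pos (x := y / N) (by positivity)
    linarith
  have hεN : -1 ≤ ε * log N := by
    rcases le_total 0 ε with h | h
    · have := mul_nonneg h hlN; linarith
    · nlinarith
  set S := Set.uIcc 0 ε
  have hS : ∀ w ∈ S, -(1/4) ≤ w ∧ -1 ≤ w * log N := by
    intro w hw
    rcases le_total 0 ε with h | h
    · rw [show S = Set.Icc 0 ε from Set.uIcc_of_le h] at hw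
      exact ⟨by linarith [hw.1], by have := mul_nonneg hw.1 hlN; linarith⟩
    · rw [show S = Set.Icc ε 0 from Set.uIcc_of_ge h] at hw
      exact ⟨by linarith [hw.1], by nlinarith [hw.1]⟩
  have hmv := Convex.norm_image_sub_le_of_norm_hasDerivWithin_le
    (f := fun w => log (PP N (1 + w)) - EE (w * log N))
    (f' := fun w => ∑ p ∈ Nat.primesLE N, log p / ((p:ℝ) ^ (1 + w) - 1) - log N * e1 (w * log N))
    (C := C) (s := S)
    (fun w hw => by
      have h1 := log_PP_hasDerivAt N (w := w) (by linarith [(hS w hw).1])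
      have h2 : HasDerivAt (fun w => w * log N) (log N) w := by
        simpa using (hasDerivAt_id w).mul_const (log N)
      have h3 := (EE_hasDerivAt (w * log N)).comp w h2
      rw [mul_comm (log (N:ℝ))]
      exact (h1.sub h3).hasDerivWithinAt)
    (fun w hw => hb N w hN1 (hS w hw).1 (hS w hw).2)
    (convex_uIcc _ _) (x := 0) (y := ε) Set.left_mem_uIcc Set.right_mem_uIcc
  simp only [Real.norm_eq_abs, add_zero, zero_mul, EE_zero, sub_zero] at hmv
  have hl := EE_lip hεN hεy
  have h3 : |ε * log N - ε * log y| ≤ |ε| := by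
    rw [← mul_sub, abs_mul]
    apply mul_le_of_le_one_right (abs_nonneg _)
    rw [abs_le]; constructor <;> linarith
  have h4 : |EE (ε * log N) - EE (ε * log y)| ≤ exp 1 * |ε| :=
    hl.trans (mul_le_mul_of_nonneg_left h3 (Real.exp_pos 1).le)
  rw [abs_le] at hmv h4 ⊢
  constructor <;> linarith [hmv.1, hmv.2, h4.1, h4.2]

lemma PP_two_lower : ∃ C : ℝ, 0 ≤ C ∧ ∀ y : ℝ, -C ≤ log (PP y 2) := by
  have hs : Summable (fun n : ℕ => 2 * (n:ℝ) ^ (-2 : ℝ)) :=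
    (Real.summable_nat_rpow.mpr (by norm_num)).mul_left 2
  refine ⟨∑' n : ℕ, 2 * (n:ℝ) ^ (-2 : ℝ), tsum_nonneg fun n => by positivity, fun y => ?_⟩
  unfold PP
  rw [Real.log_prod]
  · have h1 := hs.sum_le_tsum (Nat.primesLE ⌊y⌋₊) fun n _ => by positivity
    refine (neg_le_neg h1).trans ?_
    rw [← Finset.sum_neg_distrib]
    apply Finset.sum_le_sum
    intro p hp
    have hpp := Nat.prime_of_mem_primesLE hp
    have hp2 : (2:ℝ) ≤ p := by exact_mod_cast hpp.two_le
    have hx : (p:ℝ) ^ (-2:ℝ) ≤ 1 / 2 := by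
      rw [Real.rpow_neg (by linarith), Real.rpow_two, ← one_div]
      apply one_div_le_one_div_of_le (by norm_num); nlinarith
    have hx0 : 0 ≤ (p:ℝ) ^ (-2:ℝ) := by positivity
    set x := (p:ℝ) ^ (-2:ℝ)
    have h2 := Real.one_sub_inv_le_log_of_pos (x := 1 - x) (by linarith)
    refine le_trans ?_ h2
    rw [neg_le_sub_iff_le_add, inv_le_iff_one_le_mul₀ (by linarith)]
    nlinarith
  · intro p hp
    have := prime_rpow_lt_one (Nat.prime_of_mem_primesLE hp) (s := 2) (by norm_num)
    linarith

lemma PP_one_log : ∃ C : ℝ, 0 ≤ C ∧ ∀ y : ℝ, 2 ≤ y → |log (PP y 1) + log (log y)| ≤ C := by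
  obtain ⟨C1, hC1, h1⟩ := PP_expand
  obtain ⟨C2, hC2, h2⟩ := PP_two_lower
  refine ⟨C1 + C2 + 2, by positivity, fun y hy => ?_⟩
  have hl2 : (1/2:ℝ) ≤ log 2 := by linarith [Real.log_two_gt_d9]
  have hl : log 2 ≤ log y := Real.log_le_log (by norm_num) hy
  have h3 := h1 y 1 (by linarith) (by norm_num) (by linarith)
  have h4 := h2 y
  have h5 : log (PP y 2) ≤ 0 := Real.log_nonpos (PP_pos (by norm_num)).le (PP_le_one (by norm_num))
  have h6 : |EE (log y) - log (log y)| ≤ 2 := by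
    rcases le_total 1 (log y) with h | h
    · have := EE_log_upper h
      have := EE_log_lower h
      rw [abs_le]; constructor <;> linarith
    · have a1 := EE_mono (by linarith : 0 ≤ log y)
      rw [EE_zero] at a1
      have a2 := EE_le_self (by linarith : 0 ≤ log y)
      have a3 : log (log y) ≤ 0 := Real.log_nonpos (by linarith) h
      have a4 := Real.one_sub_inv_le_log_of_pos (x := log y) (by linarith)
      have a5 : (log y)⁻¹ ≤ 2 := by
        rw [inv_le_comm₀ (by linarith) (by norm_num)]; linarith
      rw [abs_le]; constructor <;> linarith
  norm_num at h3
  rw [abs_le] at h3 h6 ⊢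
  constructor <;> linarith [h3.1, h3.2, h6.1, h6.2]

/-- multiplicative form -/
lemma PP_one_bounds : ∃ c C : ℝ, 0 < c ∧ 0 < C ∧ ∀ y : ℝ, 2 ≤ y →
    c ≤ PP y 1 * log y ∧ PP y 1 * log y ≤ C := by
  obtain ⟨C, hC, h⟩ := PP_one_log
  refine ⟨exp (-C), exp C, Real.exp_pos _, Real.exp_pos _, fun y hy => ?_⟩
  have hl : 0 < log y := Real.log_pos (by linarith)
  have hP : 0 < PP y 1 := PP_pos one_pos
  have h1 := abs_le.mp (h y hy)
  rw [← Real.log_mul hP.ne' hl.ne'] at h1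
  have hpos : 0 < PP y 1 * log y := by positivity
  exact ⟨(Real.le_log_iff_exp_le hpos).mp h1.1, (Real.log_le_iff_le_exp hpos).mp h1.2⟩

noncomputable def nu (k : ℕ) (t : ℝ) (n : ℕ) : ℝ := gin k t 1 n

noncomputable def ell (t : ℝ) (n : ℕ) : ℝ := log (t * n)

noncomputable def kap (k : ℕ) (x : ℝ) : ℝ := exp (k * EE x - x)

lemma nu_nonneg (k : ℕ) (t : ℝ) (n : ℕ) : 0 ≤ nu k t n := gin_nonneg one_pos n

lemma kap_pos (k : ℕ) (x : ℝ) : 0 < kap k x := Real.exp_pos _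

lemma kap_continuous (k : ℕ) : Continuous (kap k) := by
  unfold kap
  exact Real.continuous_exp.comp ((continuous_const.mul EE_continuous).sub continuous_id)

lemma kap_zero (k : ℕ) : kap k 0 = 1 := by simp [kap, EE_zero]

lemma nu_ne_zero {k : ℕ} {t : ℝ} {n : ℕ} (h : nu k t n ≠ 0) : IsDense n t := by
  unfold nu gin at h
  by_contra hd
  simp [hd] at h

lemma nu_zero_of_not {k : ℕ} {t : ℝ} {n : ℕ} (h : ¬ IsDense n t) : nu k t n = 0 := by
  by_contra h2; exact h (nu_ne_zero h2)

lemma nu_dense {k : ℕ} {t : ℝ} {n : ℕ} (h : IsDense n t) :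
    nu k t n = fw k n / n * PP (t * n) 1 ^ k := by
  unfold nu gin
  rw [if_pos h, Real.rpow_neg_one]; rfl

lemma ell_ge {t : ℝ} (ht : 2 ≤ t) {n : ℕ} (hn : 0 < n) : log t ≤ ell t n := by
  unfold ell
  apply Real.log_le_log (by linarith)
  have : (1:ℝ) ≤ n := by exact_mod_cast hn
  nlinarith

lemma log_t_ge {t : ℝ} (ht : 2 ≤ t) : (1/2 : ℝ) ≤ log t := by
  have := Real.log_le_log (by norm_num) ht
  linarith [Real.log_two_gt_d9]

lemma kap_bdd {k : ℕ} (hk : k = 1 ∨ k = 2) {x : ℝ} (hx : 0 ≤ x) : kap k x ≤ exp 2 := by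
  unfold kap
  apply Real.exp_le_exp.mpr
  have hE0 : 0 ≤ EE x := by rw [← EE_zero]; exact EE_mono hx
  have hk2 : (k:ℝ) ≤ 2 := by rcases hk with rfl | rfl <;> norm_num
  have h1 : k * EE x ≤ 2 * EE x := mul_le_mul_of_nonneg_right hk2 hE0
  rcases le_total x 1 with h | h
  · have := EE_le_self hx
    linarith
  · have h2 := EE_log_upper h
    have h3 : log (x / 2) ≤ x / 2 - 1 := Real.log_le_sub_one_of_pos (by linarith)
    rw [Real.log_div (by linarith) (by norm_num)] at h3
    have h4 := Real.log_two_lt_d9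
    linarith

lemma gin_compare : ∃ A : ℝ, 0 ≤ A ∧ ∀ k : ℕ, k = 1 ∨ k = 2 → ∀ t : ℝ, 2 ≤ t → ∀ ε : ℝ, 0 < ε →
    ∀ n : ℕ, nu k t n * kap k (ε * ell t n) ≤ exp (A * ε) * t ^ (-ε) * gin k t (1 + ε) n ∧
      exp (-A * ε) * t ^ (-ε) * gin k t (1 + ε) n ≤ nu k t n * kap k (ε * ell t n) := by
  obtain ⟨C, hC, hb⟩ := PP_expand
  refine ⟨2 * C, by positivity, fun k hk t ht ε hε n => ?_⟩
  by_cases hd : IsDense n t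
  swap
  · rw [nu_zero_of_not hd]; simp [gin, hd]
  have hn : (1:ℝ) ≤ n := by exact_mod_cast hd.1
  have hn0 : (0:ℝ) < n := by linarith
  have ht0 : (0:ℝ) < t := by linarith
  have hy : 1 ≤ t * n := by nlinarith
  have hl : 0 ≤ log (t * n) := Real.log_nonneg hy
  have h1 := hb (t * n) ε hy (by linarith) (by nlinarith)
  rw [abs_of_pos hε] at h1
  have hP1 : 0 < PP (t * n) 1 := PP_pos one_pos
  have hP2 : 0 < PP (t * n) (1 + ε) := PP_pos (by linarith)
  have hk2 : (k:ℝ) ≤ 2 := by rcases hk with rfl | rfl <;> norm_num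
  rw [nu_dense hd]
  unfold gin ell kap
  rw [if_pos hd]
  have e1' : PP (t * n) 1 ^ k = exp (k * log (PP (t * n) 1)) := by
    rw [← Real.log_pow, Real.exp_log (by positivity)]
  have e2 : PP (t * n) (1 + ε) ^ k = exp (k * log (PP (t * n) (1 + ε))) := by
    rw [← Real.log_pow, Real.exp_log (by positivity)]
  have e3 : (n:ℝ) ^ (-(1 + ε)) = (n:ℝ)⁻¹ * exp (-ε * log n) := by
    rw [neg_add, Real.rpow_add hn0, Real.rpow_neg_one, Real.rpow_def_of_pos hn0]; congr 2; ring
  have e4 : t ^ (-ε) = exp (-ε * log t) := by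
    rw [Real.rpow_def_of_pos ht0]; congr 1; ring
  have e5 : log (t * n) = log t + log n := Real.log_mul ht0.ne' hn0.ne'
  rw [e1', e2, e3, e4]
  set a := log (PP (t * n) 1)
  set b := log (PP (t * n) (1 + ε))
  set E := EE (ε * log (t * n))
  have hf := fw_nonneg k n
  have hA : 0 ≤ fw k n * (n:ℝ)⁻¹ := by positivity
  have l1 : fw k n / n * exp (k * a) * exp (k * E - ε * log (t * n)) =
      fw k n * (n:ℝ)⁻¹ * exp (k * a + (k * E - ε * log (t * n))) := by rw [Real.exp_add]; ring
  have l2 : ∀ c, exp (c * ε) * exp (-ε * log t) * (fw k n * ((n:ℝ)⁻¹ * exp (-ε * log n)) * exp (k * b)) =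
      fw k n * (n:ℝ)⁻¹ * exp (c * ε + -ε * log t + -ε * log n + k * b) := by
    intro c; simp only [Real.exp_add]; ring
  rw [l1, l2, l2]
  have hk0 : (0:ℝ) ≤ k := by positivity
  have hkey : |(k:ℝ) * (b - a - E)| ≤ 2 * C * ε := by
    rw [abs_mul, abs_of_nonneg hk0]
    calc (k:ℝ) * |b - a - E| ≤ 2 * (C * ε) := mul_le_mul hk2 h1 (abs_nonneg _) (by norm_num)
      _ = _ := by ring
  rw [abs_le] at hkey
  constructor
  · apply mul_le_mul_of_nonneg_left _ hA
    apply Real.exp_le_exp.mpr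
    rw [e5]; linarith [hkey.1, hkey.2]
  · apply mul_le_mul_of_nonneg_left _ hA
    apply Real.exp_le_exp.mpr
    rw [e5]; linarith [hkey.1, hkey.2]

/-- the basic facts on `Y(ε) = ∑ ν κ(ε ℓ)`. -/
lemma Y_facts : ∃ A : ℝ, 0 ≤ A ∧ ∀ k : ℕ, k = 1 ∨ k = 2 → ∀ t : ℝ, 2 ≤ t → ∀ ε : ℝ, 0 < ε →
    Summable (fun n => nu k t n * kap k (ε * ell t n)) ∧
    ∑' n, nu k t n * kap k (ε * ell t n) ≤ exp (A * ε - ε * log t) ∧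
    exp (-A * ε - ε * log t) ≤ ∑' n, nu k t n * kap k (ε * ell t n) := by
  obtain ⟨A, hA, hb⟩ := gin_compare
  refine ⟨A, hA, fun k hk t ht ε hε => ?_⟩
  have hid := identity_inf hk (t := t) (s := 1 + ε) (by linarith) (by linarith)
  have h0 : ∀ n, 0 ≤ nu k t n * kap k (ε * ell t n) := fun n =>
    mul_nonneg (nu_nonneg _ _ _) (kap_pos _ _).le
  have hs : Summable (fun n => nu k t n * kap k (ε * ell t n)) :=
    Summable.of_nonneg_of_le h0 (fun n => (hb k hk t ht ε hε n).1) (hid.summable.mul_left _)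
  have et : t ^ (-ε) = exp (-(ε * log t)) := by
    rw [Real.rpow_def_of_pos (by linarith)]; congr 1; ring
  refine ⟨hs, ?_, ?_⟩
  · have := hs.tsum_le_tsum (fun n => (hb k hk t ht ε hε n).1) (hid.summable.mul_left _)
    rw [tsum_mul_left, hid.tsum_eq, mul_one, et, ← Real.exp_add] at this
    exact this
  · have := (hid.summable.mul_left (exp (-A * ε) * t ^ (-ε))).tsum_le_tsum (fun n => (hb k hk t ht ε hε n).2) hs
    rw [tsum_mul_left, hid.tsum_eq, mul_one, et, ← Real.exp_add] at this
    exact this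

lemma kap_tendsto (k : ℕ) (t : ℝ) (n : ℕ) :
    Filter.Tendsto (fun ε => nu k t n * kap k (ε * ell t n)) (nhdsWithin 0 (Set.Ioi 0)) (nhds (nu k t n)) := by
  have h : Continuous (fun ε => nu k t n * kap k (ε * ell t n)) :=
    continuous_const.mul ((kap_continuous k).comp (continuous_id.mul continuous_const))
  have := (h.tendsto 0).mono_left (nhdsWithin_le_nhds (s := Set.Ioi 0))
  simpa [kap_zero] using this

lemma nu_hasSum {k : ℕ} (hk : k = 1 ∨ k = 2) {t : ℝ} (ht : 2 ≤ t) : HasSum (nu k t) 1 := by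
  obtain ⟨A, hA, hY⟩ := Y_facts
  have hlim : ∀ c : ℝ, Filter.Tendsto (fun ε : ℝ => exp (c * ε - ε * log t)) (nhdsWithin 0 (Set.Ioi 0)) (nhds 1) := by
    intro c
    have h : Continuous (fun ε : ℝ => exp (c * ε - ε * log t)) := by fun_prop
    have := (h.tendsto 0).mono_left (nhdsWithin_le_nhds (s := Set.Ioi 0))
    simpa using this
  have hsum : Summable (nu k t) := by
    apply summable_of_sum_le (c := 1) (fun n => nu_nonneg k t n)
    intro u
    have h1 : Filter.Tendsto (fun ε => ∑ n ∈ u, nu k t n * kap k (ε * ell t n)) (nhdsWithin 0 (Set.Ioi 0))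
        (nhds (∑ n ∈ u, nu k t n)) := tendsto_finsetSum _ fun n _ => kap_tendsto k t n
    refine le_of_tendsto_of_tendsto h1 (hlim A) ?_
    filter_upwards [self_mem_nhdsWithin] with ε hε
    obtain ⟨hs, hu, -⟩ := hY k hk t ht ε hε
    exact (hs.sum_le_tsum u fun n _ => mul_nonneg (nu_nonneg _ _ _) (kap_pos _ _).le).trans hu
  have hT : Filter.Tendsto (fun ε => ∑' n, nu k t n * kap k (ε * ell t n)) (nhdsWithin 0 (Set.Ioi 0))
      (nhds (∑' n, nu k t n)) := by
    refine tendsto_tsum_of_dominated_convergence (hsum.mul_right (exp 2)) (kap_tendsto k t) ?_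
    filter_upwards [self_mem_nhdsWithin] with ε hε n
    rw [Real.norm_of_nonneg (mul_nonneg (nu_nonneg _ _ _) (kap_pos _ _).le)]
    by_cases hd : IsDense n t
    · apply mul_le_mul_of_nonneg_left _ (nu_nonneg _ _ _)
      have h1 := ell_ge ht hd.1
      have h2 := log_t_ge ht
      have hε : 0 < ε := hε
      exact kap_bdd hk (mul_nonneg hε.le (by linarith))
    · simp [nu_zero_of_not hd]
  have hT2 : Filter.Tendsto (fun ε => ∑' n, nu k t n * kap k (ε * ell t n)) (nhdsWithin 0 (Set.Ioi 0)) (nhds 1) := by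
    refine tendsto_of_tendsto_of_tendsto_of_le_of_le' (hlim (-A)) (hlim A) ?_ ?_
    · filter_upwards [self_mem_nhdsWithin] with ε hε
      exact (hY k hk t ht ε hε).2.2
    · filter_upwards [self_mem_nhdsWithin] with ε hε
      exact (hY k hk t ht ε hε).2.1
  rw [← tendsto_nhds_unique hT hT2]
  exact hsum.hasSum

/-- `1 - Y(ε)` bounds -/
lemma one_sub_Y : ∃ C t0 : ℝ, 0 < C ∧ 2 ≤ t0 ∧ ∀ k : ℕ, k = 1 ∨ k = 2 → ∀ t : ℝ, 2 ≤ t → ∀ ε : ℝ, 0 < ε →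
    1 - ∑' n, nu k t n * kap k (ε * ell t n) ≤ C * (ε * log t) ∧
    (t0 ≤ t → ε * log t ≤ 1 → ε * log t / 4 ≤ 1 - ∑' n, nu k t n * kap k (ε * ell t n)) := by
  obtain ⟨A, hA, hY⟩ := Y_facts
  refine ⟨2 * A + 1, exp (2 * A + 1), by positivity, ?_, fun k hk t ht ε hε => ?_⟩
  · have := Real.add_one_le_exp (2 * A + 1); linarith
  obtain ⟨-, h1, h2⟩ := hY k hk t ht ε hε
  have hl := log_t_ge ht
  constructor
  · have h3 := Real.add_one_le_exp (-A * ε - ε * log t)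
    have : A * ε ≤ 2 * A * (ε * log t) := by
      have := mul_le_mul_of_nonneg_left hl (by positivity : 0 ≤ 2 * (A * ε))
      linarith
    nlinarith
  · intro htt hεt
    have h3 : 2 * A + 1 ≤ log t := (Real.le_log_iff_exp_le (by linarith)).mpr htt
    have h4 : A * ε - ε * log t ≤ -(ε * log t / 2) := by nlinarith
    have h5 : exp (-(ε * log t / 2)) ≤ 1 - ε * log t / 4 := by
      set z := ε * log t / 2 with hz
      have hz0 : 0 ≤ z := by positivity
      have hz1 : z ≤ 1 / 2 := by linarith
      have h6 := Real.add_one_le_exp z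
      rw [Real.exp_neg, inv_le_iff_one_le_mul₀ (Real.exp_pos z)]
      have h7 : 1 ≤ (1 - z / 2) * (z + 1) := by nlinarith
      have h8 : (1 - z / 2) * (z + 1) ≤ (1 - z / 2) * exp z := mul_le_mul_of_nonneg_left h6 (by linarith)
      calc (1:ℝ) ≤ _ := h7.trans h8
        _ = _ := by rw [hz]; ring
    have h6 := Real.exp_le_exp.mpr h4
    linarith

def Hdata (k : ℕ) (α β : ℝ) : Prop :=
  ∃ (H : ℝ → ℝ) (C c x2 b t0 : ℝ), 0 < C ∧ 0 < c ∧ 0 < x2 ∧ 0 < b ∧ 2 ≤ t0 ∧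
    (∀ x, 0 ≤ x → 0 ≤ H x ∧ H x ≤ C ∧ H x ≤ C * x ^ β) ∧ (∀ x, x2 ≤ x → c ≤ H x) ∧
    (∀ t, 2 ≤ t → ∀ a, 0 < a → a * log t ≤ b →
      ∑' n, nu k t n * H (a * ell t n) ≤ C * (a * log t) ^ α) ∧
    (∀ t, t0 ≤ t → ∀ a, 0 < a → a * log t ≤ b →
      c * (a * log t) ^ α ≤ ∑' n, nu k t n * H (a * ell t n))

lemma EE_slope {a b : ℝ} (hab : a ≤ b) :
    e1 b * (b - a) ≤ EE b - EE a ∧ EE b - EE a ≤ e1 a * (b - a) := by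
  have h0 : EE b - EE a = ∫ z in a..b, e1 z := by
    unfold EE
    rw [intervalIntegral.integral_interval_sub_left] <;> exact e1_continuous.intervalIntegrable _ _
  have h1 : ∀ c : ℝ, ∫ z in a..b, c = c * (b - a) := by
    intro c; rw [intervalIntegral.integral_const, smul_eq_mul, mul_comm]
  rw [h0, ← h1, ← h1]
  constructor
  · apply intervalIntegral.integral_mono_on hab (by simp) (e1_continuous.intervalIntegrable _ _)
    intro x hx; exact e1_antitone hx.2
  · apply intervalIntegral.integral_mono_on hab (e1_continuous.intervalIntegrable _ _) (by simp)
    intro x hx; exact e1_antitone hx.1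

lemma EE_sq {x : ℝ} (hx : 0 ≤ x) : x - EE x ≤ x ^ 2 := by
  have h := (EE_slope hx).1
  rw [EE_zero, sub_zero, sub_zero, mul_comm, mul_e1] at h
  have h2 : exp (-x) ≤ 1 - x + x ^ 2 := by
    rw [Real.exp_neg, inv_le_iff_one_le_mul₀ (exp_pos x)]
    have h3 := Real.add_one_le_exp x
    have h4 : 0 < 1 - x + x ^ 2 := by nlinarith
    have : (1 - x + x ^ 2) * (x + 1) ≤ (1 - x + x ^ 2) * exp x := by gcongr
    have h5 : (1 - x + x ^ 2) * (x + 1) = 1 + x ^ 3 := by ring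
    have : 0 ≤ x ^ 3 := by positivity
    linarith
  linarith

lemma EE_one_lt : EE 1 < 1 := by
  have h1 := (EE_slope (show (0:ℝ) ≤ 1/2 by norm_num)).2
  have h2 := (EE_slope (show (1/2:ℝ) ≤ 1 by norm_num)).2
  have h3 := mul_e1 (1/2)
  have h4 : 1 / 2 < exp (-(1/2 : ℝ)) := by
    have := Real.add_one_lt_exp (x := -(1/2:ℝ)) (by norm_num)
    linarith
  rw [e1_zero, EE_zero] at h1
  linarith

lemma ell_nonneg {t : ℝ} (ht : 2 ≤ t) (n : ℕ) : 0 ≤ ell t n := by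
  rcases Nat.eq_zero_or_pos n with rfl | hn
  · simp [ell]
  · have := ell_ge ht hn
    have := log_t_ge ht
    linarith

lemma nu_summable_mul {k : ℕ} (hk : k = 1 ∨ k = 2) {t : ℝ} (ht : 2 ≤ t) {g : ℕ → ℝ} {C : ℝ}
    (hg : ∀ n, |g n| ≤ C) : Summable (fun n => nu k t n * g n) := by
  apply Summable.of_norm_bounded ((nu_hasSum hk ht).summable.mul_left C)
  intro n
  rw [Real.norm_eq_abs, abs_mul, abs_of_nonneg (nu_nonneg _ _ _), mul_comm]
  exact mul_le_mul_of_nonneg_right (hg n) (nu_nonneg _ _ _)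

lemma Hdata_one : Hdata 1 1 2 := by
  obtain ⟨C, t0, hC, ht0, hY⟩ := one_sub_Y
  have hkap1 : ∀ x, 0 ≤ x → kap 1 x ≤ 1 := by
    intro x hx
    unfold kap
    rw [Real.exp_le_one_iff]
    have := EE_le_self hx
    push_cast; linarith
  have hc0 : 0 < 1 - exp (EE 1 - 1) := by
    have : exp (EE 1 - 1) < 1 := by rw [Real.exp_lt_one_iff]; linarith [EE_one_lt]
    linarith
  have key : ∀ t, 2 ≤ t → ∀ a, 0 < a → ∑' n, nu 1 t n * (1 - kap 1 (a * ell t n)) =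
      1 - ∑' n, nu 1 t n * kap 1 (a * ell t n) := by
    intro t ht a ha
    have h1 := nu_hasSum (Or.inl rfl : 1 = 1 ∨ 1 = 2) ht
    have h2 : Summable (fun n => nu 1 t n * kap 1 (a * ell t n)) := by
      apply nu_summable_mul (Or.inl rfl) ht (C := 1)
      intro n
      rw [abs_of_pos (kap_pos _ _)]
      exact hkap1 _ (mul_nonneg ha.le (ell_nonneg ht n))
    have h3 := h1.summable.tsum_sub h2
    rw [h1.tsum_eq] at h3
    rw [← h3]
    simp only [mul_sub, mul_one]
  refine ⟨fun x => 1 - kap 1 x, max C 1, min (1/4) (1 - exp (EE 1 - 1)), 1, 1, t0, by positivity, by positivity,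
    one_pos, one_pos, ht0, ?_, ?_, ?_, ?_⟩
  · intro x hx
    have h1 := hkap1 x hx
    have h2 := kap_pos 1 x
    refine ⟨by linarith, by linarith [le_max_right C 1], ?_⟩
    have h3 : 1 - kap 1 x ≤ x ^ 2 := by
      unfold kap
      have h4 := Real.add_one_le_exp ((1:ℕ) * EE x - x)
      have h5 := EE_sq hx
      push_cast at h4 ⊢
      linarith
    rw [Real.rpow_two]
    have : x ^ 2 ≤ max C 1 * x ^ 2 := le_mul_of_one_le_left (sq_nonneg x) (le_max_right _ _)
    linarith
  · intro x hx
    refine (min_le_right _ _).trans ?_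
    have : kap 1 x ≤ exp (EE 1 - 1) := by
      unfold kap
      apply Real.exp_le_exp.mpr
      have h1 := (EE_slope hx).2
      have h2 : e1 1 ≤ 1 := (e1_antitone (zero_le_one' ℝ)).trans e1_zero.le
      have h3 : e1 1 * (x - 1) ≤ 1 * (x - 1) := mul_le_mul_of_nonneg_right h2 (by linarith)
      push_cast; linarith
    simp only; linarith
  · intro t ht a ha hab
    rw [key t ht a ha, Real.rpow_one]
    refine ((hY 1 (Or.inl rfl) t ht a ha).1).trans ?_
    have := log_t_ge ht
    exact mul_le_mul_of_nonneg_right (le_max_left _ _) (by positivity)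
  · intro t ht a ha hab
    have ht2 : 2 ≤ t := ht0.trans ht
    rw [key t ht2 a ha, Real.rpow_one]
    refine le_trans ?_ ((hY 1 (Or.inl rfl) t ht2 a ha).2 ht hab)
    have := log_t_ge ht2
    have h0 : 0 ≤ a * log t := by positivity
    have := mul_le_mul_of_nonneg_right (min_le_left (1/4) (1 - exp (EE 1 - 1))) h0
    linarith

section xi
variable {ξ : ℝ → ℝ} 

lemma xi_int_eq (hξ0 : ∀ u : ℝ, u < 1 → ξ u = 0) (w : ℝ) :
    ∫ t in (1:ℝ)..w, ξ t = ∫ t in (1:ℝ)..(max w 1), ξ (max t 1) := by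
  rcases le_total w 1 with h | h
  · rw [max_eq_right h, intervalIntegral.integral_same, intervalIntegral.integral_symm,
      intervalIntegral.integral_of_le h, integral_Ioc_eq_integral_Ioo]
    rw [setIntegral_congr_fun (g := fun _ => (0:ℝ)) measurableSet_Ioo]
    · simp
    · intro x hx; exact hξ0 x hx.2
  · rw [max_eq_left h]
    apply intervalIntegral.integral_congr
    intro x hx
    rw [Set.uIcc_of_le h] at hx
    simp only
    rw [max_eq_left hx.1]

lemma xi_fun (hξ0 : ∀ u : ℝ, u < 1 → ξ u = 0)
    (hξ : ∀ u : ℝ, 1 ≤ u → u * ξ u = 2 + 2 * ∫ t in (1:ℝ)..(u - 1), ξ t) (u : ℝ) :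
    ξ (max u 1) = (2 + 2 * ∫ t in (1:ℝ)..(max (max u 1 - 1) 1), ξ (max t 1)) / max u 1 := by
  have h1 : (1:ℝ) ≤ max u 1 := le_max_right _ _
  rw [eq_div_iff (by linarith), ← xi_int_eq hξ0, mul_comm, hξ _ h1]

lemma xi_cont_aux (hξ0 : ∀ u : ℝ, u < 1 → ξ u = 0)
    (hξ : ∀ u : ℝ, 1 ≤ u → u * ξ u = 2 + 2 * ∫ t in (1:ℝ)..(u - 1), ξ t) (n : ℕ) :
    ContinuousOn (fun u => ξ (max u 1)) (Set.Iic ((n:ℝ) + 1)) ∧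
    ∀ u ≤ (n:ℝ) + 1, 0 ≤ ξ (max u 1) ∧ ξ (max u 1) ≤ 2 * max u 1 := by
  induction n with
  | zero =>
    have h : ∀ u ∈ Set.Iic (((0:ℕ):ℝ) + 1), ξ (max u 1) = 2 := by
      intro u hu
      have hu1 : u ≤ 1 := by simpa using hu
      rw [xi_fun hξ0 hξ, max_eq_right hu1]
      norm_num
    constructor
    · exact continuousOn_const.congr h
    · intro u hu
      rw [h u hu]
      constructor
      · norm_num
      · linarith [le_max_right u 1]
  | succ n ih =>
    obtain ⟨ih1, ih2⟩ := ih
    set b : ℝ := (n:ℝ) + 1 with hb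
    have hb1 : 1 ≤ b := by rw [hb]; linarith [(Nat.cast_nonneg n : (0:ℝ) ≤ n)]
    have hcont : Continuous (fun u => ξ (max (min u b) 1)) := by
      have := ih1.comp_continuous (f := fun u : ℝ => min u b) (by fun_prop) (fun u => Set.mem_Iic.mpr (min_le_right _ _))
      exact this
    have heq : ∀ u ≤ b + 1, ξ (max u 1) = (2 + 2 * ∫ t in (1:ℝ)..(max (max u 1 - 1) 1), ξ (max (min t b) 1)) / max u 1 := by
      intro u hu
      rw [xi_fun hξ0 hξ]
      congr 3
      apply intervalIntegral.integral_congr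
      intro x hx
      rw [Set.uIcc_of_le (le_max_right _ _)] at hx
      have : x ≤ b := by
        refine hx.2.trans (max_le ?_ hb1)
        have : max u 1 ≤ b + 1 := max_le hu (by linarith)
        linarith
      simp only
      rw [min_eq_left this]
    have hcast : (((n + 1 : ℕ) : ℝ) + 1) = b + 1 := by rw [hb]; push_cast; ring
    rw [hcast]
    constructor
    · apply ContinuousOn.congr _ heq
      apply Continuous.continuousOn
      apply Continuous.div
      · apply continuous_const.add
        apply continuous_const.mul
        have h1 : Continuous (fun w => ∫ t in (1:ℝ)..w, ξ (max (min t b) 1)) :=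
          intervalIntegral.continuous_primitive (fun a b => hcont.intervalIntegrable a b) 1
        exact h1.comp (by fun_prop)
      · fun_prop
      · intro u; linarith [le_max_right u 1]
    · intro u hu
      rw [heq u hu]
      set w := max u 1 with hw
      have hw1 : 1 ≤ w := le_max_right _ _
      set m := max (w - 1) 1 with hm
      have hm1 : 1 ≤ m := le_max_right _ _
      have hm2 : m ^ 2 - 1 ≤ w ^ 2 - 1 := by
        have : m ≤ w := max_le (by linarith) hw1
        nlinarith
      have hlow : 0 ≤ ∫ t in (1:ℝ)..m, ξ (max (min t b) 1) :=
        intervalIntegral.integral_nonneg hm1 (fun x _ => (ih2 _ (min_le_right _ _)).1)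
      have hup : ∫ t in (1:ℝ)..m, ξ (max (min t b) 1) ≤ m ^ 2 - 1 := by
        have h1 : ∫ t in (1:ℝ)..m, ξ (max (min t b) 1) ≤ ∫ t in (1:ℝ)..m, 2 * t := by
          apply intervalIntegral.integral_mono_on hm1 (hcont.intervalIntegrable _ _)
          · exact (by fun_prop : Continuous fun t : ℝ => 2 * t).intervalIntegrable _ _
          · intro x hx
            refine (ih2 _ (min_le_right _ _)).2.trans ?_
            have : max (min x b) 1 ≤ x := max_le (min_le_left _ _) hx.1
            linarith
        have h2 : ∫ t in (1:ℝ)..m, 2 * t = m ^ 2 - 1 := by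
          rw [intervalIntegral.integral_const_mul, integral_id]; ring
        linarith
      constructor
      · positivity
      · rw [div_le_iff₀ (by linarith)]
        have : m ^ 2 - 1 ≤ w ^ 2 - 1 := hm2
        nlinarith

lemma xi_cont (hξ0 : ∀ u : ℝ, u < 1 → ξ u = 0)
    (hξ : ∀ u : ℝ, 1 ≤ u → u * ξ u = 2 + 2 * ∫ t in (1:ℝ)..(u - 1), ξ t) :
    Continuous (fun u => ξ (max u 1)) := by
  rw [continuous_iff_continuousAt]
  intro u
  obtain ⟨n, hn⟩ := exists_nat_gt u
  exact (xi_cont_aux hξ0 hξ n).1.continuousAt (Iic_mem_nhds (by linarith))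

lemma xi_bd (hξ0 : ∀ u : ℝ, u < 1 → ξ u = 0)
    (hξ : ∀ u : ℝ, 1 ≤ u → u * ξ u = 2 + 2 * ∫ t in (1:ℝ)..(u - 1), ξ t) {u : ℝ} (hu : 0 ≤ u) :
    0 ≤ ξ u ∧ ξ u ≤ 2 * u := by
  rcases lt_or_ge u 1 with h | h
  · rw [hξ0 u h]; constructor <;> linarith
  · obtain ⟨n, hn⟩ := exists_nat_gt u
    have := (xi_cont_aux hξ0 hξ n).2 u (by linarith)
    rwa [max_eq_left h] at this

lemma xi_meas (hξ0 : ∀ u : ℝ, u < 1 → ξ u = 0)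
    (hξ : ∀ u : ℝ, 1 ≤ u → u * ξ u = 2 + 2 * ∫ t in (1:ℝ)..(u - 1), ξ t) : Measurable ξ := by
  have h : ξ = fun u => if u < 1 then 0 else ξ (max u 1) := by
    funext u
    split_ifs with h
    · exact hξ0 u h
    · rw [max_eq_left (not_lt.mp h)]
  rw [h]
  exact Measurable.ite measurableSet_Iio measurable_const (xi_cont hξ0 hξ).measurable

end xi

lemma lap_int {g : ℝ → ℝ} (hg : Measurable g) {C : ℝ} (hb : ∀ u, 0 < u → |g u| ≤ C * (1 + u ^ 2))
    {x : ℝ} (hx : 0 < x) : IntegrableOn (fun u => g u * exp (-(x * u))) (Set.Ioi 0) := by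
  have h0 := integrableOn_rpow_mul_exp_neg_mul_rpow (s := 0) (p := 1) (b := x) (by norm_num) one_pos hx
  have h2 := integrableOn_rpow_mul_exp_neg_mul_rpow (s := 2) (p := 1) (b := x) (by norm_num) one_pos hx
  have h := (h0.add h2).const_mul C
  apply Integrable.mono' h
  · exact (hg.mul (by fun_prop)).aestronglyMeasurable
  · rw [ae_restrict_iff' measurableSet_Ioi]
    refine Filter.Eventually.of_forall fun u hu => ?_
    have h1 := mul_le_mul_of_nonneg_right (hb u hu) (exp_pos (-(x * u))).le
    rw [norm_mul, Real.norm_eq_abs, Real.norm_eq_abs, abs_of_pos (exp_pos _)]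
    refine h1.trans (le_of_eq ?_)
    simp only [Pi.add_apply, Real.rpow_zero, Real.rpow_one, Real.rpow_two]
    rw [neg_mul]; ring

noncomputable def Xi (ξ : ℝ → ℝ) (x : ℝ) : ℝ := ∫ u in Set.Ioi (0:ℝ), ξ u * exp (-(x * u))

section xi
variable {ξ : ℝ → ℝ} 

lemma xi_lap (hξ0 : ∀ u : ℝ, u < 1 → ξ u = 0)
    (hξ : ∀ u : ℝ, 1 ≤ u → u * ξ u = 2 + 2 * ∫ t in (1:ℝ)..(u - 1), ξ t) {x : ℝ} (hx : 0 < x) :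
    IntegrableOn (fun u => ξ u * exp (-(x * u))) (Set.Ioi 0) := by
  apply lap_int (xi_meas hξ0 hξ) (C := 2) _ hx
  intro u hu
  have := xi_bd hξ0 hξ hu.le
  rw [abs_of_nonneg this.1]; nlinarith

lemma uxi_lap (hξ0 : ∀ u : ℝ, u < 1 → ξ u = 0)
    (hξ : ∀ u : ℝ, 1 ≤ u → u * ξ u = 2 + 2 * ∫ t in (1:ℝ)..(u - 1), ξ t) {x : ℝ} (hx : 0 < x) :
    IntegrableOn (fun u => (u * ξ u) * exp (-(x * u))) (Set.Ioi 0) := by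
  apply lap_int (measurable_id.mul (xi_meas hξ0 hξ)) (C := 2) _ hx
  intro u hu
  have := xi_bd hξ0 hξ hu.le
  simp only [Pi.mul_apply, id]
  rw [abs_of_nonneg (mul_nonneg hu.le this.1)]; nlinarith

lemma Xi_deriv (hξ0 : ∀ u : ℝ, u < 1 → ξ u = 0)
    (hξ : ∀ u : ℝ, 1 ≤ u → u * ξ u = 2 + 2 * ∫ t in (1:ℝ)..(u - 1), ξ t) {x : ℝ} (hx : 0 < x) :
    HasDerivAt (Xi ξ) (-∫ u in Set.Ioi (0:ℝ), (u * ξ u) * exp (-(x * u))) x := by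
  have hm := xi_meas hξ0 hξ
  have := (hasDerivAt_integral_of_dominated_loc_of_deriv_le (μ := volume.restrict (Set.Ioi (0:ℝ)))
    (F := fun x u => ξ u * exp (-(x * u))) (F' := fun x u => -((u * ξ u) * exp (-(x * u))))
    (bound := fun u => (u * ξ u) * exp (-((x/2) * u))) (x₀ := x) (s := Set.Ioi (x/2))
    (Ioi_mem_nhds (by linarith)) ?_ (xi_lap hξ0 hξ hx) ?_ ?_ (uxi_lap hξ0 hξ (by linarith)) ?_).2
  · rw [integral_neg] at this
    exact this
  · refine Filter.Eventually.of_forall fun y => ?_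
    exact (hm.mul (by fun_prop)).aestronglyMeasurable
  · exact (((measurable_id.mul hm).mul (by fun_prop)).neg).aestronglyMeasurable
  · rw [ae_restrict_iff' measurableSet_Ioi]
    refine Filter.Eventually.of_forall fun u hu y hy => ?_
    have hu' : 0 < u := hu
    have h0 : 0 ≤ u * ξ u := mul_nonneg hu'.le (xi_bd hξ0 hξ hu'.le).1
    have hy' : x / 2 < y := hy
    rw [norm_neg, norm_mul, Real.norm_of_nonneg h0, Real.norm_of_nonneg (exp_pos _).le]
    gcongr
  · refine Filter.Eventually.of_forall fun u y _ => ?_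
    have h1 : HasDerivAt (fun y => -(y * u)) (-u) y := by
      exact HasDerivAt.congr_deriv ((hasDerivAt_id y).mul_const u).neg (by simp)
    exact HasDerivAt.congr_deriv ((h1.exp).const_mul (ξ u)) (by ring)

lemma Xi_eq (hξ0 : ∀ u : ℝ, u < 1 → ξ u = 0) (x : ℝ) :
    Xi ξ x = ∫ u in Set.Ioi (1:ℝ), ξ (max u 1) * exp (-(x * u)) := by
  unfold Xi
  rw [← integral_Ici_eq_integral_Ioi (x := (1:ℝ))]
  rw [setIntegral_congr_fun (g := fun u => ξ u * exp (-(x * u))) measurableSet_Ici]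
  · apply setIntegral_eq_of_subset_of_forall_sdiff_eq_zero measurableSet_Ioi
    · intro u hu
      have : (1:ℝ) ≤ u := hu
      exact lt_of_lt_of_le one_pos this
    · intro u hu
      have : u < 1 := not_le.mp hu.2
      rw [hξ0 u this, zero_mul]
  · intro u hu
    simp only
    rw [max_eq_left hu]

lemma Xi_parts (hξ0 : ∀ u : ℝ, u < 1 → ξ u = 0)
    (hξ : ∀ u : ℝ, 1 ≤ u → u * ξ u = 2 + 2 * ∫ t in (1:ℝ)..(u - 1), ξ t) {x : ℝ} (hx : 0 < x) :
    ∫ u in Set.Ioi (0:ℝ), (u * ξ u) * exp (-(x * u)) = 2 * exp (-x) / x * (1 + Xi ξ x) := by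
  set W : ℝ → ℝ := fun w => ∫ t in (1:ℝ)..w, ξ (max t 1) with hW
  have hζ := xi_cont hξ0 hξ
  have hWd : ∀ w, HasDerivAt W (ξ (max w 1)) w := fun w =>
    intervalIntegral.integral_hasDerivAt_right (hζ.intervalIntegrable _ _)
      (hζ.stronglyMeasurableAtFilter _ _) hζ.continuousAt
  have hWc : Continuous W := continuous_iff_continuousAt.mpr fun w => (hWd w).continuousAt
  have hWb : ∀ w, 1 ≤ w → 0 ≤ W w ∧ W w ≤ w ^ 2 := by
    intro w hw
    constructor
    · exact intervalIntegral.integral_nonneg hw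
        (fun x hx => (xi_bd hξ0 hξ (by linarith [le_max_right x 1])).1)
    · have h1 : W w ≤ ∫ t in (1:ℝ)..w, 2 * t := by
        apply intervalIntegral.integral_mono_on hw (hζ.intervalIntegrable _ _)
        · exact (by fun_prop : Continuous fun t : ℝ => 2 * t).intervalIntegrable _ _
        · intro x hx
          have h := (xi_bd hξ0 hξ (u := max x 1) (by linarith [le_max_right x 1])).2
          rwa [max_eq_left hx.1] at *
      have h2 : ∫ t in (1:ℝ)..w, 2 * t = w ^ 2 - 1 := by
        rw [intervalIntegral.integral_const_mul, integral_id]; ring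
      linarith
  -- integrate by parts
  have hWint : IntegrableOn (fun w => W (max w 1) * exp (-(x * w))) (Set.Ioi 0) := by
    apply lap_int (hWc.comp (by fun_prop)).measurable (C := 1) _ hx
    intro u hu
    have h1 := hWb (max u 1) (le_max_right _ _)
    simp only [Function.comp]
    rw [abs_of_nonneg h1.1]
    refine h1.2.trans ?_
    rcases max_cases u 1 with h | h <;> rw [h.1] <;> nlinarith
  have hζint : IntegrableOn (fun w => ξ (max w 1) * exp (-(x * w))) (Set.Ioi 0) := by
    apply lap_int hζ.measurable (C := 2) _ hx
    intro u hu
    have h1 := xi_bd hξ0 hξ (u := max u 1) (by linarith [le_max_right u 1])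
    rw [abs_of_nonneg h1.1]
    refine h1.2.trans ?_
    rcases max_cases u 1 with h | h <;> rw [h.1] <;> nlinarith
  have hsub : Set.Ioi (1:ℝ) ⊆ Set.Ioi 0 := Set.Ioi_subset_Ioi zero_le_one
  have hWint1 : IntegrableOn (fun w => W w * exp (-(x * w))) (Set.Ioi 1) := by
    apply (hWint.mono_set hsub).congr_fun _ measurableSet_Ioi
    intro w hw
    simp only
    rw [max_eq_left (le_of_lt hw)]
  have hparts : ∫ w in Set.Ioi (1:ℝ), W w * exp (-(x * w)) = Xi ξ x / x := by
    have hI := integral_Ioi_of_hasDerivAt_of_tendsto' (a := (1:ℝ)) (m := 0)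
      (f := fun w => -(W w * exp (-(x * w)) / x))
      (f' := fun w => W w * exp (-(x * w)) - (ξ (max w 1) * exp (-(x * w))) / x) ?_ ?_ ?_
    · rw [integral_sub hWint1 ((hζint.mono_set hsub).div_const x), integral_div, ← Xi_eq hξ0] at hI
      have hW1 : W 1 = 0 := by simp [hW]
      rw [hW1] at hI
      simp at hI
      linarith
    · intro w _
      have h1 : HasDerivAt (fun y => -(x * y)) (-x) w := by
        exact HasDerivAt.congr_deriv ((hasDerivAt_id w).const_mul x).neg (by simp)
      refine HasDerivAt.congr_deriv (((hWd w).mul h1.exp).div_const x).neg ?_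
      field_simp
      ring
    · exact hWint1.sub ((hζint.mono_set hsub).div_const x)
    · have h1 := (tendsto_pow_mul_exp_neg_atTop_nhds_zero 2).comp
        (Filter.tendsto_id.const_mul_atTop hx)
      have h2 := h1.const_mul (1 / x ^ 3)
      rw [mul_zero] at h2
      apply squeeze_zero_norm' _ h2
      filter_upwards [Filter.eventually_ge_atTop (1:ℝ)] with w hw
      have h3 := hWb w hw
      rw [norm_neg, Real.norm_of_nonneg (by have := h3.1; positivity)]
      simp only [Function.comp, id]
      have h4 : 1 / x ^ 3 * ((x * w) ^ 2 * exp (-(x * w))) = w ^ 2 * exp (-(x * w)) / x := by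
        field_simp
      rw [h4]
      have := h3.2
      gcongr
  have hexp : ∫ w in Set.Ioi (0:ℝ), exp (-(x * w)) = 1 / x := by
    have := integral_exp_mul_Ioi (a := -x) (by linarith) 0
    simp only [neg_mul] at this
    rw [this]; simp
  -- shift
  have hs1 : ∫ u in Set.Ioi (0:ℝ), (u * ξ u) * exp (-(x * u)) =
      ∫ u in Set.Ioi (1:ℝ), (u * ξ u) * exp (-(x * u)) := by
    rw [← integral_Ici_eq_integral_Ioi (x := (1:ℝ))]
    apply setIntegral_eq_of_subset_of_forall_sdiff_eq_zero measurableSet_Ioi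
    · intro u hu
      have : (1:ℝ) ≤ u := hu
      exact lt_of_lt_of_le one_pos this
    · intro u hu
      have : u < 1 := not_le.mp hu.2
      rw [hξ0 u this]; simp
  have hs2 : ∫ u in Set.Ioi (1:ℝ), (u * ξ u) * exp (-(x * u)) =
      ∫ w in Set.Ioi (0:ℝ), ((w + 1) * ξ (w + 1)) * exp (-(x * (w + 1))) := by
    have := (measurePreserving_add_right volume (1:ℝ)).setIntegral_preimage_emb
      (measurableEmbedding_addRight (1:ℝ)) (fun u => (u * ξ u) * exp (-(x * u))) (Set.Ioi 1)
    rw [← this]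
    congr 2
    ext w; simp
  have hs3 : ∫ w in Set.Ioi (0:ℝ), ((w + 1) * ξ (w + 1)) * exp (-(x * (w + 1))) =
      ∫ w in Set.Ioi (0:ℝ), 2 * exp (-x) * (exp (-(x * w)) + W (max w 1) * exp (-(x * w))) := by
    apply setIntegral_congr_fun measurableSet_Ioi
    intro w hw
    have hw0 : (0:ℝ) < w := hw
    simp only
    rw [hξ _ (by linarith), add_sub_cancel_right, xi_int_eq hξ0]
    have : -(x * (w + 1)) = -x + -(x * w) := by ring
    rw [this, Real.exp_add, hW]
    ring
  have hs4 : ∫ w in Set.Ioi (0:ℝ), W (max w 1) * exp (-(x * w)) = Xi ξ x / x := by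
    rw [← hparts, ← integral_Ici_eq_integral_Ioi (x := (1:ℝ))]
    rw [setIntegral_congr_fun (s := Set.Ici (1:ℝ)) (g := fun w => W (max w 1) * exp (-(x * w))) measurableSet_Ici]
    · apply setIntegral_eq_of_subset_of_forall_sdiff_eq_zero measurableSet_Ioi
      · intro u hu
        have : (1:ℝ) ≤ u := hu
        exact lt_of_lt_of_le one_pos this
      · intro u hu
        have : u < 1 := not_le.mp hu.2
        rw [max_eq_right this.le]; simp [hW]
    · intro w hw
      simp only
      rw [max_eq_left hw]
  have hexpint : IntegrableOn (fun w => exp (-(x * w))) (Set.Ioi 0) := by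
    have := lap_int (g := fun _ => 1) measurable_const (C := 1) (fun u _ => by simp; positivity) hx
    simpa using this
  rw [hs1, hs2, hs3, integral_const_mul, integral_add hexpint hWint, hs4, hexp]
  field_simp

lemma Xi_const (hξ0 : ∀ u : ℝ, u < 1 → ξ u = 0)
    (hξ : ∀ u : ℝ, 1 ≤ u → u * ξ u = 2 + 2 * ∫ t in (1:ℝ)..(u - 1), ξ t) :
    ∃ A : ℝ, ∀ x, 0 < x → x ^ 2 * (1 + Xi ξ x) = A * exp (2 * EE x) := by
  set G : ℝ → ℝ := fun x => x ^ 2 * (1 + Xi ξ x) * exp (-(2 * EE x)) with hG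
  have hd : ∀ x, 0 < x → HasDerivAt G 0 x := by
    intro x hx
    have h1 := Xi_deriv hξ0 hξ hx
    rw [Xi_parts hξ0 hξ hx] at h1
    have h2 := ((hasDerivAt_pow 2 x).mul (h1.const_add 1)).mul (((EE_hasDerivAt x).const_mul 2).neg.exp)
    refine HasDerivAt.congr_deriv h2 ?_
    have h3 := mul_e1 x
    have h4 : exp (-x) = 1 - x * e1 x := by linarith
    rw [h4]
    field_simp
    simp
    ring
  refine ⟨G 1, fun x hx => ?_⟩
  have : G x = G 1 := by
    apply IsOpen.is_const_of_deriv_eq_zero isOpen_Ioi (convex_Ioi (0:ℝ)).isPreconnected _ _ hx (Set.mem_Ioi.mpr one_pos)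
    · intro y hy; exact (hd y hy).differentiableAt.differentiableWithinAt
    · intro y hy; exact (hd y hy).deriv
  rw [← this, hG]
  simp only
  rw [mul_assoc, ← Real.exp_add]; simp
end xi

lemma rpow_le_two_exp {y δ : ℝ} (hy : 0 < y) (h0 : 0 < δ) (h1 : δ < 1) : y ^ (1 + δ) ≤ 2 * exp y := by
  have h2 := Real.quadratic_le_exp_of_nonneg hy.le
  rcases le_total y 1 with h | h
  · have : y ^ (1 + δ) ≤ 1 := Real.rpow_le_one hy.le h (by linarith)
    nlinarith
  · have : y ^ (1 + δ) ≤ y ^ (2:ℝ) := Real.rpow_le_rpow_of_exponent_le h (by linarith)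
    rw [Real.rpow_two] at this
    nlinarith

lemma lap_weight {x v δ : ℝ} (hx : 0 < x) (hx1 : x ≤ 1) (hv : 0 < v) (h0 : 0 < δ) (h1 : δ < 1) :
    x ^ 2 * exp (-(x * v)) ≤ 6 * x ^ (1 - δ) * (v + 1) ^ (-δ - 1) := by
  have h2 := rpow_le_two_exp (show 0 < x * (v + 1) by positivity) h0 h1
  have h3 : exp (x * (v + 1)) ≤ 3 * exp (x * v) := by
    rw [mul_add, mul_one, Real.exp_add, mul_comm]
    have : exp x ≤ exp 1 := Real.exp_le_exp.mpr hx1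
    have := Real.exp_one_lt_d9
    gcongr; linarith
  rw [Real.mul_rpow hx.le (by linarith)] at h2
  have hxx : x ^ 2 = x ^ (1 - δ) * x ^ (1 + δ) := by
    rw [← Real.rpow_add hx, ← Real.rpow_two]; norm_num
  have hvv : (v + 1) ^ (-δ - 1) = ((v + 1) ^ (1 + δ))⁻¹ := by
    rw [← Real.rpow_neg (by linarith)]; congr 1; ring
  rw [hxx, hvv, Real.exp_neg, ← div_eq_mul_inv, ← div_eq_mul_inv, div_le_div_iff₀ (exp_pos _) (by positivity)]
  have : 0 < x ^ (1 - δ) := by positivity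
  calc x ^ (1 - δ) * x ^ (1 + δ) * (v + 1) ^ (1 + δ) = x ^ (1 - δ) * (x ^ (1 + δ) * (v + 1) ^ (1 + δ)) := by ring
    _ ≤ x ^ (1 - δ) * (2 * (3 * exp (x * v))) := mul_le_mul_of_nonneg_left (by linarith) this.le
    _ = _ := by ring

lemma lap_lin {x : ℝ} (hx : 0 < x) : IntegrableOn (fun v => (v + 2) * exp (-(x * v))) (Set.Ioi 0) ∧
    ∫ v in Set.Ioi (0:ℝ), (v + 2) * exp (-(x * v)) = 1 / x ^ 2 + 2 / x := by
  have hi1 : IntegrableOn (fun v => v * exp (-(x * v))) (Set.Ioi 0) :=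
    lap_int measurable_id (C := 1) (fun u hu => by rw [id, abs_of_pos hu]; nlinarith) hx
  have hi2 : IntegrableOn (fun v => 2 * exp (-(x * v))) (Set.Ioi 0) :=
    lap_int measurable_const (C := 2) (fun u hu => by simp; positivity) hx
  have h1 : ∫ v in Set.Ioi (0:ℝ), v * exp (-(x * v)) = 1 / x ^ 2 := by
    have := Real.integral_rpow_mul_exp_neg_mul_Ioi (a := 2) two_pos hx
    rw [Real.Gamma_two, Real.rpow_two] at this
    norm_num at this
    simpa using this
  have h2 : ∫ v in Set.Ioi (0:ℝ), 2 * exp (-(x * v)) = 2 / x := by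
    have := integral_exp_mul_Ioi (a := -x) (by linarith) 0
    simp only [neg_mul] at this
    rw [integral_const_mul, this]; simp; ring
  constructor
  · simp only [add_mul]; exact hi1.add hi2
  · rw [← h1, ← h2, ← integral_add hi1 hi2]
    simp only [add_mul]

section xi
variable {ξ : ℝ → ℝ} 

lemma Xi_split (hξ0 : ∀ u : ℝ, u < 1 → ξ u = 0)
    (hξ : ∀ u : ℝ, 1 ≤ u → u * ξ u = 2 + 2 * ∫ t in (1:ℝ)..(u - 1), ξ t) (E0 : ℝ) {x : ℝ} (hx : 0 < x) :
    IntegrableOn (fun v => (ξ v - (v + 2) * E0) * exp (-(x * v))) (Set.Ioi 0) ∧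
    Xi ξ x = (∫ v in Set.Ioi (0:ℝ), (ξ v - (v + 2) * E0) * exp (-(x * v))) + E0 * (1 / x ^ 2 + 2 / x) := by
  have h1 := xi_lap hξ0 hξ hx
  obtain ⟨h2, h3⟩ := lap_lin hx
  have e : (fun v => (ξ v - (v + 2) * E0) * exp (-(x * v))) =
      fun v => ξ v * exp (-(x * v)) - E0 * ((v + 2) * exp (-(x * v))) := by
    funext v; ring
  rw [e]
  refine ⟨h1.sub (h2.const_mul E0), ?_⟩
  rw [integral_sub h1 (h2.const_mul E0), integral_const_mul, h3]
  unfold Xi; ring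

lemma A_eq (hξ0 : ∀ u : ℝ, u < 1 → ξ u = 0)
    (hξ : ∀ u : ℝ, 1 ≤ u → u * ξ u = 2 + 2 * ∫ t in (1:ℝ)..(u - 1), ξ t) {E0 δ : ℝ} (h0 : 0 < δ) (h1 : δ < 1)
    (hI : IntegrableOn (fun v => (ξ v - (v + 2) * E0) * (v + 1) ^ (-δ - 1)) (Set.Ioi 0))
    {A : ℝ} (hA : ∀ x, 0 < x → x ^ 2 * (1 + Xi ξ x) = A * exp (2 * EE x)) : A = E0 := by
  set M := ∫ v in Set.Ioi (0:ℝ), ‖(ξ v - (v + 2) * E0) * (v + 1) ^ (-δ - 1)‖ with hM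
  set R : ℝ → ℝ := fun x => ∫ v in Set.Ioi (0:ℝ), (ξ v - (v + 2) * E0) * exp (-(x * v)) with hR
  have hRb : ∀ x, 0 < x → x ≤ 1 → ‖x ^ 2 * R x‖ ≤ 6 * M * x ^ (1 - δ) := by
    intro x hx hx1
    rw [hR]
    simp only
    rw [← integral_const_mul]
    have := norm_integral_le_of_norm_le (μ := volume.restrict (Set.Ioi (0:ℝ)))
      (f := fun v => x ^ 2 * ((ξ v - (v + 2) * E0) * exp (-(x * v))))
      (g := fun v => 6 * x ^ (1 - δ) * ‖(ξ v - (v + 2) * E0) * (v + 1) ^ (-δ - 1)‖) (hI.norm.const_mul _) ?_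
    · refine this.trans (le_of_eq ?_)
      rw [integral_const_mul]; ring
    · rw [ae_restrict_iff' measurableSet_Ioi]
      refine Filter.Eventually.of_forall fun v hv => ?_
      have hv0 : (0:ℝ) < v := hv
      have h := lap_weight hx hx1 hv0 h0 h1
      rw [norm_mul, norm_mul, norm_mul, Real.norm_of_nonneg (sq_nonneg x), Real.norm_of_nonneg (exp_pos _).le,
        Real.norm_of_nonneg (by positivity : 0 ≤ (v + 1) ^ (-δ - 1))]
      have := mul_le_mul_of_nonneg_left h (norm_nonneg (ξ v - (v + 2) * E0))
      linarith
  have hlim : Filter.Tendsto (fun x => x ^ 2 * R x) (nhdsWithin 0 (Set.Ioi 0)) (nhds 0) := by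
    have h2 : Filter.Tendsto (fun x : ℝ => 6 * M * x ^ (1 - δ)) (nhdsWithin 0 (Set.Ioi 0)) (nhds 0) := by
      have : Continuous (fun x : ℝ => 6 * M * x ^ (1 - δ)) :=
        continuous_const.mul (Real.continuous_rpow_const (by linarith))
      have := (this.tendsto 0).mono_left (nhdsWithin_le_nhds (s := Set.Ioi 0))
      rwa [Real.zero_rpow (by linarith), mul_zero] at this
    apply squeeze_zero_norm' _ h2
    filter_upwards [Ioc_mem_nhdsGT (zero_lt_one' ℝ)] with x hx
    exact hRb x hx.1 hx.2
  have hl1 : Filter.Tendsto (fun x => x ^ 2 + x ^ 2 * R x + E0 * (1 + 2 * x)) (nhdsWithin 0 (Set.Ioi 0)) (nhds (0 + 0 + E0)) := by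
    apply Filter.Tendsto.add
    · apply Filter.Tendsto.add _ hlim
      have := ((continuous_pow 2).tendsto (0:ℝ)).mono_left (nhdsWithin_le_nhds (s := Set.Ioi 0))
      simpa using this
    · have : Continuous (fun x : ℝ => E0 * (1 + 2 * x)) := by fun_prop
      have := (this.tendsto 0).mono_left (nhdsWithin_le_nhds (s := Set.Ioi 0))
      simpa using this
  have hl2 : Filter.Tendsto (fun x => A * exp (2 * EE x)) (nhdsWithin 0 (Set.Ioi 0)) (nhds A) := by
    have : Continuous (fun x : ℝ => A * exp (2 * EE x)) :=
      continuous_const.mul (Real.continuous_exp.comp (continuous_const.mul EE_continuous))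
    have := (this.tendsto 0).mono_left (nhdsWithin_le_nhds (s := Set.Ioi 0))
    simpa [EE_zero] using this
  have hl3 : Filter.Tendsto (fun x => A * exp (2 * EE x)) (nhdsWithin 0 (Set.Ioi 0)) (nhds (0 + 0 + E0)) := by
    apply hl1.congr'
    filter_upwards [self_mem_nhdsWithin] with x hx
    have hx0 : (0:ℝ) < x := hx
    have hs := (Xi_split hξ0 hξ E0 hx0).2
    have hs' : Xi ξ x = R x + E0 * (1 / x ^ 2 + 2 / x) := hs
    rw [← hA x hx0, hs']
    field_simp
    ring
  have := tendsto_nhds_unique hl2 hl3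
  simpa using this

lemma fubini_r {r : ℝ → ℝ} (hr : Measurable r) {δ : ℝ} (h0 : 0 < δ)
    (hI : IntegrableOn (fun v => r v * (v + 1) ^ (-δ - 1)) (Set.Ioi 0)) :
    IntegrableOn (fun x => x ^ δ * exp (-x) * ∫ v in Set.Ioi (0:ℝ), r v * exp (-(x * v))) (Set.Ioi 0) ∧
    ∫ x in Set.Ioi (0:ℝ), x ^ δ * exp (-x) * ∫ v in Set.Ioi (0:ℝ), r v * exp (-(x * v)) =
      Gamma (δ + 1) * ∫ v in Set.Ioi (0:ℝ), r v * (v + 1) ^ (-δ - 1) := by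
  set μ := volume.restrict (Set.Ioi (0:ℝ)) with hμ
  set f : ℝ → ℝ → ℝ := fun x v => r v * (x ^ δ * exp (-((v + 1) * x))) with hf
  have hfm : AEStronglyMeasurable (Function.uncurry f) (μ.prod μ) := by
    apply Measurable.aestronglyMeasurable
    apply Measurable.mul (hr.comp measurable_snd)
    apply Measurable.mul (measurable_fst.pow_const δ)
    fun_prop
  have hgam : ∀ v, 0 < v → ∫ x in Set.Ioi (0:ℝ), x ^ δ * exp (-((v + 1) * x)) = Gamma (δ + 1) * (v + 1) ^ (-δ - 1) := by
    intro v hv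
    have := Real.integral_rpow_mul_exp_neg_mul_Ioi (a := δ + 1) (r := v + 1) (by linarith) (by linarith)
    rw [add_sub_cancel_right] at this
    rw [this, mul_comm, one_div, Real.inv_rpow (by linarith), ← Real.rpow_neg (by linarith)]
    congr 2; ring
  have hfi : Integrable (Function.uncurry f) (μ.prod μ) := by
    rw [integrable_prod_iff' hfm]
    constructor
    · rw [hμ, ae_restrict_iff' measurableSet_Ioi]
      refine Filter.Eventually.of_forall fun v hv => ?_
      have hv0 : (0:ℝ) < v := hv
      have := integrableOn_rpow_mul_exp_neg_mul_rpow (s := δ) (p := 1) (b := v + 1) (by linarith) one_pos (by linarith)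
      have := this.const_mul (r v)
      simp only [Real.rpow_one, neg_mul] at this
      exact this
    · have h1 := (hI.norm).const_mul (Gamma (δ + 1))
      apply Integrable.congr h1
      rw [Filter.EventuallyEq, hμ, ae_restrict_iff' measurableSet_Ioi]
      refine Filter.Eventually.of_forall fun v hv => ?_
      have hv0 : (0:ℝ) < v := hv
      simp only [Function.uncurry, hf]
      have : ∀ x ∈ Set.Ioi (0:ℝ), ‖r v * (x ^ δ * exp (-((v + 1) * x)))‖ = ‖r v‖ * (x ^ δ * exp (-((v + 1) * x))) := by
        intro x hx
        have hx0 : (0:ℝ) < x := hx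
        rw [norm_mul, Real.norm_of_nonneg (by positivity : 0 ≤ x ^ δ * exp (-((v + 1) * x)))]
      rw [setIntegral_congr_fun measurableSet_Ioi this, integral_const_mul, hgam v hv0, norm_mul,
        Real.norm_of_nonneg (by positivity : 0 ≤ (v + 1) ^ (-δ - 1))]
      ring
  have e : ∀ x, x ^ δ * exp (-x) * ∫ v in Set.Ioi (0:ℝ), r v * exp (-(x * v)) = ∫ v, f x v ∂μ := by
    intro x
    rw [← integral_const_mul]
    congr 1
    funext v
    rw [hf]
    simp only
    have : -((v + 1) * x) = -x + -(x * v) := by ring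
    rw [this, Real.exp_add]; ring
  rw [show (fun x => x ^ δ * exp (-x) * ∫ v in Set.Ioi (0:ℝ), r v * exp (-(x * v))) = fun x => ∫ v, f x v ∂μ from funext e]
  refine ⟨hfi.integral_prod_left, ?_⟩
  rw [integral_integral_swap hfi, ← integral_const_mul]
  apply setIntegral_congr_fun measurableSet_Ioi
  intro v hv
  simp only [hf]
  rw [integral_const_mul, hgam v hv]
  ring
end xi

lemma int_min {g : ℝ → ℝ} (hg : Measurable g) {C δ : ℝ} (h0 : 0 < δ) (h1 : δ < 1)
    (hb1 : ∀ x, 0 < x → |g x| ≤ C * x) (hb2 : ∀ x, 0 < x → |g x| ≤ C) :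
    IntegrableOn (fun x => g x * x ^ (δ - 2)) (Set.Ioi 0) := by
  have hm : Measurable (fun x => g x * x ^ (δ - 2)) := hg.mul (measurable_id.pow_const _)
  rw [← Set.Ioc_union_Ioi_eq_Ioi (zero_le_one' ℝ)]
  apply IntegrableOn.union
  · have h2 : IntegrableOn (fun x : ℝ => C * x ^ (δ - 1)) (Set.Ioc 0 1) := by
      apply Integrable.const_mul
      have := (intervalIntegral.intervalIntegrable_rpow' (a := 0) (b := 1) (r := δ - 1) (by linarith))
      rwa [intervalIntegrable_iff_integrableOn_Ioc_of_le zero_le_one] at this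
    apply Integrable.mono' h2 hm.aestronglyMeasurable
    rw [ae_restrict_iff' measurableSet_Ioc]
    refine Filter.Eventually.of_forall fun x hx => ?_
    have hx0 : 0 < x := hx.1
    rw [norm_mul, Real.norm_of_nonneg (by positivity : 0 ≤ x ^ (δ - 2)), Real.norm_eq_abs]
    have : x ^ (δ - 1) = x * x ^ (δ - 2) := by
      nth_rewrite 2 [← Real.rpow_one x]
      rw [← Real.rpow_add hx0]; congr 1; ring
    rw [this, ← mul_assoc]
    have := hb1 x hx0
    gcongr
  · have h2 : IntegrableOn (fun x : ℝ => C * x ^ (δ - 2)) (Set.Ioi 1) :=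
      Integrable.const_mul (integrableOn_Ioi_rpow_of_lt (by linarith) one_pos) C
    apply Integrable.mono' h2 hm.aestronglyMeasurable
    rw [ae_restrict_iff' measurableSet_Ioi]
    refine Filter.Eventually.of_forall fun x hx => ?_
    have hx1 : (1:ℝ) < x := hx
    have hx0 : 0 < x := by linarith
    rw [norm_mul, Real.norm_of_nonneg (by positivity : 0 ≤ x ^ (δ - 2)), Real.norm_eq_abs]
    have := hb2 x hx0
    gcongr

lemma expm1_bd {x : ℝ} (hx : 0 < x) : |exp (-x) - 1| ≤ x ∧ |exp (-x) - 1| ≤ 1 := by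
  have h1 : exp (-x) ≤ 1 := by rw [Real.exp_le_one_iff]; linarith
  have h2 := Real.add_one_le_exp (-x)
  have h3 := exp_pos (-x)
  rw [abs_of_nonpos (by linarith)]
  constructor <;> linarith

lemma int_expm1 {δ : ℝ} (h0 : 0 < δ) (h1 : δ < 1) :
    IntegrableOn (fun x => (exp (-x) - 1) * x ^ (δ - 2)) (Set.Ioi 0) ∧
    ∫ x in Set.Ioi (0:ℝ), (exp (-x) - 1) * x ^ (δ - 2) = Gamma δ / (δ - 1) := by
  have hi : IntegrableOn (fun x => (exp (-x) - 1) * x ^ (δ - 2)) (Set.Ioi 0) :=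
    int_min (by fun_prop) h0 h1 (C := 1) (fun x hx => by rw [one_mul]; exact (expm1_bd hx).1)
      (fun x hx => (expm1_bd hx).2)
  refine ⟨hi, ?_⟩
  have hG := Real.GammaIntegral_convergent h0
  have hd : δ - 1 ≠ 0 := by linarith
  have hI := integral_Ioi_of_hasDerivAt_of_tendsto (a := (0:ℝ)) (m := 0)
      (f := fun x => (exp (-x) - 1) * x ^ (δ - 1) / (δ - 1))
      (f' := fun x => (exp (-x) - 1) * x ^ (δ - 2) - (exp (-x) * x ^ (δ - 1)) / (δ - 1)) ?_ ?_ ?_ ?_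
  · rw [integral_sub hi (hG.div_const _), integral_div, ← Real.Gamma_eq_integral h0] at hI
    simp at hI
    linarith
  · unfold ContinuousWithinAt
    have h2 : Filter.Tendsto (fun x : ℝ => x ^ δ / (1 - δ)) (nhdsWithin 0 (Set.Ici 0)) (nhds 0) := by
      have : Continuous (fun x : ℝ => x ^ δ / (1 - δ)) := (Real.continuous_rpow_const h0.le).div_const _
      have := (this.tendsto 0).mono_left (nhdsWithin_le_nhds (s := Set.Ici 0))
      simpa [Real.zero_rpow h0.ne'] using this
    simp only [neg_zero, Real.exp_zero, sub_self, zero_mul, zero_div]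
    apply squeeze_zero_norm' _ h2
    filter_upwards [self_mem_nhdsWithin] with x hx
    rcases eq_or_lt_of_le (show (0:ℝ) ≤ x from hx) with rfl | hx0
    · simp [Real.zero_rpow h0.ne']
    · rw [norm_div, norm_mul, Real.norm_of_nonneg (by positivity : 0 ≤ x ^ (δ - 1)), Real.norm_eq_abs,
        Real.norm_eq_abs, abs_of_neg (by linarith : δ - 1 < 0), neg_sub]
      have : x ^ δ = x * x ^ (δ - 1) := by
        nth_rewrite 2 [← Real.rpow_one x]
        rw [← Real.rpow_add hx0]; congr 1; ring
      rw [this]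
      have := (expm1_bd hx0).1
      have : 0 < 1 - δ := by linarith
      gcongr
  · intro x hx
    have hx0 : (0:ℝ) < x := hx
    have a1 : HasDerivAt (fun x => exp (-x) - 1) (-exp (-x)) x :=
      HasDerivAt.congr_deriv ((hasDerivAt_neg x).exp.sub_const 1) (by ring)
    have a2 := Real.hasDerivAt_rpow_const (x := x) (p := δ - 1) (Or.inl hx0.ne')
    refine HasDerivAt.congr_deriv ((a1.mul a2).div_const (δ - 1)) ?_
    have : δ - 1 - 1 = δ - 2 := by ring
    rw [this]
    field_simp
    ring
  · exact hi.sub (hG.div_const _)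
  · have h2 : Filter.Tendsto (fun x : ℝ => x ^ (-(1 - δ)) / (1 - δ)) Filter.atTop (nhds 0) := by
      have := (tendsto_rpow_neg_atTop (y := 1 - δ) (by linarith)).div_const (1 - δ)
      simpa using this
    apply squeeze_zero_norm' _ h2
    filter_upwards [Filter.eventually_gt_atTop (0:ℝ)] with x hx0
    rw [norm_div, norm_mul, Real.norm_of_nonneg (by positivity : 0 ≤ x ^ (δ - 1)), Real.norm_eq_abs,
        Real.norm_eq_abs, abs_of_neg (by linarith : δ - 1 < 0), neg_sub, neg_sub]
    have := (expm1_bd hx0).2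
    have : 0 < 1 - δ := by linarith
    apply div_le_div_of_nonneg_right _ this.le
    apply mul_le_of_le_one_left (by positivity)
    assumption

lemma kap_two_bd {x : ℝ} (hx : 0 ≤ x) : |kap 2 x - 1| ≤ 9 * x ∧ |kap 2 x - 1| ≤ 9 := by
  have h1 := kap_bdd (Or.inr rfl : 2 = 1 ∨ 2 = 2) hx
  have h2 := kap_pos 2 x
  have he : exp 2 < 8 := by
    have := Real.exp_one_lt_d9
    have h3 : exp 2 = exp 1 * exp 1 := by rw [← Real.exp_add]; norm_num
    rw [h3]; nlinarith [exp_pos 1]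
  have h9 : |kap 2 x - 1| ≤ 9 := by rw [abs_le]; constructor <;> linarith
  refine ⟨?_, h9⟩
  rcases le_total x 1 with h | h
  · have h3 := EE_le_self hx
    have h4 : 0 ≤ EE x := by rw [← EE_zero]; exact EE_mono hx
    have h5 : |((2:ℕ):ℝ) * EE x - x| ≤ x := by push_cast; rw [abs_le]; constructor <;> linarith
    have := Real.abs_exp_sub_one_le (x := ((2:ℕ):ℝ) * EE x - x) (h5.trans h)
    unfold kap
    linarith
  · linarith

lemma E0_numeric {δ : ℝ} (hδ1 : 0.713611 < δ) (hδ2 : δ < 0.713614) :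
    0 < 1 + exp (-2 * eulerMascheroniConstant) / δ + exp (-2 * eulerMascheroniConstant) / (δ - 1) := by
  have h1 : exp (-2 * eulerMascheroniConstant) < 0.3678794412 := by
    refine lt_trans ?_ Real.exp_neg_one_lt_d9
    apply Real.exp_lt_exp.mpr
    linarith [Real.one_half_lt_eulerMascheroniConstant]
  have h2 := exp_pos (-2 * eulerMascheroniConstant)
  set E := exp (-2 * eulerMascheroniConstant)
  have h3 : 1 + E / δ + E / (δ - 1) = (δ * (1 - δ) + E * (1 - 2 * δ)) / (δ * (1 - δ)) := by
    have : δ ≠ 0 := by linarith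
    have : 1 - δ ≠ 0 := by linarith
    have : δ - 1 ≠ 0 := by linarith
    rw [eq_div_iff (by positivity)]
    field_simp
    ring
  rw [h3]
  apply div_pos
  · nlinarith
  · nlinarith

lemma kap_int_zero {ξ : ℝ → ℝ} (hξ0 : ∀ u : ℝ, u < 1 → ξ u = 0)
    (hξ : ∀ u : ℝ, 1 ≤ u → u * ξ u = 2 + 2 * ∫ t in (1:ℝ)..(u - 1), ξ t)
    {δ : ℝ} (hδ1 : 0.713611 < δ) (hδ2 : δ < 0.713614)
    (hδeq : 0 = 1 + (∫ v in Set.Ioi (0:ℝ),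
          (ξ v - (v + 2) * Real.exp (-2 * Real.eulerMascheroniConstant)) *
            (v + 1) ^ (-δ - 1)) +
        Real.exp (-2 * Real.eulerMascheroniConstant) / δ +
        Real.exp (-2 * Real.eulerMascheroniConstant) / (δ - 1)) :
    IntegrableOn (fun x => (kap 2 x - 1) * x ^ (δ - 2)) (Set.Ioi 0) ∧
    ∫ x in Set.Ioi (0:ℝ), (kap 2 x - 1) * x ^ (δ - 2) = 0 := by
  have h0 : 0 < δ := by linarith
  have h1 : δ < 1 := by linarith
  have hnum := E0_numeric hδ1 hδ2
  have hE0 := exp_pos (-2 * eulerMascheroniConstant)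
  set E0 := exp (-2 * eulerMascheroniConstant) with hE
  refine ⟨int_min ((kap_continuous 2).measurable.sub_const 1) h0 h1 (fun x hx => (kap_two_bd hx.le).1)
    (fun x hx => (kap_two_bd hx.le).2), ?_⟩
  by_cases hI : IntegrableOn (fun v => (ξ v - (v + 2) * E0) * (v + 1) ^ (-δ - 1)) (Set.Ioi 0)
  swap
  · rw [integral_undef hI] at hδeq
    linarith
  obtain ⟨A, hA⟩ := Xi_const hξ0 hξ
  have hAE := A_eq hξ0 hξ h0 h1 hI hA
  have hr : Measurable (fun v => ξ v - (v + 2) * E0) := (xi_meas hξ0 hξ).sub (by fun_prop)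
  obtain ⟨f1, f2⟩ := fubini_r hr h0 hI
  obtain ⟨g1, g2⟩ := int_expm1 h0 h1
  have hG1 := Real.GammaIntegral_convergent h0
  have hG2 := Real.GammaIntegral_convergent (show 0 < δ + 1 by linarith)
  have hG1e := Real.Gamma_eq_integral h0
  have hG2e := Real.Gamma_eq_integral (show 0 < δ + 1 by linarith)
  have hGrec := Real.Gamma_add_one h0.ne'
  have hpt : ∀ x ∈ Set.Ioi (0:ℝ), (kap 2 x - 1) * x ^ (δ - 2) =
      E0⁻¹ * (exp (-x) * x ^ (δ + 1 - 1) +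
      x ^ δ * exp (-x) * (∫ v in Set.Ioi (0:ℝ), (ξ v - (v + 2) * E0) * exp (-(x * v)))
      + E0 * ((exp (-x) - 1) * x ^ (δ - 2)) + (2 * E0) * (exp (-x) * x ^ (δ - 1))) := by
    intro x hx
    have hx0 : (0:ℝ) < x := hx
    have hs := (Xi_split hξ0 hξ E0 hx0).2
    set R := ∫ v in Set.Ioi (0:ℝ), (ξ v - (v + 2) * E0) * exp (-(x * v))
    have hA' := hA x hx0
    rw [hAE, hs] at hA'
    have hk : kap 2 x = exp (2 * EE x) * exp (-x) := by
      unfold kap; rw [← Real.exp_add]; congr 1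
    have p1 : x ^ δ = x ^ 2 * x ^ (δ - 2) := by
      rw [← Real.rpow_two, ← Real.rpow_add hx0]; congr 1; ring
    have p2 : x ^ (δ - 1) = x * x ^ (δ - 2) := by
      nth_rewrite 2 [← Real.rpow_one x]
      rw [← Real.rpow_add hx0]; congr 1; ring
    rw [add_sub_cancel_right, p1, p2]
    have hEE : exp (2 * EE x) = E0⁻¹ * (x ^ 2 * (1 + (R + E0 * (1 / x ^ 2 + 2 / x)))) := by
      rw [hA']; field_simp
    rw [hk, hEE]
    field_simp
    ring
  rw [setIntegral_congr_fun measurableSet_Ioi hpt, integral_const_mul]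
  rw [integral_add, integral_add, integral_add hG2 f1, integral_const_mul, integral_const_mul, f2, g2, ← hG1e, ← hG2e,
    hGrec]
  · have hd1 : δ - 1 ≠ 0 := by linarith
    have hd0 := h0.ne'
    have : (∫ v in Set.Ioi (0:ℝ), (ξ v - (v + 2) * E0) * (v + 1) ^ (-δ - 1)) = - 1 - E0 / δ - E0 / (δ - 1) := by
      linarith
    rw [this]
    field_simp
    ring
  · exact hG2.add f1
  · exact g1.const_mul E0
  · exact (hG2.add f1).add (g1.const_mul E0)
  · exact hG1.const_mul _

lemma EE_half {y z : ℝ} (hy : 0 < y) (hyz : y ≤ z) (h : EE y ≤ y / 2) : EE z ≤ z / 2 := by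
  have h1 := (EE_slope hy.le).1
  have h2 := (EE_slope hyz).2
  rw [EE_zero, sub_zero, sub_zero] at h1
  have h3 : e1 y ≤ 1 / 2 := by
    by_contra hc
    push Not at hc
    nlinarith
  nlinarith

lemma kap_two_half {x : ℝ} (hx : 16 ≤ x) : kap 2 x ≤ 1 / 2 := by
  have h1 := EE_log_upper (show 1 ≤ x by linarith)
  have h2 : log x ≤ x / 4 - 1 + 2 * log 2 := by
    have h3 := Real.log_le_sub_one_of_pos (show 0 < x / 4 by linarith)
    rw [Real.log_div (by linarith) (by norm_num)] at h3
    have : log 4 = 2 * log 2 := by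
      rw [show (4:ℝ) = 2 ^ 2 by norm_num, Real.log_pow]; norm_num
    linarith
  have h4 := Real.log_two_lt_d9
  have h5 : kap 2 x ≤ exp (-1) := by
    unfold kap
    apply Real.exp_le_exp.mpr
    push_cast
    linarith
  have := Real.exp_neg_one_lt_d9
  linarith

noncomputable def FF (δ x : ℝ) : ℝ := ∫ z in Set.Ioi x, (1 - kap 2 z) * z ^ (δ - 2)

section
variable {δ : ℝ}

lemma gk_int (h0 : 0 < δ) (h1 : δ < 1) : IntegrableOn (fun x => (1 - kap 2 x) * x ^ (δ - 2)) (Set.Ioi 0) :=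
  int_min (measurable_const.sub (kap_continuous 2).measurable) h0 h1 (C := 9)
    (fun x hx => by change |1 - kap 2 x| ≤ _; rw [abs_sub_comm]; exact (kap_two_bd hx.le).1)
    (fun x hx => by change |1 - kap 2 x| ≤ _; rw [abs_sub_comm]; exact (kap_two_bd hx.le).2)

lemma FF_eq (h0 : 0 < δ) (h1 : δ < 1)
    (hz : ∫ x in Set.Ioi (0:ℝ), (1 - kap 2 x) * x ^ (δ - 2) = 0) {x : ℝ} (hx : 0 < x) :
    FF δ x = ∫ z in Set.Ioc 0 x, (kap 2 z - 1) * z ^ (δ - 2) := by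
  have hi := gk_int h0 h1
  rw [← Set.Ioc_union_Ioi_eq_Ioi hx.le, setIntegral_union (Set.Ioc_disjoint_Ioi le_rfl) measurableSet_Ioi
    (hi.mono_set Set.Ioc_subset_Ioi_self) (hi.mono_set (Set.Ioi_subset_Ioi hx.le))] at hz
  have : ∀ z, (kap 2 z - 1) * z ^ (δ - 2) = -((1 - kap 2 z) * z ^ (δ - 2)) := fun z => by ring
  simp only [this]
  rw [integral_neg]
  unfold FF
  linarith

lemma kap_le_one_iff (z : ℝ) : kap 2 z ≤ 1 ↔ EE z ≤ z / 2 := by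
  unfold kap
  rw [Real.exp_le_one_iff]
  push_cast
  constructor <;> intro h <;> linarith

lemma FF_nonneg (h0 : 0 < δ) (h1 : δ < 1)
    (hz : ∫ x in Set.Ioi (0:ℝ), (1 - kap 2 x) * x ^ (δ - 2) = 0) {x : ℝ} (hx : 0 < x) : 0 ≤ FF δ x := by
  by_cases h : EE x ≤ x / 2
  · apply setIntegral_nonneg measurableSet_Ioi
    intro z hz
    have hz' : x < z := hz
    have : kap 2 z ≤ 1 := (kap_le_one_iff z).mpr (EE_half hx hz'.le h)
    have : 0 < z := by linarith
    apply mul_nonneg (by linarith) (by positivity)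
  · rw [FF_eq h0 h1 hz hx]
    apply setIntegral_nonneg measurableSet_Ioc
    intro z hz
    have hz0 := hz.1
    have : 1 < kap 2 z := by
      by_contra hc
      push Not at hc
      exact h (EE_half hz.1 hz.2 ((kap_le_one_iff z).mp hc))
    apply mul_nonneg (by linarith) (by positivity)

lemma rpow_tail (h1 : δ < 1) {x : ℝ} (hx : 0 < x) : ∫ z in Set.Ioi x, z ^ (δ - 2) = x ^ (δ - 1) / (1 - δ) := by
  rw [integral_Ioi_rpow_of_lt (by linarith) hx]
  have : δ - 2 + 1 = δ - 1 := by ring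
  rw [this, ← neg_sub δ 1, div_neg, neg_div]

lemma FF_le_tail (h0 : 0 < δ) (h1 : δ < 1) {x : ℝ} (hx : 0 < x) : FF δ x ≤ x ^ (δ - 1) / (1 - δ) := by
  rw [← rpow_tail h1 hx]
  unfold FF
  apply setIntegral_mono_on ((gk_int h0 h1).mono_set (Set.Ioi_subset_Ioi hx.le))
    (integrableOn_Ioi_rpow_of_lt (by linarith) hx) measurableSet_Ioi
  intro z hz
  have hz' : x < z := hz
  have : 0 < z := by linarith
  have h2 := kap_pos 2 z
  apply mul_le_of_le_one_left (by positivity) (by linarith)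

lemma FF_ge_tail (h0 : 0 < δ) (h1 : δ < 1) {x : ℝ} (hx : 16 ≤ x) : 1 / 2 * (x ^ (δ - 1) / (1 - δ)) ≤ FF δ x := by
  have hx0 : 0 < x := by linarith
  rw [← rpow_tail h1 hx0, ← integral_const_mul]
  unfold FF
  apply setIntegral_mono_on ((integrableOn_Ioi_rpow_of_lt (by linarith) hx0).const_mul _)
    ((gk_int h0 h1).mono_set (Set.Ioi_subset_Ioi hx0.le)) measurableSet_Ioi
  intro z hz
  have hz' : x < z := hz
  have : 0 < z := by linarith
  have h2 := kap_two_half (show 16 ≤ z by linarith)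
  apply mul_le_mul_of_nonneg_right (by linarith) (by positivity)

lemma FF_le_small (h0 : 0 < δ) (h1 : δ < 1)
    (hz : ∫ x in Set.Ioi (0:ℝ), (1 - kap 2 x) * x ^ (δ - 2) = 0) {x : ℝ} (hx : 0 < x) :
    FF δ x ≤ 9 * x ^ δ / δ := by
  rw [FF_eq h0 h1 hz hx]
  have hi : IntegrableOn (fun z : ℝ => z ^ (δ - 1)) (Set.Ioc 0 x) := by
    have := (intervalIntegral.intervalIntegrable_rpow' (a := 0) (b := x) (r := δ - 1) (by linarith))
    rwa [intervalIntegrable_iff_integrableOn_Ioc_of_le hx.le] at this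
  have hval : ∫ z in Set.Ioc 0 x, 9 * z ^ (δ - 1) = 9 * x ^ δ / δ := by
    rw [integral_const_mul, ← intervalIntegral.integral_of_le hx.le, integral_rpow (Or.inl (by linarith))]
    simp [Real.zero_rpow h0.ne']
    ring
  rw [← hval]
  have hi2 : IntegrableOn (fun z => (kap 2 z - 1) * z ^ (δ - 2)) (Set.Ioc 0 x) := by
    have := ((gk_int h0 h1).mono_set (Set.Ioc_subset_Ioi_self : Set.Ioc 0 x ⊆ Set.Ioi 0)).neg
    apply this.congr_fun _ measurableSet_Ioc
    intro z _
    simp only [Pi.neg_apply]; ring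
  apply setIntegral_mono_on hi2 (hi.const_mul 9) measurableSet_Ioc
  intro z hz
  have hz0 := hz.1
  have h2 := (abs_le.mp (kap_two_bd hz0.le).1).2
  have : z ^ (δ - 1) = z * z ^ (δ - 2) := by
    nth_rewrite 2 [← Real.rpow_one z]
    rw [← Real.rpow_add hz0]; congr 1; ring
  rw [this, ← mul_assoc]
  exact mul_le_mul_of_nonneg_right h2 (by positivity)

lemma FF_subst {a l : ℝ} (ha : 0 < a) (hl : 0 < l) :
    l ^ (1 - δ) * FF δ (a * l) = ∫ ε in Set.Ioi a, (1 - kap 2 (ε * l)) * ε ^ (δ - 2) := by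
  have h := integral_comp_mul_right_Ioi (fun z => (1 - kap 2 z) * z ^ (δ - 2)) a hl
  have h2 : ∫ ε in Set.Ioi a, (1 - kap 2 (ε * l)) * (ε * l) ^ (δ - 2) =
      l ^ (δ - 2) * ∫ ε in Set.Ioi a, (1 - kap 2 (ε * l)) * ε ^ (δ - 2) := by
    rw [← integral_const_mul]
    apply setIntegral_congr_fun measurableSet_Ioi
    intro ε hε
    have hε' : a < ε := hε
    simp only
    rw [Real.mul_rpow (by linarith) hl.le]; ring
  rw [h2] at h
  unfold FF
  rw [smul_eq_mul] at h
  have h3 : l ^ (1 - δ) = l⁻¹ * (l ^ (δ - 2))⁻¹ := by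
    rw [← Real.rpow_neg hl.le, ← Real.rpow_neg_one, ← Real.rpow_add hl]; congr 1; ring
  have h4 : l ^ (δ - 2) ≠ 0 := by positivity
  rw [h3]
  generalize (∫ ε in Set.Ioi a, (1 - kap 2 (ε * l)) * ε ^ (δ - 2)) = I at h ⊢
  generalize (∫ (z : ℝ) in Set.Ioi (a * l), (1 - kap 2 z) * z ^ (δ - 2)) = J at h ⊢
  calc l⁻¹ * (l ^ (δ - 2))⁻¹ * J = (l ^ (δ - 2))⁻¹ * (l⁻¹ * J) := by ring
    _ = (l ^ (δ - 2))⁻¹ * (l ^ (δ - 2) * I) := by rw [h]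
    _ = I := by field_simp
end

noncomputable def GY (t ε : ℝ) : ℝ := 1 - ∑' n, nu 2 t n * kap 2 (ε * ell t n)

lemma GY_cont {t : ℝ} (ht : 2 ≤ t) : ContinuousOn (GY t) (Set.Ici 0) := by
  unfold GY
  apply continuousOn_const.sub
  have hs := ((nu_hasSum (Or.inr rfl : 2 = 1 ∨ 2 = 2) ht).summable).mul_right (exp 2)
  apply continuousOn_tsum (u := fun n => nu 2 t n * exp 2) _ hs
  · intro n ε hε
    rw [norm_mul, Real.norm_of_nonneg (nu_nonneg _ _ _), Real.norm_of_nonneg (kap_pos _ _).le]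
    exact mul_le_mul_of_nonneg_left (kap_bdd (Or.inr rfl) (mul_nonneg hε (ell_nonneg ht n))) (nu_nonneg _ _ _)
  · intro n
    exact (continuous_const.mul ((kap_continuous 2).comp (continuous_id.mul continuous_const))).continuousOn

lemma GY_eq {t : ℝ} (ht : 2 ≤ t) {ε : ℝ} (hε : 0 ≤ ε) :
    HasSum (fun n => nu 2 t n * (1 - kap 2 (ε * ell t n))) (GY t ε) := by
  have h1 := nu_hasSum (Or.inr rfl : 2 = 1 ∨ 2 = 2) ht
  have h2 : Summable (fun n => nu 2 t n * kap 2 (ε * ell t n)) := by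
    apply nu_summable_mul (Or.inr rfl) ht (C := exp 2)
    intro n
    rw [abs_of_pos (kap_pos _ _)]
    exact kap_bdd (Or.inr rfl) (mul_nonneg hε (ell_nonneg ht n))
  have := h1.sub h2.hasSum
  simpa only [mul_sub, mul_one, GY] using this

lemma GY_bd {t : ℝ} (ht : 2 ≤ t) {ε : ℝ} (hε : 0 ≤ ε) : |GY t ε| ≤ 9 ∧ GY t ε ≤ 1 := by
  have h := GY_eq ht hε
  have h1 := nu_hasSum (Or.inr rfl : 2 = 1 ∨ 2 = 2) ht
  have hb : ∀ n, |1 - kap 2 (ε * ell t n)| ≤ 9 := fun n => by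
    rw [abs_sub_comm]; exact (kap_two_bd (mul_nonneg hε (ell_nonneg ht n))).2
  constructor
  · rw [abs_le]
    have h9 := h1.mul_right 9
    rw [one_mul] at h9
    constructor
    · have := hasSum_le (fun n => ?_) h9.neg h
      · exact this
      · have := mul_le_mul_of_nonneg_left (abs_le.mp (hb n)).1 (nu_nonneg 2 t n)
        linarith
    · refine hasSum_le (fun n => ?_) h h9
      exact mul_le_mul_of_nonneg_left (abs_le.mp (hb n)).2 (nu_nonneg 2 t n)
  · refine hasSum_le (fun n => ?_) h h1
    apply mul_le_of_le_one_right (nu_nonneg _ _ _)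
    linarith [kap_pos 2 (ε * ell t n)]

lemma GY_int {t : ℝ} (ht : 2 ≤ t) {δ a : ℝ} (h1 : δ < 1) (ha : 0 < a) :
    IntegrableOn (fun ε => GY t ε * ε ^ (δ - 2)) (Set.Ioi a) := by
  have h := (integrableOn_Ioi_rpow_of_lt (show δ - 2 < -1 by linarith) ha).const_mul 9
  apply Integrable.mono' h
  · apply ContinuousOn.aestronglyMeasurable _ measurableSet_Ioi
    apply ContinuousOn.mul ((GY_cont ht).mono (fun x hx => le_of_lt (lt_trans ha hx)))
    apply ContinuousOn.rpow_const continuousOn_id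
    intro x hx
    exact Or.inl (lt_trans ha hx).ne'
  · rw [ae_restrict_iff' measurableSet_Ioi]
    refine Filter.Eventually.of_forall fun x hx => ?_
    have hx0 : 0 < x := lt_trans ha hx
    rw [norm_mul, Real.norm_of_nonneg (by positivity : 0 ≤ x ^ (δ - 2)), Real.norm_eq_abs]
    exact mul_le_mul_of_nonneg_right (GY_bd ht hx0.le).1 (by positivity)

lemma Q_eq {t : ℝ} (ht : 2 ≤ t) {δ a : ℝ} (h0 : 0 < δ) (h1 : δ < 1) (ha : 0 < a) :
    HasSum (fun n => nu 2 t n * ((ell t n) ^ (1 - δ) * FF δ (a * ell t n)))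
      (∫ ε in Set.Ioi a, GY t ε * ε ^ (δ - 2)) := by
  have hr := integrableOn_Ioi_rpow_of_lt (show δ - 2 < -1 by linarith) ha
  have hbd : ∀ n : ℕ, ∀ ε ∈ Set.Ioi a, ‖nu 2 t n * ((1 - kap 2 (ε * ell t n)) * ε ^ (δ - 2))‖ ≤
      nu 2 t n * (9 * ε ^ (δ - 2)) := by
    intro n ε hε
    have hε0 : 0 < ε := lt_trans ha hε
    rw [norm_mul, norm_mul, Real.norm_of_nonneg (nu_nonneg _ _ _), Real.norm_of_nonneg (by positivity : 0 ≤ ε ^ (δ - 2)),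
      Real.norm_eq_abs, abs_sub_comm]
    apply mul_le_mul_of_nonneg_left _ (nu_nonneg _ _ _)
    exact mul_le_mul_of_nonneg_right (kap_two_bd (mul_nonneg hε0.le (ell_nonneg ht n))).2 (by positivity)
  have hFi : ∀ n : ℕ, Integrable (fun ε => nu 2 t n * ((1 - kap 2 (ε * ell t n)) * ε ^ (δ - 2)))
      (volume.restrict (Set.Ioi a)) := by
    intro n
    apply Integrable.mono' ((hr.const_mul 9).const_mul (nu 2 t n))
    · apply Measurable.aestronglyMeasurable
      apply Measurable.const_mul
      apply Measurable.mul _ (measurable_id.pow_const _)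
      exact measurable_const.sub ((kap_continuous 2).measurable.comp (measurable_id.mul_const _))
    · rw [ae_restrict_iff' measurableSet_Ioi]
      exact Filter.Eventually.of_forall (hbd n)
  have hsum : Summable (fun n => ∫ ε in Set.Ioi a, ‖nu 2 t n * ((1 - kap 2 (ε * ell t n)) * ε ^ (δ - 2))‖) := by
    have hs := ((nu_hasSum (Or.inr rfl : 2 = 1 ∨ 2 = 2) ht).summable).mul_right (∫ ε in Set.Ioi a, 9 * ε ^ (δ - 2))
    apply Summable.of_nonneg_of_le _ _ hs
    · intro n; positivity
    · intro n
      rw [← integral_const_mul]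
      exact setIntegral_mono_on (hFi n).norm ((hr.const_mul 9).const_mul _) measurableSet_Ioi (hbd n)
  have h := hasSum_integral_of_summable_integral_norm hFi hsum
  have e1 : ∫ ε in Set.Ioi a, ∑' n, nu 2 t n * ((1 - kap 2 (ε * ell t n)) * ε ^ (δ - 2)) =
      ∫ ε in Set.Ioi a, GY t ε * ε ^ (δ - 2) := by
    apply setIntegral_congr_fun measurableSet_Ioi
    intro ε hε
    have hε0 : 0 < ε := lt_trans ha hε
    simp only
    rw [← (GY_eq ht hε0.le).tsum_eq, ← tsum_mul_right]
    congr 1; funext n; ring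
  rw [e1] at h
  suffices hfe : (fun n => nu 2 t n * ((ell t n) ^ (1 - δ) * FF δ (a * ell t n))) =
      (fun n => ∫ ε in Set.Ioi a, nu 2 t n * ((1 - kap 2 (ε * ell t n)) * ε ^ (δ - 2))) by
    rw [hfe]; exact h
  funext n
  rw [integral_const_mul]
  rcases Nat.eq_zero_or_pos n with rfl | hn
  · have : nu 2 t 0 = 0 := nu_zero_of_not (fun h => absurd h.1 (lt_irrefl 0))
    rw [this, zero_mul, zero_mul]
  · rw [FF_subst ha]
    have := ell_ge ht hn
    have := log_t_ge ht
    linarith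

lemma Hdata_two {δ : ℝ} (h0 : 0 < δ) (h1 : δ < 1)
    (hz : ∫ x in Set.Ioi (0:ℝ), (1 - kap 2 x) * x ^ (δ - 2) = 0) : Hdata 2 (1 - δ) 1 := by
  obtain ⟨C, t0, hC, ht0, hY⟩ := one_sub_Y
  have hd : 0 < 1 - δ := by linarith
  have key : ∀ t, 2 ≤ t → ∀ a, 0 < a →
      ∑' n, nu 2 t n * ((a * ell t n) ^ (1 - δ) * FF δ (a * ell t n)) =
      a ^ (1 - δ) * ∫ ε in Set.Ioi a, GY t ε * ε ^ (δ - 2) := by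
    intro t ht a ha
    rw [← (Q_eq ht h0 h1 ha).tsum_eq, ← tsum_mul_left]
    congr 1; funext n
    rw [Real.mul_rpow ha.le (ell_nonneg ht n)]; ring
  have hQ0 : ∀ t, 2 ≤ t → ∀ a, 0 < a → 0 ≤ ∫ ε in Set.Ioi a, GY t ε * ε ^ (δ - 2) := by
    intro t ht a ha
    refine (Q_eq ht h0 h1 ha).nonneg fun n => ?_
    rcases Nat.eq_zero_or_pos n with rfl | hn
    · have : nu 2 t 0 = 0 := nu_zero_of_not (fun h => absurd h.1 (lt_irrefl 0))
      rw [this, zero_mul]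
    · have h2 := ell_ge ht hn
      have h3 := log_t_ge ht
      have h4 : 0 < ell t n := by linarith
      have := FF_nonneg h0 h1 hz (mul_pos ha h4)
      have := nu_nonneg 2 t n
      positivity
  have hsplit : ∀ t, 2 ≤ t → ∀ a b, 0 < a → a ≤ b → ∫ ε in Set.Ioi a, GY t ε * ε ^ (δ - 2) =
      (∫ ε in Set.Ioc a b, GY t ε * ε ^ (δ - 2)) + ∫ ε in Set.Ioi b, GY t ε * ε ^ (δ - 2) := by
    intro t ht a b ha hab
    have hi := GY_int ht h1 ha
    rw [← Set.Ioc_union_Ioi_eq_Ioi hab, setIntegral_union (Set.Ioc_disjoint_Ioi le_rfl) measurableSet_Ioi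
      (hi.mono_set Set.Ioc_subset_Ioi_self) (hi.mono_set (Set.Ioi_subset_Ioi hab))]
  have hpow : ∀ z : ℝ, 0 < z → z * z ^ (δ - 2) = z ^ (δ - 1) := by
    intro z hz
    nth_rewrite 1 [← Real.rpow_one z]
    rw [← Real.rpow_add hz]; congr 1; ring
  have hpow' : ∀ z : ℝ, 0 < z → z * z ^ (δ - 1) = z ^ δ := by
    intro z hz
    nth_rewrite 1 [← Real.rpow_one z]
    rw [← Real.rpow_add hz]; congr 1; ring
  set C' := C / δ + 1 / (1 - δ) + 9 / δ with hC'
  have hC'0 : 0 < C' := by positivity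
  have hlogt : ∀ t : ℝ, 2 ≤ t → log t * (1 / log t) ^ δ = (log t) ^ (1 - δ) := by
    intro t ht
    have := log_t_ge ht
    have hl : 0 < log t := by linarith
    rw [one_div, Real.inv_rpow hl.le, ← Real.rpow_neg hl.le]
    nth_rewrite 1 [← Real.rpow_one (log t)]
    rw [← Real.rpow_add hl]; congr 1
  refine ⟨fun x => x ^ (1 - δ) * FF δ x, C', min (1/8) (1 / 2 * (1 / (1 - δ))), 16, 1 / 2, t0, hC'0, by positivity,
    by norm_num, by norm_num, ht0, ?_, ?_, ?_, ?_⟩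
  · intro x hx
    rcases eq_or_lt_of_le hx with rfl | hx0
    · simp only [Real.zero_rpow hd.ne', zero_mul, Real.zero_rpow one_ne_zero, mul_zero, le_refl, true_and, and_true]
      exact hC'0.le
    · have a1 := FF_nonneg h0 h1 hz hx0
      have a2 := FF_le_tail h0 h1 hx0
      have a3 := FF_le_small h0 h1 hz hx0
      have p0 : 0 < x ^ (1 - δ) := by positivity
      have b1 : x ^ (1 - δ) * (x ^ (δ - 1) / (1 - δ)) = 1 / (1 - δ) := by
        rw [← mul_div_assoc, ← Real.rpow_add hx0]; simp
      have b2 : x ^ (1 - δ) * (9 * x ^ δ / δ) = 9 / δ * x := by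
        have : x ^ (1 - δ) * x ^ δ = x := by rw [← Real.rpow_add hx0]; simp
        calc x ^ (1 - δ) * (9 * x ^ δ / δ) = 9 / δ * (x ^ (1 - δ) * x ^ δ) := by ring
          _ = _ := by rw [this]
      have c1 := mul_le_mul_of_nonneg_left a2 p0.le
      have c2 := mul_le_mul_of_nonneg_left a3 p0.le
      rw [b1] at c1
      rw [b2] at c2
      refine ⟨by positivity, ?_, ?_⟩
      · have : 1 / (1 - δ) ≤ C' := by
          have : 0 < C / δ := by positivity
          have : 0 < 9 / δ := by positivity
          linarith
        linarith
      · rw [Real.rpow_one]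
        have : 9 / δ ≤ C' := by
          have : 0 < C / δ := by positivity
          have : 0 < 1 / (1 - δ) := by positivity
          linarith
        have := mul_le_mul_of_nonneg_right this hx
        linarith
  · intro x hx
    have hx0 : 0 < x := by linarith
    have a1 := FF_ge_tail h0 h1 hx
    have p0 : 0 < x ^ (1 - δ) := by positivity
    have b1 : x ^ (1 - δ) * (1 / 2 * (x ^ (δ - 1) / (1 - δ))) = 1 / 2 * (1 / (1 - δ)) := by
      have : x ^ (1 - δ) * x ^ (δ - 1) = 1 := by rw [← Real.rpow_add hx0]; simp
      calc x ^ (1 - δ) * (1 / 2 * (x ^ (δ - 1) / (1 - δ))) = 1 / 2 * ((x ^ (1 - δ) * x ^ (δ - 1)) / (1 - δ)) := by ring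
        _ = _ := by rw [this]
    have c1 := mul_le_mul_of_nonneg_left a1 p0.le
    rw [b1] at c1
    exact (min_le_right _ _).trans c1
  · intro t ht a ha hab
    have hl := log_t_ge ht
    have hl0 : 0 < log t := by linarith
    set b := 1 / log t with hb
    have hb0 : 0 < b := by positivity
    have hlb : log t * b = 1 := by rw [hb]; field_simp
    have hab' : a ≤ b := by rw [hb, le_div_iff₀ hl0]; linarith
    rw [key t ht a ha, hsplit t ht a b ha hab']
    have i1 : ∫ ε in Set.Ioi b, GY t ε * ε ^ (δ - 2) ≤ b ^ (δ - 1) / (1 - δ) := by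
      rw [← rpow_tail h1 hb0]
      apply setIntegral_mono_on (GY_int ht h1 hb0) (integrableOn_Ioi_rpow_of_lt (by linarith) hb0) measurableSet_Ioi
      intro ε hε
      have hε0 : 0 < ε := lt_trans hb0 hε
      exact mul_le_of_le_one_left (by positivity) (GY_bd ht hε0.le).2
    have hi : IntegrableOn (fun z : ℝ => z ^ (δ - 1)) (Set.Ioc 0 b) := by
      have := (intervalIntegral.intervalIntegrable_rpow' (a := 0) (b := b) (r := δ - 1) (by linarith))
      rwa [intervalIntegrable_iff_integrableOn_Ioc_of_le hb0.le] at this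
    have hval : ∫ z in Set.Ioc 0 b, C * log t * z ^ (δ - 1) = C * log t * b ^ δ / δ := by
      rw [integral_const_mul, ← intervalIntegral.integral_of_le hb0.le, integral_rpow (Or.inl (by linarith))]
      simp [Real.zero_rpow h0.ne']
      ring
    have i2 : ∫ ε in Set.Ioc a b, GY t ε * ε ^ (δ - 2) ≤ C * log t * b ^ δ / δ := by
      rw [← hval]
      have j1 : ∫ ε in Set.Ioc a b, GY t ε * ε ^ (δ - 2) ≤ ∫ z in Set.Ioc a b, C * log t * z ^ (δ - 1) := by
        apply setIntegral_mono_on ((GY_int ht h1 ha).mono_set Set.Ioc_subset_Ioi_self)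
          ((hi.mono_set (Set.Ioc_subset_Ioc_left ha.le)).const_mul _) measurableSet_Ioc
        intro ε hε
        have hε0 : 0 < ε := lt_trans ha hε.1
        have := (hY 2 (Or.inr rfl) t ht ε hε0).1
        have h5 : GY t ε ≤ C * (ε * log t) := this
        rw [← hpow ε hε0]
        have := mul_le_mul_of_nonneg_right h5 (by positivity : 0 ≤ ε ^ (δ - 2))
        linarith
      refine j1.trans ?_
      apply setIntegral_mono_set (hi.const_mul _)
      · rw [Filter.EventuallyLE, ae_restrict_iff' measurableSet_Ioc]
        refine Filter.Eventually.of_forall fun z hz => ?_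
        have := hz.1
        simp only [Pi.zero_apply]; positivity
      · exact (Set.Ioc_subset_Ioc_left ha.le).eventuallyLE
    have e1 : b ^ (δ - 1) = (log t) ^ (1 - δ) := by
      rw [hb, one_div, Real.inv_rpow hl0.le, ← Real.rpow_neg hl0.le]; congr 1; ring
    have e2 : C * log t * b ^ δ / δ = C / δ * (log t) ^ (1 - δ) := by
      rw [← hlogt t ht]; ring
    rw [e1] at i1
    rw [e2] at i2
    rw [Real.mul_rpow ha.le hl0.le]
    have p1 : 0 < (log t) ^ (1 - δ) := by positivity
    have p2 : 0 < a ^ (1 - δ) := by positivity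
    have : (∫ ε in Set.Ioc a b, GY t ε * ε ^ (δ - 2)) + ∫ ε in Set.Ioi b, GY t ε * ε ^ (δ - 2) ≤ C' * (log t) ^ (1 - δ) := by
      have : 0 ≤ 9 / δ * (log t) ^ (1 - δ) := by positivity
      rw [hC']
      have e3 : (C / δ + 1 / (1 - δ) + 9 / δ) * (log t) ^ (1 - δ) = C / δ * (log t) ^ (1 - δ) +
        (log t) ^ (1 - δ) / (1 - δ) + 9 / δ * (log t) ^ (1 - δ) := by ring
      rw [e3]; linarith
    have := mul_le_mul_of_nonneg_left this p2.le
    linarith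
  · intro t ht a ha hab
    have ht2 : 2 ≤ t := ht0.trans ht
    have hl := log_t_ge ht2
    have hl0 : 0 < log t := by linarith
    set b := 1 / log t with hb
    have hb0 : 0 < b := by positivity
    have hlb : log t * b = 1 := by rw [hb]; field_simp
    have hab' : a ≤ b / 2 := by rw [hb, div_div, le_div_iff₀ (by positivity)]; linarith
    rw [key t ht2 a ha, hsplit t ht2 a b ha (by linarith)]
    have i1 := hQ0 t ht2 b hb0
    have hG : ∀ ε, 0 < ε → ε ≤ b → ε * log t / 4 ≤ GY t ε := by
      intro ε hε hεb
      apply (hY 2 (Or.inr rfl) t ht2 ε hε).2 ht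
      calc ε * log t ≤ b * log t := by gcongr
        _ = 1 := by linarith
    have hii := (GY_int ht2 (δ := δ) h1 ha).mono_set (Set.Ioc_subset_Ioi_self : Set.Ioc a b ⊆ Set.Ioi a)
    have i2 : 1 / 8 * (log t) ^ (1 - δ) ≤ ∫ ε in Set.Ioc a b, GY t ε * ε ^ (δ - 2) := by
      have j1 : ∫ ε in Set.Ioc (b/2) b, GY t ε * ε ^ (δ - 2) ≤ ∫ ε in Set.Ioc a b, GY t ε * ε ^ (δ - 2) := by
        apply setIntegral_mono_set hii
        · rw [Filter.EventuallyLE, ae_restrict_iff' measurableSet_Ioc]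
          refine Filter.Eventually.of_forall fun z hz => ?_
          have hz0 := lt_trans ha hz.1
          have := hG z hz0 hz.2
          have : 0 < z * log t / 4 := by positivity
          simp only [Pi.zero_apply]
          apply mul_nonneg (by linarith) (by positivity)
        · exact (Set.Ioc_subset_Ioc_left hab').eventuallyLE
      refine le_trans ?_ j1
      have j2 : ∫ ε in Set.Ioc (b/2) b, log t / 4 * b ^ (δ - 1) = 1 / 8 * (log t) ^ (1 - δ) := by
        rw [setIntegral_const, measureReal_def, Real.volume_Ioc, ENNReal.toReal_ofReal (by linarith), smul_eq_mul, ← hlogt t ht2,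
          ← hb, ← hpow' b hb0]
        ring
      rw [← j2]
      apply setIntegral_mono_on (integrableOn_const (by simp)) (hii.mono_set (Set.Ioc_subset_Ioc_left hab')) measurableSet_Ioc
      intro ε hε
      have hε0 : 0 < ε := by linarith [hε.1]
      have h5 := hG ε hε0 hε.2
      have h6 := mul_le_mul_of_nonneg_right h5 (by positivity : 0 ≤ ε ^ (δ - 2))
      have h7 : b ^ (δ - 1) ≤ ε ^ (δ - 1) := Real.rpow_le_rpow_of_nonpos hε0 hε.2 (by linarith)
      have h8 := mul_le_mul_of_nonneg_left h7 (by positivity : 0 ≤ log t / 4)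
      rw [← hpow ε hε0] at h8
      linarith
    rw [Real.mul_rpow ha.le hl0.le]
    have p1 : 0 < (log t) ^ (1 - δ) := by positivity
    have p2 : 0 < a ^ (1 - δ) := by positivity
    have j3 : 1 / 8 * (log t) ^ (1 - δ) ≤ (∫ ε in Set.Ioc a b, GY t ε * ε ^ (δ - 2)) + ∫ ε in Set.Ioi b, GY t ε * ε ^ (δ - 2) := by
      linarith
    have := mul_le_mul_of_nonneg_left j3 p2.le
    refine le_trans ?_ this
    have j4 := mul_le_mul_of_nonneg_right (min_le_left (1/8 : ℝ) (1 / 2 * (1 / (1 - δ)))) (mul_pos p2 p1).le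
    linarith

noncomputable def NN (k : ℕ) (t L : ℝ) : ℝ := ∑' n, nu k t n * (if L ≤ ell t n then 1 else 0)
noncomputable def Mom (k : ℕ) (t γ M : ℝ) : ℝ := ∑' n, nu k t n * (if ell t n ≤ M then ell t n ^ γ else 0)

lemma NN_summable {k : ℕ} (hk : k = 1 ∨ k = 2) {t : ℝ} (ht : 2 ≤ t) (L : ℝ) :
    Summable (fun n => nu k t n * (if L ≤ ell t n then 1 else 0)) := by
  apply nu_summable_mul hk ht (C := 1)
  intro n; split_ifs <;> simp

lemma NN_le_one {k : ℕ} (hk : k = 1 ∨ k = 2) {t : ℝ} (ht : 2 ≤ t) (L : ℝ) : NN k t L ≤ 1 := by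
  rw [← (nu_hasSum hk ht).tsum_eq]
  apply (NN_summable hk ht L).tsum_le_tsum _ (nu_hasSum hk ht).summable
  intro n
  apply mul_le_of_le_one_right (nu_nonneg _ _ _)
  split_ifs <;> norm_num

lemma NN_nonneg (k : ℕ) (t L : ℝ) : 0 ≤ NN k t L := by
  apply tsum_nonneg
  intro n
  apply mul_nonneg (nu_nonneg _ _ _)
  split_ifs <;> norm_num

lemma Mom_summable {k : ℕ} (hk : k = 1 ∨ k = 2) {t : ℝ} (ht : 2 ≤ t) {γ : ℝ} (hγ : 0 ≤ γ) (M : ℝ) :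
    Summable (fun n => nu k t n * (if ell t n ≤ M then ell t n ^ γ else 0)) := by
  apply nu_summable_mul hk ht (C := |M| ^ γ)
  intro n
  have h0 := ell_nonneg ht n
  split_ifs with h
  · rw [abs_of_nonneg (by positivity)]
    exact Real.rpow_le_rpow h0 (h.trans (le_abs_self M)) hγ
  · simp; positivity

lemma Mom_nonneg {k : ℕ} {t : ℝ} (ht : 2 ≤ t) (γ M : ℝ) : 0 ≤ Mom k t γ M := by
  apply tsum_nonneg
  intro n
  apply mul_nonneg (nu_nonneg _ _ _)
  have h0 := ell_nonneg ht n
  split_ifs <;> positivity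

lemma NN_bound {k : ℕ} (hk : k = 1 ∨ k = 2) {α β : ℝ} (hα : 0 < α) (h : Hdata k α β) :
    ∃ C, 0 < C ∧ ∀ t, 2 ≤ t → ∀ L, 0 < L → NN k t L ≤ C * (log t / L) ^ α := by
  obtain ⟨H, C, c, x2, b, t0, hC, hc, hx2, hb, ht0, hH, hHc, hup, -⟩ := h
  refine ⟨C * x2 ^ α / c + (b / x2)⁻¹ ^ α, by positivity, ?_⟩
  intro t ht L hL
  have hl : 0 < log t := by linarith [log_t_ge ht]
  have hr : 0 < log t / L := by positivity
  by_cases hab : x2 / L * log t ≤ b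
  · have h1 := hup t ht (x2 / L) (by positivity) hab
    have hs : Summable (fun n => nu k t n * H (x2 / L * ell t n)) := by
      apply nu_summable_mul hk ht (C := C)
      intro n
      have := hH (x2 / L * ell t n) (mul_nonneg (by positivity) (ell_nonneg ht n))
      rw [abs_of_nonneg this.1]; exact this.2.1
    have h2 : c * NN k t L ≤ ∑' n, nu k t n * H (x2 / L * ell t n) := by
      unfold NN
      rw [← tsum_mul_left]
      apply ((NN_summable hk ht L).mul_left c).tsum_le_tsum _ hs
      intro n
      have := hH (x2 / L * ell t n) (mul_nonneg (by positivity) (ell_nonneg ht n))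
      have hn := nu_nonneg k t n
      split_ifs with h3
      · have : c ≤ H (x2 / L * ell t n) := by
          apply hHc
          rw [div_mul_eq_mul_div, le_div_iff₀ hL]
          exact mul_le_mul_of_nonneg_left h3 hx2.le
        have := mul_le_mul_of_nonneg_left this hn
        linarith
      · rw [mul_zero, mul_zero]; exact mul_nonneg hn this.1
    have h3 : x2 / L * log t = x2 * (log t / L) := by ring
    rw [h3, Real.mul_rpow hx2.le hr.le] at h1
    have h4 : NN k t L ≤ C * x2 ^ α / c * (log t / L) ^ α := by
      rw [div_mul_eq_mul_div, le_div_iff₀ hc]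
      linarith
    have : 0 ≤ (b / x2)⁻¹ ^ α * (log t / L) ^ α := by positivity
    rw [add_mul]; linarith
  · have h1 := NN_le_one hk ht L
    have h2 : 1 ≤ (b / x2)⁻¹ ^ α * (log t / L) ^ α := by
      rw [← Real.mul_rpow (by positivity) hr.le]
      apply Real.one_le_rpow _ hα.le
      rw [inv_mul_eq_div, le_div_iff₀ (by positivity), one_mul, div_le_div_iff₀ hx2 hL]
      push Not at hab
      rw [div_mul_eq_mul_div, lt_div_iff₀ hL] at hab
      linarith
    have : 0 ≤ C * x2 ^ α / c * (log t / L) ^ α := by positivity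
    rw [add_mul]; linarith

lemma Mom_bound {k : ℕ} (hk : k = 1 ∨ k = 2) {α : ℝ} {C : ℝ} (hα : 0 < α) (hC : 0 < C)
    (hN : ∀ t, 2 ≤ t → ∀ L, 0 < L → NN k t L ≤ C * (log t / L) ^ α) {γ : ℝ} (hγ : α < γ) :
    ∃ K, 0 < K ∧ ∀ t, 2 ≤ t → ∀ M, 0 < M → Mom k t γ M ≤ K * (log t) ^ α * M ^ (γ - α) := by
  have hq : (2:ℝ)⁻¹ ^ (γ - α) < 1 := Real.rpow_lt_one (by norm_num) (by norm_num) (by linarith)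
  set q := (2:ℝ)⁻¹ ^ (γ - α) with hqd
  have hq1 : 0 < 1 - q := by linarith
  set K := C * 2 ^ α / (1 - q) with hK
  have hK0 : 0 < K := by positivity
  have hKq : K * q + C * 2 ^ α = K := by
    have : K * (1 - q) = C * 2 ^ α := by rw [hK]; field_simp
    linarith
  refine ⟨K, hK0, fun t ht => ?_⟩
  have hl : 0 < log t := by linarith [log_t_ge ht]
  have key : ∀ j : ℕ, ∀ M : ℝ, 0 < M → M < 2 ^ j / 2 → Mom k t γ M ≤ K * (log t) ^ α * M ^ (γ - α) := by
    intro j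
    induction j with
    | zero =>
      intro M hM hMj
      have : Mom k t γ M = 0 := by
        unfold Mom
        convert tsum_zero with n
        rcases Nat.eq_zero_or_pos n with rfl | hn
        · have : nu k t 0 = 0 := nu_zero_of_not (fun h => absurd h.1 (lt_irrefl 0))
          rw [this, zero_mul]
        · have h1 := ell_ge ht hn
          have h2 := log_t_ge ht
          rw [if_neg, mul_zero]
          push Not
          norm_num at hMj
          linarith
      rw [this]; positivity
    | succ j ih =>
      intro M hM hMj
      have h1 := ih (M / 2) (by positivity) (by rw [pow_succ] at hMj; linarith)
      have h2 := hN t ht (M / 2) (by positivity)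
      have h3 : Mom k t γ M ≤ Mom k t γ (M / 2) + M ^ γ * NN k t (M / 2) := by
        unfold Mom NN
        rw [← tsum_mul_left, ← (Mom_summable hk ht (by linarith) _).tsum_add ((NN_summable hk ht _).mul_left _)]
        apply (Mom_summable hk ht (by linarith) _).tsum_le_tsum _
          ((Mom_summable hk ht (by linarith) _).add ((NN_summable hk ht _).mul_left _))
        intro n
        have hn := nu_nonneg k t n
        have h0 := ell_nonneg ht n
        have : (if ell t n ≤ M then ell t n ^ γ else 0) ≤ (if ell t n ≤ M / 2 then ell t n ^ γ else 0) +
            M ^ γ * (if M / 2 ≤ ell t n then 1 else 0) := by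
          have p1 : 0 ≤ ell t n ^ γ := by positivity
          have p2 : 0 ≤ M ^ γ := by positivity
          by_cases a1 : ell t n ≤ M
          · by_cases a2 : ell t n ≤ M / 2
            · rw [if_pos a1, if_pos a2]
              split_ifs <;> linarith
            · push Not at a2
              rw [if_pos a1, if_neg (by linarith), if_pos a2.le]
              have := Real.rpow_le_rpow h0 a1 (by linarith : 0 ≤ γ)
              linarith
          · rw [if_neg a1]
            split_ifs <;> linarith
        have := mul_le_mul_of_nonneg_left this hn
        linarith
      have e1 : (M / 2) ^ (γ - α) = M ^ (γ - α) * q := by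
        rw [hqd, ← Real.mul_rpow hM.le (by norm_num)]; rfl
      have e2 : M ^ γ * (C * (log t / (M / 2)) ^ α) = C * 2 ^ α * (log t) ^ α * M ^ (γ - α) := by
        have : log t / (M / 2) = 2 * log t / M := by field_simp
        rw [this, Real.div_rpow (by positivity) hM.le, Real.mul_rpow (by norm_num) hl.le, Real.rpow_sub hM]
        ring
      have h4 := mul_le_mul_of_nonneg_left h2 (by positivity : 0 ≤ M ^ γ)
      rw [e2] at h4
      rw [e1] at h1
      calc Mom k t γ M ≤ K * log t ^ α * (M ^ (γ - α) * q) + C * 2 ^ α * log t ^ α * M ^ (γ - α) := by linarith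
        _ = (K * q + C * 2 ^ α) * (log t ^ α * M ^ (γ - α)) := by ring
        _ = _ := by rw [hKq]; ring
  intro M hM
  obtain ⟨j, hj⟩ := pow_unbounded_of_one_lt (2 * M) (by norm_num : (1:ℝ) < 2)
  exact key j M hM (by linarith)

lemma window {k : ℕ} (hk : k = 1 ∨ k = 2) {α β : ℝ} (hα : 0 < α) (hβ : α < β) (h : Hdata k α β) :
    ∃ A c t0, 1 ≤ A ∧ 0 < c ∧ 2 ≤ t0 ∧ ∀ t, t0 ≤ t → ∀ L, A * log t ≤ L →
      c * (log t / L) ^ α ≤ ∑' n, nu k t n * (if L / A ≤ ell t n ∧ ell t n ≤ A * L then 1 else 0) := by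
  obtain ⟨C1, hC1, hN⟩ := NN_bound hk hα h
  obtain ⟨K, hK, hM⟩ := Mom_bound hk hα hC1 hN hβ
  obtain ⟨H, C, c, x2, b, t0, hC, hc, hx2, hb, ht0, hH, hHc, -, hlo⟩ := h
  have l1 : Filter.Tendsto (fun A : ℝ => C * K * A ^ (-(β - α)) + C * C1 * A ^ (-α)) Filter.atTop (nhds 0) := by
    have a1 := (tendsto_rpow_neg_atTop (show 0 < β - α by linarith)).const_mul (C * K)
    have a2 := (tendsto_rpow_neg_atTop hα).const_mul (C * C1)
    simpa using a1.add a2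
  have l2 := l1.eventually (gt_mem_nhds (half_pos hc))
  obtain ⟨A, hA1, hAb, hA⟩ := ((Filter.eventually_ge_atTop (1:ℝ)).and ((Filter.eventually_ge_atTop (1/b)).and l2)).exists
  refine ⟨A, c / 2 / C, t0, hA1, by positivity, ht0, ?_⟩
  intro t ht L hL
  have ht2 : 2 ≤ t := ht0.trans ht
  have hl : 0 < log t := by linarith [log_t_ge ht2]
  have hA0 : 0 < A := by linarith
  have hL0 : 0 < L := lt_of_lt_of_le (by positivity) hL
  have hr : 0 < log t / L := by positivity
  have h1 := hlo t ht (1 / L) (by positivity) (by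
    rw [one_div_mul_eq_div, div_le_iff₀ hL0]
    rw [div_le_iff₀ hb] at hAb
    nlinarith)
  have e1 : 1 / L * log t = log t / L := by ring
  rw [e1] at h1
  have h2 := hM t ht2 (L / A) (by positivity)
  have h3 := hN t ht2 (A * L) (by positivity)
  have hs : Summable (fun n => nu k t n * H (1 / L * ell t n)) := by
    apply nu_summable_mul hk ht2 (C := C)
    intro n
    have := hH (1 / L * ell t n) (mul_nonneg (by positivity) (ell_nonneg ht2 n))
    rw [abs_of_nonneg this.1]; exact this.2.1
  have hsw : Summable (fun n => nu k t n * (if L / A ≤ ell t n ∧ ell t n ≤ A * L then (1:ℝ) else 0)) := by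
    apply nu_summable_mul hk ht2 (C := 1)
    intro n; split_ifs <;> simp
  have h4 : ∑' n, nu k t n * H (1 / L * ell t n) ≤
      C * (∑' n, nu k t n * (if L / A ≤ ell t n ∧ ell t n ≤ A * L then 1 else 0)) +
      C * L ^ (-β) * Mom k t β (L / A) + C * NN k t (A * L) := by
    unfold Mom NN
    have s1 := hsw.mul_left C
    have s2 := (Mom_summable hk ht2 (by linarith : 0 ≤ β) (L / A)).mul_left (C * L ^ (-β))
    have s3 := (NN_summable hk ht2 (A * L)).mul_left C
    rw [← tsum_mul_left, ← tsum_mul_left, ← tsum_mul_left, ← s1.tsum_add s2, ← (s1.add s2).tsum_add s3]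
    apply hs.tsum_le_tsum _ ((s1.add s2).add s3)
    intro n
    have hn := nu_nonneg k t n
    have h0 := ell_nonneg ht2 n
    obtain ⟨b1, b2, b3⟩ := hH (1 / L * ell t n) (mul_nonneg (by positivity) h0)
    have e2 : (1 / L * ell t n) ^ β = L ^ (-β) * ell t n ^ β := by
      rw [Real.mul_rpow (by positivity) h0, one_div, Real.inv_rpow hL0.le, Real.rpow_neg hL0.le]
    rw [e2] at b3
    have : H (1 / L * ell t n) ≤ C * (if L / A ≤ ell t n ∧ ell t n ≤ A * L then 1 else 0) +
       C * L ^ (-β) * (if ell t n ≤ L / A then ell t n ^ β else 0) + C * (if A * L ≤ ell t n then 1 else 0) := by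
      have p1 : 0 ≤ C * L ^ (-β) * (if ell t n ≤ L / A then ell t n ^ β else 0) := by
        split_ifs <;> positivity
      have p2 : 0 ≤ C * (if A * L ≤ ell t n then (1:ℝ) else 0) := by split_ifs <;> positivity
      have p3 : 0 ≤ C * (if L / A ≤ ell t n ∧ ell t n ≤ A * L then (1:ℝ) else 0) := by split_ifs <;> positivity
      by_cases a1 : ell t n ≤ L / A
      · rw [if_pos a1] at p1 ⊢
        linarith
      · by_cases a2 : A * L ≤ ell t n
        · rw [if_pos a2] at p2 ⊢; linarith
        · push Not at a1 a2
          rw [if_pos ⟨a1.le, a2.le⟩] at p3 ⊢; linarith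
    have := mul_le_mul_of_nonneg_left this hn
    linarith
  have e3 : C * L ^ (-β) * (K * (log t) ^ α * (L / A) ^ (β - α)) = C * K * A ^ (-(β - α)) * (log t / L) ^ α := by
    rw [Real.div_rpow hL0.le hA0.le, Real.div_rpow hl.le hL0.le, Real.rpow_neg hA0.le, Real.rpow_neg hL0.le, Real.rpow_sub hL0]
    field_simp
  have e4 : C * (C1 * (log t / (A * L)) ^ α) = C * C1 * A ^ (-α) * (log t / L) ^ α := by
    rw [Real.div_rpow hl.le (by positivity), Real.mul_rpow hA0.le hL0.le, Real.div_rpow hl.le hL0.le, Real.rpow_neg hA0.le]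
    field_simp
  have h5 := mul_le_mul_of_nonneg_left h2 (by positivity : 0 ≤ C * L ^ (-β))
  have h6 := mul_le_mul_of_nonneg_left h3 hC.le
  rw [e3] at h5
  rw [e4] at h6
  have h7 := mul_le_mul_of_nonneg_right hA.le (by positivity : 0 ≤ (log t / L) ^ α)
  rw [add_mul] at h7
  rw [div_mul_eq_mul_div, div_le_iff₀ hC]
  linarith

lemma fw_log {k : ℕ} (hk : k = 1 ∨ k = 2) (c : ℕ) :
    fw k c * log c = k * ∑ m ∈ c.divisors, ArithmeticFunction.vonMangoldt (c / m) * fw k m := by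
  rcases hk with rfl | rfl
  · simp only [fw, le_refl, tsub_eq_zero_of_le, pow_zero, one_mul, mul_one, Nat.cast_one]
    rw [Nat.sum_div_divisors c (fun d => ArithmeticFunction.vonMangoldt d), ArithmeticFunction.vonMangoldt_sum]
  · simp only [fw, Nat.add_one_sub_one, pow_one, Nat.cast_ofNat]
    have h1 : ∑ m ∈ c.divisors, ArithmeticFunction.vonMangoldt (c / m) * (m.divisors.card : ℝ) =
        ∑ d ∈ c.divisors, log d := by
      have h2 : (ArithmeticFunction.vonMangoldt * (ArithmeticFunction.zeta : ArithmeticFunction ℝ)) * (ArithmeticFunction.zeta : ArithmeticFunction ℝ) =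
        ArithmeticFunction.vonMangoldt * ((ArithmeticFunction.zeta : ArithmeticFunction ℝ) * (ArithmeticFunction.zeta : ArithmeticFunction ℝ)) := mul_assoc _ _ _
      rw [ArithmeticFunction.vonMangoldt_mul_zeta] at h2
      have h3 := congrArg (fun f => f c) h2
      rw [ArithmeticFunction.coe_mul_zeta_apply, ArithmeticFunction.mul_apply] at h3
      simp only [ArithmeticFunction.log_apply] at h3
      rw [h3, Nat.sum_divisorsAntidiagonal' (fun a b => ArithmeticFunction.vonMangoldt a * ((ArithmeticFunction.zeta : ArithmeticFunction ℝ) * (ArithmeticFunction.zeta : ArithmeticFunction ℝ)) b)]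
      apply Finset.sum_congr rfl
      intro m hm
      congr 1
      rw [ArithmeticFunction.coe_mul_zeta_apply]
      have : ∀ i ∈ m.divisors, (ArithmeticFunction.zeta : ArithmeticFunction ℝ) i = 1 := by
        intro i hi
        have := Nat.pos_of_mem_divisors hi
        simp [ArithmeticFunction.zeta_apply, this.ne']
      rw [Finset.sum_congr rfl this]; simp
    rw [h1]
    have h4 : ∑ d ∈ c.divisors, log ((c / d : ℕ):ℝ) = ∑ d ∈ c.divisors, log d := Nat.sum_div_divisors c (fun d => log d)
    have h5 : ∑ d ∈ c.divisors, (log ((c / d : ℕ):ℝ) + log d) = ∑ d ∈ c.divisors, log c := by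
      apply Finset.sum_congr rfl
      intro d hd
      have hdc := Nat.dvd_of_mem_divisors hd
      have h0 := Nat.pos_of_mem_divisors hd
      have hc0 : c ≠ 0 := Nat.ne_zero_of_mem_divisors hd
      have : 0 < c / d := Nat.div_pos (Nat.le_of_dvd (Nat.pos_of_ne_zero hc0) hdc) h0
      rw [← Real.log_mul (by positivity) (by positivity), ← Nat.cast_mul, Nat.div_mul_cancel hdc]
    rw [Finset.sum_add_distrib, h4, Finset.sum_const, nsmul_eq_mul] at h5
    linarith

open Classical in
noncomputable def RS (w X : ℝ) : Finset ℕ :=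
  (Finset.Icc 1 ⌊X⌋₊).filter (fun c => ∀ p : ℕ, p.Prime → p ∣ c → w < p)

open Classical in
lemma mem_RS {w X : ℝ} (hX : 0 ≤ X) {c : ℕ} : c ∈ RS w X ↔ (1 ≤ c ∧ (c:ℝ) ≤ X) ∧ ∀ p : ℕ, p.Prime → p ∣ c → w < p := by
  unfold RS
  rw [Finset.mem_filter, Finset.mem_Icc, Nat.le_floor_iff hX]

lemma rough_prod {k : ℕ} (hk : k = 1 ∨ k = 2) {w X : ℝ} (hw : 1 ≤ w) (hX : w ≤ X) :
    ∑ c ∈ RS w X, fw k c / c ≤ (PP w 1 / PP X 1) ^ k := by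
  classical
  have hX0 : 0 ≤ X := by linarith
  set s := (Nat.primesLE ⌊X⌋₊).filter (fun p : ℕ => w < p) with hs
  have hprime : ∀ p ∈ s, p.Prime := fun p hp => (Nat.mem_primesLE.mp (Finset.mem_filter.mp hp).1).2
  have hz : ∀ {p : ℕ}, p.Prime → 0 ≤ (p:ℝ)⁻¹ ∧ (p:ℝ)⁻¹ < 1 := by
    intro p hp
    have : (1:ℝ) < p := by exact_mod_cast hp.one_lt
    exact ⟨by positivity, inv_lt_one_of_one_lt₀ this⟩
  have hpw : ∀ {p : ℕ}, p.Prime → HasSum (fun n : ℕ => fw k (p ^ n) / ((p ^ n : ℕ) : ℝ)) (((1 - (p:ℝ)⁻¹) ^ k)⁻¹) := by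
    intro p hp
    have := hasSum_fw hk hp (hz hp).1 (hz hp).2
    refine this.congr_fun ?_ 
    intro n
    push_cast
    rw [inv_pow]; rfl
  have h := EulerProduct.summable_and_hasSum_factoredNumbers_prod_filter_prime_tsum
    (f := fun n : ℕ => fw k n / n) (by simp [fw_one]) (by
      intro m n hmn
      rw [fw_mul hmn]; push_cast; rw [mul_div_mul_comm]) (by
      intro p hp
      exact (hpw hp).summable.norm) s
  have h2 := h.2
  have e1 : ∏ p ∈ s with p.Prime, ∑' n : ℕ, (fun n : ℕ => fw k n / n) (p ^ n) = (PP w 1 / PP X 1) ^ k := by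
    rw [Finset.filter_true_of_mem hprime]
    have : ∀ p ∈ s, ∑' n : ℕ, (fun n : ℕ => fw k n / (n:ℝ)) (p ^ n) = ((1 - (p:ℝ)⁻¹)⁻¹) ^ k := by
      intro p hp
      rw [inv_pow]
      exact (hpw (hprime p hp)).tsum_eq
    rw [Finset.prod_congr rfl this, Finset.prod_pow]
    congr 1
    rw [Finset.prod_inv_distrib]
    have e2 : PP X 1 = PP w 1 * ∏ p ∈ s, (1 - (p:ℝ)⁻¹) := by
      unfold PP
      simp only [Real.rpow_neg_one]
      rw [← Finset.prod_filter_mul_prod_filter_not (Nat.primesLE ⌊X⌋₊) (fun p : ℕ => w < p), mul_comm]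
      congr 1
      apply Finset.prod_congr _ (fun _ _ => rfl)
      ext p
      simp only [Finset.mem_filter, Nat.mem_primesLE, not_lt, Nat.le_floor_iff hX0, Nat.le_floor_iff (show 0 ≤ w by linarith)]
      constructor
      · rintro ⟨⟨_, b⟩, c⟩; exact ⟨c, b⟩
      · rintro ⟨a, b⟩; exact ⟨⟨a.trans hX, b⟩, a⟩
    have p1 := PP_pos (y := X) one_pos
    have p2 := PP_pos (y := w) one_pos
    rw [e2] at p1 ⊢
    have p3 : ∏ p ∈ s, (1 - (p:ℝ)⁻¹) ≠ 0 := fun h => by rw [h, mul_zero] at p1; exact lt_irrefl _ p1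
    field_simp
  rw [e1] at h2
  rw [← h2.tsum_eq]
  have h3 := h2.summable
  have hmem : ∀ c ∈ RS w X, c ∈ Nat.factoredNumbers s := by
    intro c hc
    rw [mem_RS hX0] at hc
    rw [Nat.mem_factoredNumbers']
    intro p hp hpc
    rw [hs, Finset.mem_filter, Nat.mem_primesLE, Nat.le_floor_iff hX0]
    refine ⟨⟨?_, hp⟩, hc.2 p hp hpc⟩
    refine le_trans ?_ hc.1.2
    exact_mod_cast Nat.le_of_dvd (by omega) hpc
  have h4 : ∑ c ∈ RS w X, fw k c / c = ∑ c ∈ (RS w X).subtype (· ∈ Nat.factoredNumbers s), fw k c / ((c:ℕ):ℝ) := by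
    rw [Finset.sum_subtype_of_mem (fun c : ℕ => fw k c / (c:ℝ)) hmem]
  rw [h4]
  exact h3.sum_le_tsum _ (fun c _ => div_nonneg (fw_nonneg _ _) (by positivity))

lemma PP_upper : ∃ C : ℝ, 0 < C ∧ ∀ y : ℝ, 1 ≤ y → PP y 1 ≤ C / log (2 * y) := by
  obtain ⟨c, C, hc, hC, h⟩ := PP_one_bounds
  refine ⟨2 * C + log 4, by positivity, fun y hy => ?_⟩
  have hl : 0 < log (2 * y) := Real.log_pos (by linarith)
  have h4 : 0 < log 4 := Real.log_pos (by norm_num)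
  rw [le_div_iff₀ hl]
  have p := PP_pos (y := y) one_pos
  by_cases hy2 : 2 ≤ y
  · have h1 := (h y hy2).2
    have h2 : log (2 * y) ≤ 2 * log y := by
      rw [Real.log_mul (by norm_num) (by positivity)]
      have := Real.log_le_log (by norm_num) hy2
      linarith
    have := mul_le_mul_of_nonneg_left h2 p.le
    linarith
  · have h1 := PP_le_one (y := y) one_pos
    push Not at hy2
    have h2 : log (2 * y) ≤ log 4 := Real.log_le_log (by positivity) (by linarith)
    have := mul_le_mul h1 h2 hl.le zero_le_one
    linarith

lemma rough_recip {k : ℕ} (hk : k = 1 ∨ k = 2) : ∃ C : ℝ, 0 < C ∧ ∀ w X : ℝ, 1 ≤ w → 2 ≤ X → w ≤ X →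
    ∑ c ∈ RS w X, fw k c / c ≤ C * (log X / log (2 * w)) ^ k := by
  obtain ⟨c, C0, hc, _, h⟩ := PP_one_bounds
  obtain ⟨C, hC, h'⟩ := PP_upper
  refine ⟨(C / c) ^ k, by positivity, fun w X hw hX hwX => ?_⟩
  refine (rough_prod hk hw hwX).trans ?_
  rw [← mul_pow]
  have p1 := PP_pos (y := X) one_pos
  have p2 := PP_pos (y := w) one_pos
  apply pow_le_pow_left₀ (by positivity)
  have hl : 0 < log X := Real.log_pos (by linarith)
  have hl2 : 0 < log (2 * w) := Real.log_pos (by linarith)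
  have h1 := (h X hX).1
  have h2 := h' w hw
  calc PP w 1 / PP X 1 ≤ (C / log (2 * w)) / (c / log X) := by
        apply div_le_div₀ (by positivity) h2 (by positivity)
        rw [div_le_iff₀ hl]; exact h1
    _ = _ := by field_simp

lemma rough_sum {k : ℕ} (hk : k = 1 ∨ k = 2) : ∃ C : ℝ, 0 < C ∧ ∀ w X : ℝ, 1 ≤ w → 2 ≤ X → w ≤ X →
    ∑ c ∈ RS w X, fw k c ≤ C * X * (log X) ^ (k - 1) / (log (2 * w)) ^ k := by
  classical
  obtain ⟨C, hC, hr⟩ := rough_recip hk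
  have h40 : 0 < log 4 := Real.log_pos (by norm_num)
  refine ⟨(1 + k * (log 4 + 4)) * C, by positivity, fun w X hw hX hwX => ?_⟩
  have hX0 : 0 ≤ X := by linarith
  have hl : 0 < log X := Real.log_pos (by linarith)
  have hl2 : 0 < log (2 * w) := Real.log_pos (by linarith)
  have h1 := hr w X hw hX hwX
  set R := ∑ c ∈ RS w X, fw k c / c with hR
  have hA : ∑ c ∈ RS w X, fw k c * log c ≤ k * (log 4 + 4) * X * R := by
    have e1 : ∑ c ∈ RS w X, fw k c * log c =
        k * ∑ m ∈ RS w X, ∑ c ∈ (RS w X).filter (m ∣ ·), ArithmeticFunction.vonMangoldt (c / m) * fw k m := by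
      rw [Finset.sum_congr rfl (fun c _ => fw_log hk c), ← Finset.mul_sum]
      congr 1
      apply Finset.sum_comm'
      intro c m
      rw [Finset.mem_filter, Nat.mem_divisors]
      constructor
      · rintro ⟨a, b, b'⟩
        refine ⟨⟨a, b⟩, ?_⟩
        rw [mem_RS hX0] at a ⊢
        have hm : m ≤ c := Nat.le_of_dvd (by omega) b
        refine ⟨⟨Nat.pos_of_dvd_of_pos b (by omega), le_trans (by exact_mod_cast hm) a.1.2⟩, fun p hp hpm => a.2 p hp (hpm.trans b)⟩
      · rintro ⟨⟨a, b⟩, -⟩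
        refine ⟨a, b, ?_⟩
        rw [mem_RS hX0] at a; omega
    rw [e1, hR, mul_assoc, mul_assoc]
    apply mul_le_mul_of_nonneg_left _ (by positivity)
    rw [← mul_assoc, Finset.mul_sum]
    apply Finset.sum_le_sum
    intro m hm
    rw [mem_RS hX0] at hm
    have hm0 : 0 < m := by omega
    have hmr : (0:ℝ) < m := by exact_mod_cast hm0
    rw [← Finset.sum_mul]
    have h2 : ∑ c ∈ (RS w X).filter (m ∣ ·), ArithmeticFunction.vonMangoldt (c / m) ≤ (log 4 + 4) * (X / m) := by
      refine le_trans ?_ (Chebyshev.psi_le_const_mul_self (by positivity : 0 ≤ X / m))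
      unfold Chebyshev.psi
      rw [← Finset.sum_image (s := (RS w X).filter (m ∣ ·)) (g := fun c => c / m) (f := fun g => ArithmeticFunction.vonMangoldt g)]
      · apply Finset.sum_le_sum_of_subset_of_nonneg
        · intro g hg
          rw [Finset.mem_image] at hg
          obtain ⟨c, hc, rfl⟩ := hg
          rw [Finset.mem_filter, mem_RS hX0] at hc
          obtain ⟨⟨⟨c1, c2⟩, -⟩, d, rfl⟩ := hc
          rw [Nat.mul_div_cancel_left d hm0, Finset.mem_Ioc, Nat.le_floor_iff (by positivity), le_div_iff₀ hmr]
          push_cast at c2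
          refine ⟨Nat.pos_of_ne_zero (by rintro rfl; simp at c1), by linarith⟩
        · intro i _ _
          exact ArithmeticFunction.vonMangoldt_nonneg
      · intro a ha b hb hab
        rw [Finset.mem_coe, Finset.mem_filter] at ha hb
        exact (Nat.div_left_inj ha.2 hb.2).mp hab
    calc _ ≤ (log 4 + 4) * (X / m) * fw k m := mul_le_mul_of_nonneg_right h2 (fw_nonneg _ _)
      _ = _ := by ring
  have hB : ∑ c ∈ RS w X, fw k c * (log X - log c) ≤ X * R := by
    rw [hR, Finset.mul_sum]
    apply Finset.sum_le_sum
    intro c hc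
    rw [mem_RS hX0] at hc
    have hc0 : (0:ℝ) < c := by exact_mod_cast (by omega : 0 < c)
    rw [← Real.log_div (by positivity) hc0.ne']
    have := Real.log_le_self (by positivity : 0 ≤ X / c)
    calc _ ≤ fw k c * (X / c) := mul_le_mul_of_nonneg_left this (fw_nonneg _ _)
      _ = _ := by ring
  have hS : (∑ c ∈ RS w X, fw k c) * log X ≤ (1 + k * (log 4 + 4)) * X * R := by
    have : (∑ c ∈ RS w X, fw k c) * log X = ∑ c ∈ RS w X, fw k c * (log X - log c) + ∑ c ∈ RS w X, fw k c * log c := by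
      rw [← Finset.sum_add_distrib, Finset.sum_mul]
      apply Finset.sum_congr rfl; intro c _; ring
    rw [this]; linarith
  have h3 : (∑ c ∈ RS w X, fw k c) * log X ≤ (1 + k * (log 4 + 4)) * X * (C * (log X / log (2 * w)) ^ k) :=
    hS.trans (mul_le_mul_of_nonneg_left h1 (by positivity))
  rw [← le_div_iff₀ hl] at h3
  refine h3.trans (le_of_eq ?_)
  have : (log X) ^ k = (log X) ^ (k - 1) * log X := by
    rw [← pow_succ]; congr 1; omega
  rw [div_pow, this]
  field_simp

lemma EE_neg {u : ℝ} (h0 : 0 ≤ u) (h1 : u ≤ 1) : -(u + u ^ 2) ≤ EE (-u) := by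
  have h := (EE_slope (by linarith : -u ≤ 0)).2
  rw [EE_zero] at h
  have h2 := mul_e1 (-u)
  rw [neg_neg] at h2
  have h3 := Real.abs_exp_sub_one_sub_id_le (by rw [abs_of_nonneg h0]; exact h1)
  have := (abs_le.mp h3).2
  nlinarith

lemma gid_lower : ∃ C : ℝ, 0 ≤ C ∧ ∀ k : ℕ, k = 1 ∨ k = 2 → ∀ t : ℝ, 2 ≤ t → ∀ N : ℕ, 55 ≤ N →
    ∀ m : ℕ, t * m < N → 
    nu k t m * (1 - (((k:ℝ) - 1) * (1 / log N * ell t m) + (1 / log N * log t) +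
      C * (1 / log N) + 2 * (1 / log N * ell t m) ^ 2)) ≤ gid k t (1 - 1 / log N) N m := by
  obtain ⟨C, hC, hP⟩ := PP_expand
  refine ⟨2 * C, by positivity, fun k hk t ht N hN m hm => ?_⟩
  have hN4 : 4 ≤ log N := by
    rw [Real.le_log_iff_exp_le (by positivity)]
    have : exp 4 ≤ 55 := by
      have h := Real.exp_one_lt_d9
      have : exp 4 = exp 1 ^ 4 := by rw [← Real.exp_nat_mul]; norm_num
      rw [this]
      calc exp 1 ^ 4 ≤ 2.7182818286 ^ 4 := by gcongr
        _ ≤ 55 := by norm_num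
    exact this.trans (by exact_mod_cast hN)
  set η := 1 / log N with hη
  have hη0 : 0 < η := by positivity
  have hη4 : η ≤ 1 / 4 := by rw [hη]; apply one_div_le_one_div_of_le <;> linarith
  have hηN : η * log N = 1 := by rw [hη]; field_simp
  by_cases hd : IsDense m t
  swap
  · rw [nu_zero_of_not hd, zero_mul]; exact gid_nonneg (by linarith) _ _
  have hm0 : 0 < m := hd.1
  have hmr : (1:ℝ) ≤ m := by exact_mod_cast hm0
  have htm : 2 ≤ t * m := by nlinarith
  set l := ell t m with hl
  have hll : l = log (t * m) := rfl
  have hl0 : 0 ≤ l := Real.log_nonneg (by linarith)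
  have hlN : l ≤ log N := Real.log_le_log (by linarith) hm.le
  have hu0 : 0 ≤ η * l := by positivity
  have hu1 : η * l ≤ 1 := by rw [← hηN]; gcongr
  have h1 := hP (t * m) (-η) (by linarith) (by linarith) (by rw [← hll]; linarith)
  rw [← hll, abs_neg, abs_of_pos hη0] at h1
  have h2 := (abs_le.mp h1).1
  have h3 := EE_neg hu0 hu1
  rw [← neg_mul] at h3
  have p1 := PP_pos (y := t * m) one_pos
  have hs0 : (0:ℝ) < 1 - η := by linarith
  have p2 := PP_pos (y := t * m) hs0
  have h4 : PP (t * m) 1 * exp (-(η * l + (η * l) ^ 2) - C * η) ≤ PP (t * m) (1 - η) := by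
    rw [← Real.log_le_log_iff (by positivity) p2, Real.log_mul p1.ne' (by positivity), Real.log_exp]
    rw [← sub_eq_add_neg] at h2
    linarith
  have h5 : gid k t (1 - η) N m = fw k m * (m:ℝ) ^ (-(1 - η)) * PP (t * m) (1 - η) ^ k := by
    unfold gid
    rw [if_pos, min_eq_left hm.le]
    refine ⟨hd, ?_⟩
    rw [Nat.mem_smoothNumbers']
    intro p hp hpm
    have a1 := Nat.le_of_dvd hm0 hpm
    have a2 : (m:ℝ) < N := by nlinarith
    have a3 : m < N := by exact_mod_cast a2
    omega
  have h6 : (m:ℝ) ^ (-(1 - η)) = (m:ℝ)⁻¹ * exp (η * l - η * log t) := by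
    rw [neg_sub, Real.rpow_sub (by positivity), Real.rpow_one, Real.rpow_def_of_pos (by positivity), hll,
      Real.log_mul (by positivity) (by positivity), div_eq_inv_mul]
    congr 2; ring
  rw [h5, h6, nu_dense hd]
  have h7 := pow_le_pow_left₀ (by positivity) h4 k
  rw [mul_pow, ← Real.exp_nat_mul] at h7
  have hk2 : (k:ℝ) ≤ 2 := by rcases hk with rfl | rfl <;> norm_num
  have h8 : 1 - (((k:ℝ) - 1) * (η * l) + η * log t + 2 * C * η + 2 * (η * l) ^ 2) ≤
      exp (η * l - η * log t) * exp (k * (-(η * l + (η * l) ^ 2) - C * η)) := by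
    rw [← Real.exp_add]
    refine le_trans ?_ (Real.add_one_le_exp _)
    have a1 := mul_le_mul_of_nonneg_right hk2 (by positivity : 0 ≤ (η * l) ^ 2)
    have a2 := mul_le_mul_of_nonneg_right hk2 (by positivity : 0 ≤ C * η)
    linarith
  have hf := fw_nonneg k m
  have q0 : 0 ≤ fw k m / m * PP (t * m) 1 ^ k := by positivity
  calc fw k m / m * PP (t * m) 1 ^ k * (1 - (((k:ℝ) - 1) * (η * l) + η * log t + 2 * C * η + 2 * (η * l) ^ 2))
      ≤ fw k m / m * PP (t * m) 1 ^ k * (exp (η * l - η * log t) * exp (k * (-(η * l + (η * l) ^ 2) - C * η))) :=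
        mul_le_mul_of_nonneg_left h8 q0
    _ = fw k m * ((m:ℝ)⁻¹ * exp (η * l - η * log t)) * (PP (t * m) 1 ^ k * exp (k * (-(η * l + (η * l) ^ 2) - C * η))) := by ring
    _ ≤ _ := mul_le_mul_of_nonneg_left h7 (by positivity)

lemma log_N_ge {N : ℕ} (hN : 55 ≤ N) : 4 ≤ log N := by
  rw [Real.le_log_iff_exp_le (by positivity)]
  have : exp 4 ≤ 55 := by
    have h := Real.exp_one_lt_d9
    have : exp 4 = exp 1 ^ 4 := by rw [← Real.exp_nat_mul]; norm_num
    rw [this]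
    calc exp 1 ^ 4 ≤ 2.7182818286 ^ 4 := by gcongr
      _ ≤ 55 := by norm_num
  exact this.trans (by exact_mod_cast hN)

lemma PP_rankin_lower : ∃ c : ℝ, 0 < c ∧ ∀ N : ℕ, 55 ≤ N → c / log N ≤ PP N (1 - 1 / log N) := by
  obtain ⟨C, hC, hP⟩ := PP_expand
  obtain ⟨c, C0, hc, _, h⟩ := PP_one_bounds
  refine ⟨c * exp (-2 - C), by positivity, fun N hN => ?_⟩
  have hN4 := log_N_ge hN
  have hNr : (55:ℝ) ≤ N := by exact_mod_cast hN
  set η := 1 / log N with hη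
  have hη0 : 0 < η := by positivity
  have hη4 : η ≤ 1 / 4 := by rw [hη]; apply one_div_le_one_div_of_le <;> linarith
  have hηN : η * log N = 1 := by rw [hη]; field_simp
  have h1 := hP N (-η) (by linarith) (by linarith) (by linarith)
  rw [abs_neg, abs_of_pos hη0, neg_mul, hηN] at h1
  have h2 := (abs_le.mp h1).1
  have h3 := EE_neg zero_le_one le_rfl
  norm_num at h3
  have p1 := PP_pos (y := N) one_pos
  have hs0 : (0:ℝ) < 1 - η := by linarith
  have p2 := PP_pos (y := N) hs0
  rw [← sub_eq_add_neg] at h2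
  have h4 : PP N 1 * exp (-2 - C) ≤ PP N (1 - η) := by
    rw [← Real.log_le_log_iff (by positivity) p2, Real.log_mul p1.ne' (by positivity), Real.log_exp]
    nlinarith
  refine le_trans ?_ h4
  rw [mul_div_right_comm]
  apply mul_le_mul_of_nonneg_right _ (by positivity)
  rw [div_le_iff₀ (by linarith)]
  exact (h N (by linarith)).1

lemma rankin {k : ℕ} (hk : k = 1 ∨ k = 2) {α C0 : ℝ} (hα : 0 < α) (hα1 : α ≤ 1) (hk2 : k = 2 → α < 1) (hC0 : 0 < C0)
    (hN0 : ∀ t, 2 ≤ t → ∀ L, 0 < L → NN k t L ≤ C0 * (log t / L) ^ α) :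
    ∃ C, 0 < C ∧ ∀ t, 2 ≤ t → ∀ N : ℕ, 55 ≤ N → ∀ S : Finset ℕ,
      (∀ m ∈ S, IsDense m t ∧ m ∈ Nat.smoothNumbers (N + 1) ∧ (N:ℝ) ≤ t * m) →
      ∑ m ∈ S, fw k m * (m:ℝ) ^ (-(1 - 1 / log N)) ≤ C * (log N) ^ (k - α) * (log t) ^ α := by
  classical
  obtain ⟨c, hc, hPl⟩ := PP_rankin_lower
  obtain ⟨C1, hC1, hgl⟩ := gid_lower
  have hM1 : ∃ K1, 0 ≤ K1 ∧ ∀ t, 2 ≤ t → ∀ M, 0 < M → ((k:ℝ) - 1) * Mom k t 1 M ≤ K1 * (log t) ^ α * M ^ (1 - α) := by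
    rcases hk with rfl | rfl
    · refine ⟨0, le_rfl, fun t ht M hM => by simp⟩
    · obtain ⟨K, hK, h⟩ := Mom_bound (Or.inr rfl) hα hC0 hN0 (hk2 rfl)
      refine ⟨K, hK.le, fun t ht M hM => ?_⟩
      have := h t ht M hM
      norm_num
      linarith
  obtain ⟨K1, hK1, hM1⟩ := hM1
  obtain ⟨K2, hK2, hM2⟩ := Mom_bound hk hα hC0 hN0 (by linarith : α < 2)
  set B := C0 + K1 + 1 + 2 * C1 + 2 * K2 with hB
  have hB0 : 0 < B := by positivity
  have hB1 : 1 ≤ B := by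
    have := hC0; have := hK2; linarith
  have hk0 : (1:ℝ) ≤ k := by rcases hk with rfl | rfl <;> norm_num
  refine ⟨B / c ^ k, by positivity, fun t ht N hN S hS => ?_⟩
  have hN4 := log_N_ge hN
  have hNr : (55:ℝ) ≤ N := by exact_mod_cast hN
  have hP := hPl N hN
  have hg := hgl k hk t ht N hN
  have hlt := log_t_ge ht
  have hlt0 : 0 < log t := by linarith
  have hlN0 : 0 < log N := by linarith
  set η := 1 / log N with hη
  have hη0 : 0 < η := by positivity
  have hη4 : η ≤ 1 / 4 := by rw [hη]; apply one_div_le_one_div_of_le <;> linarith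
  have hηN : η * log N = 1 := by rw [hη]; field_simp
  have hs0 : (0:ℝ) < 1 - η := by linarith
  have hid := identity_hasSum hk (t := t) (by linarith) hs0 N
  have hgn := fun m => gid_nonneg (k := k) (t := t) hs0 N m
  have p2 := PP_pos (y := N) hs0
  -- main claim
  have hmain : ∑ m ∈ S, gid k t (1 - η) N m ≤ B * (log t / log N) ^ α := by
    by_cases htN : t ≤ N
    · set F := (Finset.range N).filter (fun m : ℕ => t * m < N) with hF
      have hdis : Disjoint S F := by
        rw [Finset.disjoint_left]
        intro m hm hm'
        have := (hS m hm).2.2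
        have := (Finset.mem_filter.mp hm').2
        linarith
      have h1 : ∑ m ∈ S, gid k t (1 - η) N m + ∑ m ∈ F, gid k t (1 - η) N m ≤ 1 := by
        rw [← Finset.sum_union hdis]
        exact sum_le_hasSum _ (fun m _ => hgn m) hid
      have h2 : ∑ m ∈ F, nu k t m * (1 - (((k:ℝ) - 1) * (η * ell t m) + (η * log t) +
          C1 * η + 2 * (η * ell t m) ^ 2)) ≤ ∑ m ∈ F, gid k t (1 - η) N m := by
        apply Finset.sum_le_sum
        intro m hm
        exact hg m (Finset.mem_filter.mp hm).2
      have h3 : 1 - NN k t (log N) ≤ ∑ m ∈ F, nu k t m := by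
        have hs1 := (nu_hasSum hk ht).sub (NN_summable hk ht (log N)).hasSum
        have e1 : 1 - NN k t (log N) = ∑' n, (nu k t n - nu k t n * (if log N ≤ ell t n then 1 else 0)) := hs1.tsum_eq.symm
        rw [e1, tsum_eq_sum (s := F)]
        · apply Finset.sum_le_sum
          intro m _
          have : 0 ≤ nu k t m * (if log N ≤ ell t m then 1 else 0) :=
            mul_nonneg (nu_nonneg _ _ _) (by split_ifs <;> norm_num)
          linarith
        · intro m hm
          rw [if_pos, mul_one, sub_self]
          apply Real.log_le_log (by linarith)
          by_contra hlt'
          push Not at hlt'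
          apply hm
          rw [hF, Finset.mem_filter, Finset.mem_range]
          refine ⟨?_, hlt'⟩
          have : (m:ℝ) < N := by
            have : (0:ℝ) ≤ m := by positivity
            nlinarith
          exact_mod_cast this
      have hFl : ∀ m ∈ F, ell t m ≤ log N := by
        intro m hm
        rcases Nat.eq_zero_or_pos m with rfl | hm0
        · simp [ell]; linarith
        · have : (0:ℝ) < m := by exact_mod_cast hm0
          exact Real.log_le_log (by positivity) (Finset.mem_filter.mp hm).2.le
      have hmom : ∀ γ : ℝ, 0 ≤ γ → ∑ m ∈ F, nu k t m * ell t m ^ γ ≤ Mom k t γ (log N) := by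
        intro γ hγ
        have e1 : ∑ m ∈ F, nu k t m * ell t m ^ γ = ∑ m ∈ F, nu k t m * (if ell t m ≤ log N then ell t m ^ γ else 0) := by
          apply Finset.sum_congr rfl
          intro m hm; rw [if_pos (hFl m hm)]
        rw [e1]
        apply (Mom_summable hk ht hγ _).sum_le_tsum
        intro m _
        have h0 := ell_nonneg ht m
        apply mul_nonneg (nu_nonneg _ _ _)
        split_ifs <;> positivity
      have hm1 := hmom 1 zero_le_one
      have hm2 := hmom 2 (by norm_num)
      simp only [Real.rpow_one, Real.rpow_two] at hm1 hm2
      have hm0 : ∑ m ∈ F, nu k t m ≤ 1 := by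
        rw [← (nu_hasSum hk ht).tsum_eq]
        exact (nu_hasSum hk ht).summable.sum_le_tsum _ (fun m _ => nu_nonneg _ _ _)
      have e2 : ∑ m ∈ F, nu k t m * (1 - (((k:ℝ) - 1) * (η * ell t m) + (η * log t) +
          C1 * η + 2 * (η * ell t m) ^ 2)) = ∑ m ∈ F, nu k t m - ((k:ℝ) - 1) * η * ∑ m ∈ F, nu k t m * ell t m
          - (η * log t + C1 * η) * ∑ m ∈ F, nu k t m - 2 * η ^ 2 * ∑ m ∈ F, nu k t m * ell t m ^ 2 := by
        rw [Finset.mul_sum, Finset.mul_sum, Finset.mul_sum, ← Finset.sum_sub_distrib, ← Finset.sum_sub_distrib, ← Finset.sum_sub_distrib]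
        apply Finset.sum_congr rfl
        intro m _; ring
      have g1 : ((k:ℝ) - 1) * η * ∑ m ∈ F, nu k t m * ell t m ≤ ((k:ℝ) - 1) * η * Mom k t 1 (log N) :=
        mul_le_mul_of_nonneg_left hm1 (mul_nonneg (by linarith) hη0.le)
      have g2 : (η * log t + C1 * η) * ∑ m ∈ F, nu k t m ≤ (η * log t + C1 * η) :=
        mul_le_of_le_one_right (by positivity) hm0
      have g3 : 2 * η ^ 2 * ∑ m ∈ F, nu k t m * ell t m ^ 2 ≤ 2 * η ^ 2 * Mom k t 2 (log N) :=
        mul_le_mul_of_nonneg_left hm2 (by positivity)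
      have k1 := mul_le_mul_of_nonneg_left (hM1 t ht (log N) hlN0) hη0.le
      have k2 := mul_le_mul_of_nonneg_left (hM2 t ht (log N) hlN0) (by positivity : 0 ≤ η ^ 2)
      have k0 := hN0 t ht (log N) hlN0
      set r := log t / log N with hr
      have hr0 : 0 < r := by positivity
      have hr1 : r ≤ 1 := by
        rw [hr, div_le_one hlN0]; exact Real.log_le_log (by linarith) htN
      have hrα : r ≤ r ^ α := by
        nth_rewrite 1 [← Real.rpow_one r]
        exact Real.rpow_le_rpow_of_exponent_ge hr0 hr1 hα1
      have hηr : η * log t = r := by rw [hη, hr]; ring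
      have hη2 : η ≤ 2 * r := by rw [← hηr]; nlinarith
      have f1 : η * (K1 * log t ^ α * log N ^ (1 - α)) = K1 * r ^ α := by
        rw [hr, Real.div_rpow hlt0.le hlN0.le, Real.rpow_sub hlN0, Real.rpow_one, hη]; field_simp
      have f2 : η ^ 2 * (K2 * log t ^ α * log N ^ (2 - α)) = K2 * r ^ α := by
        rw [hr, Real.div_rpow hlt0.le hlN0.le, Real.rpow_sub hlN0, Real.rpow_two, hη]; field_simp
      rw [f1] at k1
      rw [f2] at k2
      have k3 := mul_le_mul_of_nonneg_left hη2 hC1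
      have k4 := mul_le_mul_of_nonneg_left hrα hC1
      rw [e2] at h2
      rw [hηr] at g2 h2
      have : B * r ^ α = C0 * r ^ α + K1 * r ^ α + r ^ α + 2 * (C1 * r ^ α) + 2 * (K2 * r ^ α) := by rw [hB]; ring
      rw [this]
      linarith
    · push Not at htN
      have h1 : ∑ m ∈ S, gid k t (1 - η) N m ≤ 1 := by
        exact sum_le_hasSum _ (fun m _ => hgn m) hid
      have h2 : 1 ≤ (log t / log N) ^ α := by
        apply Real.one_le_rpow _ hα.le
        rw [le_div_iff₀ hlN0, one_mul]
        exact Real.log_le_log (by linarith) htN.le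
      nlinarith
  have hcl : (c / log N) ^ k ≤ PP N (1 - η) ^ k := pow_le_pow_left₀ (by positivity) hP k
  have h1 : (∑ m ∈ S, fw k m * (m:ℝ) ^ (-(1 - η))) * PP N (1 - η) ^ k = ∑ m ∈ S, gid k t (1 - η) N m := by
    rw [Finset.sum_mul]
    apply Finset.sum_congr rfl
    intro m hm
    obtain ⟨a, b, d⟩ := hS m hm
    unfold gid
    rw [if_pos ⟨a, b⟩, min_eq_right d]
  have h0 : 0 ≤ ∑ m ∈ S, fw k m * (m:ℝ) ^ (-(1 - η)) :=
    Finset.sum_nonneg fun m _ => mul_nonneg (fw_nonneg _ _) (by positivity)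
  have h2 := (mul_le_mul_of_nonneg_left hcl h0).trans (h1.le.trans hmain)
  rw [← le_div_iff₀ (by positivity)] at h2
  refine h2.trans (le_of_eq ?_)
  rw [Real.div_rpow hlt0.le hlN0.le, Real.rpow_sub hlN0, Real.rpow_natCast, div_pow]
  field_simp

lemma log55 : log 55 ≤ 5 ∧ 4 ≤ log 55 := by
  constructor
  · rw [Real.log_le_iff_le_exp (by norm_num)]
    have h := Real.exp_one_gt_d9
    have : exp 5 = exp 1 ^ 5 := by rw [← Real.exp_nat_mul]; norm_num
    rw [this]
    calc (55:ℝ) ≤ 2.7182818283 ^ 5 := by norm_num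
      _ ≤ exp 1 ^ 5 := by gcongr
  · exact_mod_cast log_N_ge (le_refl 55)

lemma exp_saving (i : ℕ) : exp (-(2 ^ i / 30 : ℝ)) ≤ 162000 * (1 / 8) ^ i := by
  have h := Real.pow_div_factorial_le_exp (2 ^ i / 30 : ℝ) (by positivity) 3
  rw [Real.exp_neg, inv_le_iff_one_le_mul₀ (exp_pos _)]
  have e1 : ((2:ℝ) ^ i / 30) ^ 3 / (Nat.factorial 3 : ℕ) = 8 ^ i / 162000 := by
    have : (8:ℝ) ^ i = (2 ^ i) ^ 3 := by rw [← pow_mul, mul_comm, pow_mul]; norm_num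
    rw [this, div_pow]; norm_num [Nat.factorial]; ring
  rw [e1] at h
  calc (1:ℝ) = 162000 * (1 / 8) ^ i * (8 ^ i / 162000) := by
        rw [div_pow, one_pow]; field_simp
    _ ≤ _ := mul_le_mul_of_nonneg_left h (by positivity)

/-- admissible `a` for the class `i` -/
def okA (t x : ℝ) (i : ℕ) (a : ℕ) : Prop :=
  IsDense a t ∧ (a:ℝ) ≤ x ∧ (∀ p : ℕ, p.Prime → p ∣ a → (p:ℝ) ≤ exp (log x / 2 ^ i)) ∧
    log x / 2 ≤ log a + log x / 2 ^ i ∧ log x / 4 ≤ ell t a ∧ log 2 ≤ log x / 2 ^ i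

lemma okA_bound {k : ℕ} (hk : k = 1 ∨ k = 2) {α C0 : ℝ} (hα : 0 < α) (hα1 : α ≤ 1) (hk2 : k = 2 → α < 1) (hC0 : 0 < C0)
    (hN0 : ∀ t, 2 ≤ t → ∀ L, 0 < L → NN k t L ≤ C0 * (log t / L) ^ α) :
    ∃ C, 0 < C ∧ ∀ t x, 2 ≤ t → t ≤ x → log 55 ≤ log x / 4 → ∀ i : ℕ, ∀ S : Finset ℕ,
      (∀ a ∈ S, okA t x i a) →
      ∑ a ∈ S, fw k a / a ≤ C * (log x) ^ (k - α) * (log t) ^ α * (1 / 8) ^ i := by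
  obtain ⟨C1, hC1, hran⟩ := rankin hk hα hα1 hk2 hC0 hN0
  obtain ⟨c, _, hc, _, hPP⟩ := PP_one_bounds
  set A := (2 / c) ^ k * C0 * 4 ^ α * 8 with hA
  have hA0 : 0 < A := by positivity
  refine ⟨A + C1 * 162000, by positivity, fun t x ht htx hx i S hS => ?_⟩
  obtain ⟨l55a, l55b⟩ := log55
  set L := log x with hL
  have hL0 : 0 < L := by linarith
  have hlt := log_t_ge ht
  have hlt0 : 0 < log t := by linarith
  have hk0 : (1:ℝ) ≤ k := by rcases hk with rfl | rfl <;> norm_num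
  have hLk : 0 < L ^ (k - α) := by positivity
  have hx0 : 0 < x := by linarith
  have hlx : log t ≤ L := Real.log_le_log (by linarith) htx
  have hfin : ∀ B ≤ A + C1 * 162000, ∑ a ∈ S, fw k a / a ≤ B * L ^ (k - α) * (log t) ^ α * (1 / 8) ^ i →
      ∑ a ∈ S, fw k a / a ≤ (A + C1 * 162000) * L ^ (k - α) * (log t) ^ α * (1 / 8) ^ i := by
    intro B hB h
    refine h.trans ?_
    gcongr
  by_cases hi : i < 2
  · apply hfin A (by linarith [mul_pos hC1 (by norm_num : (0:ℝ) < 162000)])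
    have h1 : ∑ a ∈ S, fw k a / a ≤ ∑ a ∈ S, (2 * L / c) ^ k * (nu k t a * (if L / 4 ≤ ell t a then 1 else 0)) := by
      apply Finset.sum_le_sum
      intro a ha
      obtain ⟨hd, hax, -, -, hl, -⟩ := hS a ha
      rw [if_pos hl, mul_one, nu_dense hd]
      have ha1 : (1:ℝ) ≤ a := by exact_mod_cast hd.1
      have hta : 2 ≤ t * a := by nlinarith
      have hP := (hPP (t * a) hta).1
      have hl2 : log (t * a) ≤ 2 * L := by
        rw [Real.log_mul (by positivity) (by positivity)]
        have := Real.log_le_log (by positivity) hax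
        linarith
      have p1 := PP_pos (y := t * a) one_pos
      have : 1 ≤ (2 * L / c) * PP (t * a) 1 := by
        rw [div_mul_eq_mul_div, le_div_iff₀ hc]
        have := mul_le_mul_of_nonneg_left hl2 p1.le
        linarith
      have h2 : 1 ≤ ((2 * L / c) * PP (t * a) 1) ^ k := one_le_pow₀ this
      rw [mul_pow] at h2
      have hf : 0 ≤ fw k a / a := div_nonneg (fw_nonneg _ _) (by positivity)
      have := mul_le_mul_of_nonneg_left h2 hf
      linarith
    rw [← Finset.mul_sum] at h1
    have h2 : ∑ a ∈ S, nu k t a * (if L / 4 ≤ ell t a then 1 else 0) ≤ NN k t (L / 4) := by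
      apply (NN_summable hk ht _).sum_le_tsum
      intro a _
      exact mul_nonneg (nu_nonneg _ _ _) (by split_ifs <;> norm_num)
    have h3 := hN0 t ht (L / 4) (by positivity)
    have h4 := h1.trans (mul_le_mul_of_nonneg_left (h2.trans h3) (by positivity))
    refine h4.trans ?_
    have e1 : (2 * L / c) ^ k * (C0 * (log t / (L / 4)) ^ α) = (2 / c) ^ k * C0 * 4 ^ α * L ^ (k - α) * (log t) ^ α := by
      have : log t / (L / 4) = 4 * log t / L := by field_simp
      rw [this, Real.div_rpow (by positivity) hL0.le, Real.mul_rpow (by norm_num) hlt0.le, Real.rpow_sub hL0, Real.rpow_natCast,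
        mul_div_right_comm, mul_pow]
      field_simp
    rw [e1, hA]
    have h8 : (1:ℝ) ≤ 8 * (1 / 8) ^ i := by
      interval_cases i <;> norm_num
    have : 0 ≤ (2 / c) ^ k * C0 * 4 ^ α * L ^ (k - α) * (log t) ^ α := by positivity
    have := mul_le_mul_of_nonneg_left h8 this
    linarith
  · push Not at hi
    apply hfin (C1 * 162000) (by linarith)
    rcases Finset.eq_empty_or_nonempty S with rfl | ⟨a0, ha0⟩
    · simp; positivity
    have hy2 : log 2 ≤ L / 2 ^ i := (hS a0 ha0).2.2.2.2.2
    set y := L / 2 ^ i with hy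
    set N := max ⌊exp y⌋₊ 55 with hN
    have hN55 : 55 ≤ N := le_max_right _ _
    have h2i : (4:ℝ) ≤ 2 ^ i := by
      calc (4:ℝ) = 2 ^ 2 := by norm_num
        _ ≤ 2 ^ i := pow_le_pow_right₀ (by norm_num) hi
    have hy4 : y ≤ L / 4 := by rw [hy]; gcongr
    have hNe : (N:ℝ) ≤ exp (L / 4) := by
      rw [hN, Nat.cast_max]
      apply max_le
      · exact (Nat.floor_le (exp_pos _).le).trans (Real.exp_le_exp.mpr hy4)
      · rw [← Real.log_le_iff_le_exp (by norm_num)]; exact_mod_cast hx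
    have hN0' : (0:ℝ) < N := by exact_mod_cast (by omega : 0 < N)
    have hlN4 := log_N_ge hN55
    have hlNL : log N ≤ L := by
      rw [Real.log_le_iff_le_exp hN0']
      exact hNe.trans (Real.exp_le_exp.mpr (by linarith))
    have hlNy : log N ≤ 7.5 * y := by
      have h2 := Real.log_two_gt_d9
      rw [Real.log_le_iff_le_exp hN0', hN, Nat.cast_max]
      apply max_le
      · exact (Nat.floor_le (exp_pos _).le).trans (Real.exp_le_exp.mpr (by linarith))
      · rw [← Real.log_le_iff_le_exp (by norm_num)]; push_cast; linarith
    have hr := hran t ht N hN55 S (by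
      intro a ha
      obtain ⟨hd, hax, hsm, -, hl, -⟩ := hS a ha
      have ha1 : (1:ℝ) ≤ a := by exact_mod_cast hd.1
      refine ⟨hd, ?_, ?_⟩
      · rw [Nat.mem_smoothNumbers']
        intro p hp hpa
        have h1 := hsm p hp hpa
        have h2 : p ≤ ⌊exp y⌋₊ := Nat.le_floor h1
        have : ⌊exp y⌋₊ ≤ N := le_max_left _ _
        omega
      · refine hNe.trans ?_
        rw [← Real.le_log_iff_exp_le (by positivity)]; exact hl)
    have h1 : ∑ a ∈ S, fw k a / a ≤ ∑ a ∈ S, (162000 * (1 / 8) ^ i) * (fw k a * (a:ℝ) ^ (-(1 - 1 / log N))) := by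
      apply Finset.sum_le_sum
      intro a ha
      obtain ⟨hd, hax, -, hal, -, -⟩ := hS a ha
      have ha1 : (1:ℝ) ≤ a := by exact_mod_cast hd.1
      have ha0 : (0:ℝ) < a := by linarith
      have hla : L / 4 ≤ log a := by linarith
      have e1 : fw k a / a = exp (-(log a / log N)) * (fw k a * (a:ℝ) ^ (-(1 - 1 / log N))) := by
        rw [neg_sub, Real.rpow_sub ha0, Real.rpow_one, Real.rpow_def_of_pos ha0]
        have : exp (-(log a / log N)) * exp (log a * (1 / log N)) = 1 := by
          rw [← Real.exp_add, mul_one_div, neg_add_cancel, Real.exp_zero]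
        calc fw k a / a = fw k a / a * (exp (-(log a / log N)) * exp (log a * (1 / log N))) := by rw [this, mul_one]
          _ = _ := by ring
      rw [e1]
      apply mul_le_mul_of_nonneg_right _ (mul_nonneg (fw_nonneg _ _) (by positivity))
      refine le_trans (Real.exp_le_exp.mpr ?_) (exp_saving i)
      rw [neg_le_neg_iff, le_div_iff₀ (by linarith)]
      have : 2 ^ i / 30 * log N ≤ 2 ^ i / 30 * (7.5 * y) := by gcongr
      have e2 : (2:ℝ) ^ i / 30 * (7.5 * y) = L / 4 := by rw [hy]; field_simp; norm_num
      linarith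
    rw [← Finset.mul_sum] at h1
    refine h1.trans ((mul_le_mul_of_nonneg_left hr (by positivity)).trans ?_)
    have : (log N) ^ (k - α) ≤ L ^ (k - α) := Real.rpow_le_rpow (by linarith) hlNL (by linarith)
    calc 162000 * (1 / 8) ^ i * (C1 * log N ^ (k - α) * log t ^ α) ≤ 162000 * (1 / 8) ^ i * (C1 * L ^ (k - α) * log t ^ α) := by gcongr
      _ = _ := by ring

open Classical in
noncomputable def TT (k : ℕ) (x t : ℝ) : ℝ :=
  ∑ n ∈ (Finset.Icc 1 ⌊x⌋₊).filter (fun n => IsDense n t), fw k n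

lemma pair_exists {t x : ℝ} (ht : 2 ≤ t) (hx1 : 1 < x) {n : ℕ}
    (hn : IsDense n t) (hnx : (n:ℝ) ≤ x) (hs : √x ≤ n) :
    ∃ (i a c : ℕ), n = a * c ∧ okA t x i a ∧ c ∈ RS (exp (log x / 2 ^ (i+1))) (x / a) ∧
      exp (log x / 2 ^ (i+1)) ≤ x / a ∧ 2 ≤ x / a := by
  have hx0 : 0 < x := by linarith
  have hL0 : 0 < log x := Real.log_pos hx1
  have hsq : √x ≤ x := by rw [Real.sqrt_le_left hx0.le]; nlinarith
  obtain ⟨a, c, rfl, hda, hay, hc1, hym, hpa, hmt, -⟩ := hn.exists_prefix (y := √x) (by rw [Real.lt_sqrt (by norm_num)]; linarith) hs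
  have hp := Nat.minFac_prime hc1
  set p := c.minFac with hpdef
  have ha0 : 0 < a := hda.1
  have haR : (1:ℝ) ≤ a := by exact_mod_cast ha0
  have hc0 : 0 < c := Nat.pos_of_mul_pos_left (hn.1) |> fun h => h
  have hpc : p ≤ c := Nat.minFac_le hc0
  have hpcR : (p:ℝ) ≤ c := by exact_mod_cast hpc
  have hp2 : (2:ℝ) ≤ p := by exact_mod_cast hp.two_le
  have hlp2 : log 2 ≤ log p := Real.log_le_log (by norm_num) hp2
  have hlp0 : 0 < log p := lt_of_lt_of_le (Real.log_pos (by norm_num)) hlp2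
  push_cast at hnx
  have hcx : (c:ℝ) ≤ x / a := by rw [le_div_iff₀ (by linarith)]; linarith
  have hpx : (p:ℝ) ≤ x := by nlinarith
  have hlpL : log p ≤ log x := Real.log_le_log (by linarith) hpx
  obtain ⟨i, hi1, hi2⟩ := exists_nat_pow_near (x := log x / log p) (y := 2) (by rwa [le_div_iff₀ hlp0, one_mul]) (by norm_num)
  have h1 : log p ≤ log x / 2 ^ i := by
    rw [le_div_iff₀ hlp0] at hi1; rw [le_div_iff₀ (by positivity)]; linarith
  have h2 : log x / 2 ^ (i+1) < log p := by
    rw [div_lt_iff₀ hlp0] at hi2; rw [div_lt_iff₀ (by positivity)]; linarith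
  have h1' : (p:ℝ) ≤ exp (log x / 2 ^ i) := by rw [← Real.log_le_iff_le_exp (by linarith)]; exact h1
  have h2' : exp (log x / 2 ^ (i+1)) < p := by rw [← Real.lt_log_iff_exp_lt (by linarith)]; exact h2
  have hxa0 : 0 ≤ x / a := by positivity
  have hls : log √x = log x / 2 := Real.log_sqrt hx0.le
  have hs0 : 0 < √x := Real.sqrt_pos.2 hx0
  refine ⟨i, a, c, rfl, ⟨hda, by linarith, ?_, ?_, ?_, by linarith⟩, ?_, by linarith, by linarith⟩
  · intro q hq hqa
    have := hpa q hq hqa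
    have : (q:ℝ) ≤ p := by exact_mod_cast this
    linarith
  · have := Real.log_le_log hs0 hym
    rw [hls, Real.log_mul (by positivity) (by positivity)] at this
    linarith
  · have h3 : √x ≤ (t * a) ^ 2 := by nlinarith [mul_le_mul_of_nonneg_left hmt (by linarith : (0:ℝ) ≤ a), mul_nonneg (by linarith : 0 ≤ t) (mul_self_nonneg (a:ℝ))]
    have := Real.log_le_log hs0 h3
    rw [hls, Real.log_pow] at this
    unfold ell
    push_cast at this
    linarith
  · rw [mem_RS hxa0]
    refine ⟨⟨hc0, hcx⟩, fun q hq hqc => ?_⟩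
    have : (p:ℝ) ≤ q := by exact_mod_cast Nat.minFac_le_of_dvd hq.two_le hqc
    linarith

lemma upper_main {k : ℕ} (hk : k = 1 ∨ k = 2) {α C0 : ℝ} (hα : 0 < α) (hα1 : α ≤ 1) (hk2 : k = 2 → α < 1) (hC0 : 0 < C0)
    (hN0 : ∀ t, 2 ≤ t → ∀ L, 0 < L → NN k t L ≤ C0 * (log t / L) ^ α) :
    ∃ C, 0 < C ∧ ∀ t x, 2 ≤ t → t ≤ x → log 55 ≤ log x / 4 → ∀ B : Finset ℕ,
      (∀ n ∈ B, IsDense n t ∧ (n:ℝ) ≤ x ∧ √x ≤ n) →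
      ∑ n ∈ B, fw k n ≤ C * (x * (log x) ^ (k - 1 - α) * (log t) ^ α) := by
  classical
  obtain ⟨C1, hC1, hA⟩ := okA_bound hk hα hα1 hk2 hC0 hN0
  obtain ⟨C2, hC2, hR⟩ := rough_sum hk
  refine ⟨8 * C1 * C2, by positivity, fun t x ht htx hx B hB => ?_⟩
  obtain ⟨l55a, l55b⟩ := log55
  set L := log x with hL
  have hL0 : 0 < L := by linarith
  have hx0 : 0 < x := by linarith
  have hlt0 : 0 < log t := by linarith [log_t_ge ht]
  have hp : ∀ n ∈ B, _ := fun n hn => pair_exists ht (by linarith) (hB n hn).1 (hB n hn).2.1 (hB n hn).2.2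
  choose! fi fa fc hpr using hp
  set I := B.sup fi + 1 with hI
  set S : ℕ → Finset ℕ := fun i => (Finset.Icc 1 ⌊x⌋₊).filter (fun a => okA t x i a ∧ exp (L / 2 ^ (i+1)) ≤ x / a ∧ 2 ≤ x / a) with hS
  set U : Finset (Σ _ : ℕ, Σ _ : ℕ, ℕ) := (Finset.range I).sigma (fun i => (S i).sigma (fun a => RS (exp (L / 2 ^ (i+1))) (x / a))) with hU
  set φ : ℕ → (Σ _ : ℕ, Σ _ : ℕ, ℕ) := fun n => ⟨fi n, fa n, fc n⟩ with hφ
  have hinj : Set.InjOn φ B := by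
    intro n hn m hm h
    rw [(hpr n hn).1, (hpr m hm).1]
    simp only [hφ, Sigma.mk.injEq, heq_eq_eq] at h
    rw [h.2.1, h.2.2]
  have hsub : B.image φ ⊆ U := by
    intro u hu
    obtain ⟨n, hn, rfl⟩ := Finset.mem_image.1 hu
    obtain ⟨-, h2, h3, h4, h5⟩ := hpr n hn
    simp only [hU, hφ, hS, Finset.mem_sigma, Finset.mem_range, Finset.mem_filter, Finset.mem_Icc]
    refine ⟨Nat.lt_succ_of_le (Finset.le_sup hn), ⟨⟨h2.1.1, Nat.le_floor h2.2.1⟩, h2, h4, h5⟩, h3⟩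
  have s1 : ∑ n ∈ B, fw k n ≤ ∑ u ∈ U, fw k u.2.1 * fw k u.2.2 := by
    calc ∑ n ∈ B, fw k n ≤ ∑ n ∈ B, fw k (φ n).2.1 * fw k (φ n).2.2 := by
          apply Finset.sum_le_sum
          intro n hn
          conv_lhs => rw [(hpr n hn).1]
          exact fw_mul_le k _ _
      _ = ∑ u ∈ B.image φ, fw k u.2.1 * fw k u.2.2 := by rw [Finset.sum_image hinj]
      _ ≤ _ := Finset.sum_le_sum_of_subset_of_nonneg hsub (fun _ _ _ => mul_nonneg (fw_nonneg _ _) (fw_nonneg _ _))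
  have s2 : ∀ i, ∀ a ∈ S i, ∑ c ∈ RS (exp (L / 2 ^ (i+1))) (x / a), fw k a * fw k c ≤ C2 * x / L * 4 ^ (i+1) * (fw k a / a) := by
    intro i a ha
    simp only [hS, Finset.mem_filter, Finset.mem_Icc] at ha
    obtain ⟨⟨ha1, -⟩, -, h4, h5⟩ := ha
    have ha0 : (1:ℝ) ≤ a := by exact_mod_cast ha1
    rw [← Finset.mul_sum]
    have hw : 1 ≤ exp (L / 2 ^ (i+1)) := Real.one_le_exp (by positivity)
    have h := hR _ _ hw h5 h4
    have hl1 : log (x / a) ≤ L := Real.log_le_log (by linarith) (div_le_self hx0.le ha0)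
    have hl0 : 0 ≤ log (x / a) := Real.log_nonneg (by linarith)
    have hl2 : L / 2 ^ (i+1) ≤ log (2 * exp (L / 2 ^ (i+1))) := by
      rw [Real.le_log_iff_exp_le (by positivity)]; linarith
    have h6 : C2 * (x / a) * (log (x / a)) ^ (k - 1) / (log (2 * exp (L / 2 ^ (i+1)))) ^ k ≤ C2 * (x / a) * L ^ (k - 1) / (L / 2 ^ (i+1)) ^ k := by
      gcongr
    have h7 : C2 * (x / a) * L ^ (k - 1) / (L / 2 ^ (i+1)) ^ k ≤ C2 * (x / a) / L * 4 ^ (i+1) := by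
      rcases hk with rfl | rfl
      · have : (2:ℝ) ^ (i+1) ≤ 4 ^ (i+1) := by gcongr; norm_num
        calc _ = C2 * (x / a) / L * 2 ^ (i+1) := by field_simp; simp
          _ ≤ _ := by gcongr
      · have : (4:ℝ) ^ (i+1) = (2 ^ (i+1)) ^ 2 := by rw [← pow_mul, mul_comm, pow_mul]; norm_num
        rw [this]
        apply le_of_eq; field_simp; simp
    calc fw k a * _ ≤ fw k a * (C2 * (x / a) / L * 4 ^ (i+1)) := mul_le_mul_of_nonneg_left (h.trans (h6.trans h7)) (fw_nonneg _ _)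
      _ = _ := by ring
  have s3 : ∀ i, ∑ a ∈ S i, ∑ c ∈ RS (exp (L / 2 ^ (i+1))) (x / a), fw k a * fw k c ≤ 4 * C1 * C2 * (x / L * L ^ (k - α) * (log t) ^ α) * (1 / 2) ^ i := by
    intro i
    calc _ ≤ ∑ a ∈ S i, C2 * x / L * 4 ^ (i+1) * (fw k a / a) := Finset.sum_le_sum (s2 i)
      _ = C2 * x / L * 4 ^ (i+1) * ∑ a ∈ S i, fw k a / a := by rw [Finset.mul_sum]
      _ ≤ C2 * x / L * 4 ^ (i+1) * (C1 * L ^ (k - α) * (log t) ^ α * (1 / 8) ^ i) := by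
          gcongr
          exact hA t x ht htx hx i (S i) (fun a ha => (Finset.mem_filter.1 ha).2.1)
      _ = _ := by
          have : ((1:ℝ) / 2) ^ i = 4 ^ i * (1 / 8) ^ i := by rw [← mul_pow]; norm_num
          rw [this, pow_succ]; ring
  have hpw : x / L * L ^ (k - α) = x * L ^ (k - 1 - α) := by
    rw [show (k:ℝ) - 1 - α = (k - α) - 1 by ring, Real.rpow_sub_one hL0.ne']; ring
  calc _ ≤ _ := s1
    _ = ∑ i ∈ Finset.range I, ∑ a ∈ S i, ∑ c ∈ RS (exp (L / 2 ^ (i+1))) (x / a), fw k a * fw k c := by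
        rw [hU, Finset.sum_sigma]
        apply Finset.sum_congr rfl; intro i _
        rw [Finset.sum_sigma]
    _ ≤ ∑ i ∈ Finset.range I, 4 * C1 * C2 * (x / L * L ^ (k - α) * (log t) ^ α) * (1 / 2) ^ i := Finset.sum_le_sum (fun i _ => s3 i)
    _ = 4 * C1 * C2 * (x / L * L ^ (k - α) * (log t) ^ α) * ∑ i ∈ Finset.range I, ((1:ℝ) / 2) ^ i := by rw [Finset.mul_sum]
    _ ≤ 4 * C1 * C2 * (x / L * L ^ (k - α) * (log t) ^ α) * 2 := by
        gcongr
        exact sum_geometric_two_le I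
    _ = _ := by rw [hpw]; ring

lemma lt_rpow_half {t α : ℝ} (ht : 2 ≤ t) (hα : 0 < α) (hα1 : α ≤ 1) : 1 / 2 ≤ (log t) ^ α := by
  have h := log_t_ge ht
  calc (1/2:ℝ) = (1/2) ^ (1:ℝ) := by simp
    _ ≤ (1/2) ^ α := Real.rpow_le_rpow_of_exponent_ge (by norm_num) (by norm_num) hα1
    _ ≤ _ := Real.rpow_le_rpow (by norm_num) h hα.le

lemma small_exp {L e : ℝ} (h1 : 1 / 2 ≤ L) (h2 : L ≤ 20) (he : -1 ≤ e) (he1 : e ≤ 1) : 1 / 20 ≤ L ^ e := by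
  rcases le_total L 1 with h | h
  · have := Real.rpow_le_rpow_of_exponent_ge (by linarith) h he1
    rw [Real.rpow_one] at this; linarith
  · have := Real.rpow_le_rpow_of_exponent_le h he
    rw [Real.rpow_neg_one] at this
    refine le_trans ?_ this
    rw [one_div]; gcongr

lemma TT_upper {k : ℕ} (hk : k = 1 ∨ k = 2) {α C0 : ℝ} (hα : 0 < α) (hα1 : α ≤ 1) (hk2 : k = 2 → α < 1) (hC0 : 0 < C0)
    (hN0 : ∀ t, 2 ≤ t → ∀ L, 0 < L → NN k t L ≤ C0 * (log t / L) ^ α) :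
    ∃ C, 0 < C ∧ ∀ t x, 2 ≤ t → t ≤ x → TT k x t ≤ C * (x * (log x) ^ (k - 1 - α) * (log t) ^ α) := by
  classical
  obtain ⟨C, hC, hM⟩ := upper_main hk hα hα1 hk2 hC0 hN0
  refine ⟨C + 4 + 40 * exp 20, by positivity, fun t x ht htx => ?_⟩
  have hx0 : 0 < x := by linarith
  have hhalf := lt_rpow_half ht hα hα1
  have hL2 := log_t_ge (ht.trans htx)
  have hL0 : 0 < log x := by linarith
  have hLp : 0 < (log x) ^ (k - 1 - α) := by positivity
  set Q := x * (log x) ^ (k - 1 - α) * (log t) ^ α with hQ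
  have hQ0 : 0 < Q := by positivity
  have hk0 : (1:ℝ) ≤ k ∧ (k:ℝ) ≤ 2 := by rcases hk with rfl | rfl <;> norm_num
  by_cases hx : log 55 ≤ log x / 4
  · have hL1 : 1 ≤ log x := by linarith [log55.2]
    unfold TT
    rw [← Finset.sum_filter_add_sum_filter_not _ (fun n : ℕ => √x ≤ n)]
    have h1 := hM t x ht htx hx (((Finset.Icc 1 ⌊x⌋₊).filter (fun n => IsDense n t)).filter (fun n : ℕ => √x ≤ n)) (by
      intro n hn
      simp only [Finset.mem_filter, Finset.mem_Icc, Nat.le_floor_iff hx0.le] at hn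
      exact ⟨hn.1.2, hn.1.1.2, hn.2⟩)
    have h2 : ∑ n ∈ ((Finset.Icc 1 ⌊x⌋₊).filter (fun n => IsDense n t)).filter (fun n : ℕ => ¬ √x ≤ n), fw k n ≤ 4 * Q := by
      have hs0 : 0 < √x := Real.sqrt_pos.2 hx0
      have a1 : ∑ n ∈ ((Finset.Icc 1 ⌊x⌋₊).filter (fun n => IsDense n t)).filter (fun n : ℕ => ¬ √x ≤ n), fw k n
          ≤ ∑ n ∈ Finset.Icc 1 ⌊√x⌋₊, √x ^ (k - 1) := by
        refine le_trans (Finset.sum_le_sum_of_subset_of_nonneg (t := Finset.Icc 1 ⌊√x⌋₊) ?_ (fun _ _ _ => fw_nonneg _ _)) (Finset.sum_le_sum ?_)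
        · intro n hn
          simp only [Finset.mem_filter, Finset.mem_Icc, not_le] at hn
          exact Finset.mem_Icc.2 ⟨hn.1.1.1, Nat.le_floor hn.2.le⟩
        · intro n hn
          rw [Finset.mem_Icc, Nat.le_floor_iff hs0.le] at hn
          unfold fw
          gcongr
          refine le_trans ?_ hn.2
          exact_mod_cast Nat.card_divisors_le_self n
      rw [Finset.sum_const, Nat.card_Icc, Nat.add_sub_cancel, nsmul_eq_mul] at a1
      have a2 : (⌊√x⌋₊:ℝ) ≤ √x := Nat.floor_le hs0.le
      have a3 : log x ≤ 2 * √x := by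
        have := Real.log_le_self hs0.le
        rw [Real.log_sqrt hx0.le] at this; linarith
      have a4 : (log x) ^ ((k:ℝ) - 2) ≤ (log x) ^ (k - 1 - α) := Real.rpow_le_rpow_of_exponent_le hL1 (by linarith)
      have a5 : √x * √x ^ (k - 1) ≤ 2 * (x * (log x) ^ ((k:ℝ) - 2)) := by
        have hsq := Real.mul_self_sqrt hx0.le
        rcases hk with rfl | rfl
        · norm_num
          rw [Real.rpow_neg_one, ← div_eq_mul_inv, ← mul_div_assoc, le_div_iff₀ hL0]
          nlinarith
        · norm_num; linarith
      calc _ ≤ _ := a1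
        _ ≤ √x * √x ^ (k - 1) := by gcongr
        _ ≤ 2 * (x * (log x) ^ ((k:ℝ) - 2)) := a5
        _ ≤ 2 * (x * (log x) ^ (k - 1 - α)) := by gcongr
        _ = 4 * (x * (log x) ^ (k - 1 - α) * (1/2)) := by ring
        _ ≤ _ := by rw [hQ]; gcongr
    have : 0 ≤ 40 * exp 20 * Q := by positivity
    linarith
  · have hL3 : log x ≤ 20 := by linarith [log55.1]
    have hxe : x ≤ exp 20 := by rwa [← Real.log_le_iff_le_exp hx0]
    have h1 := small_exp hL2 hL3 (show -1 ≤ (k:ℝ) - 1 - α by linarith) (by linarith)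
    have h2 : TT k x t ≤ x * x := by
      unfold TT
      calc _ ≤ ∑ n ∈ Finset.Icc 1 ⌊x⌋₊, fw k n := Finset.sum_le_sum_of_subset_of_nonneg (Finset.filter_subset _ _) (fun _ _ _ => fw_nonneg _ _)
        _ ≤ ∑ n ∈ Finset.Icc 1 ⌊x⌋₊, x := by
            apply Finset.sum_le_sum
            intro n hn
            rw [Finset.mem_Icc, Nat.le_floor_iff hx0.le] at hn
            exact (fw_le k n hk (by omega)).trans hn.2
        _ = ⌊x⌋₊ * x := by rw [Finset.sum_const, Nat.card_Icc, Nat.add_sub_cancel, nsmul_eq_mul]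
        _ ≤ x * x := by gcongr; exact Nat.floor_le hx0.le
    have h3 : x * x ≤ 40 * exp 20 * Q := by
      calc x * x ≤ exp 20 * x := by gcongr
        _ = 40 * exp 20 * (x * (1/20) * (1/2)) := by ring
        _ ≤ _ := by rw [hQ]; gcongr
    have : 0 ≤ (C + 4) * Q := by positivity
    linarith

lemma primeDiv_card {N j : ℕ} (hN : 1 < N) : (N.primeFactors.filter (fun q => N ≤ q ^ j)).card ≤ j := by
  set S := N.primeFactors.filter (fun q => N ≤ q ^ j) with hS
  have h1 : ∏ q ∈ S, q ≤ N := by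
    refine Nat.le_of_dvd (by omega) ?_
    exact (Finset.prod_dvd_prod_of_subset _ _ _ (Finset.filter_subset _ _)).trans (Nat.prod_primeFactors_dvd N)
  have h2 : N ^ S.card ≤ N ^ j := by
    calc N ^ S.card = ∏ _q ∈ S, N := by simp
      _ ≤ ∏ q ∈ S, q ^ j := Finset.prod_le_prod' (fun q hq => (Finset.mem_filter.1 hq).2)
      _ = (∏ q ∈ S, q) ^ j := by rw [Finset.prod_pow]
      _ ≤ N ^ j := by gcongr
  exact (Nat.pow_le_pow_iff_right hN).1 h2

lemma push_sum {S R : Finset ℕ} {Q : ℕ → Finset ℕ} {j : ℕ} {g : ℕ → ℝ} (hg : ∀ n, 0 ≤ g n)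
    (hS : ∀ n ∈ S, 0 < n) (hQ : ∀ n ∈ S, ∀ q ∈ Q n, q.Prime ∧ n * q ∈ R ∧ n * q ≤ q ^ j) :
    ∑ n ∈ S, ∑ q ∈ Q n, g (n * q) ≤ j * ∑ N ∈ R, g N := by
  classical
  set U : Finset (Σ _ : ℕ, ℕ) := S.sigma Q with hU
  have hm : ∀ u ∈ U, u.1 * u.2 ∈ R := by
    intro u hu
    rw [hU, Finset.mem_sigma] at hu
    exact (hQ _ hu.1 _ hu.2).2.1
  have e1 : ∑ n ∈ S, ∑ q ∈ Q n, g (n * q) = ∑ u ∈ U, g (u.1 * u.2) := by rw [hU, Finset.sum_sigma]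
  rw [e1, ← Finset.sum_fiberwise_of_maps_to hm, Finset.mul_sum]
  apply Finset.sum_le_sum
  intro N _
  rw [Finset.sum_congr rfl (g := fun _ => g N) (fun u hu => by rw [(Finset.mem_filter.1 hu).2]), Finset.sum_const, nsmul_eq_mul]
  apply mul_le_mul_of_nonneg_right _ (hg N)
  rcases (U.filter (fun u => u.1 * u.2 = N)).eq_empty_or_nonempty with h | ⟨u, hu⟩
  · rw [h]; simp
  have key : ∀ v ∈ U.filter (fun u => u.1 * u.2 = N), v.2.Prime ∧ 0 < v.1 ∧ v.1 * v.2 = N ∧ N ≤ v.2 ^ j := by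
    intro v hv
    obtain ⟨h1, h2⟩ := Finset.mem_filter.1 hv
    rw [hU, Finset.mem_sigma] at h1
    have := hQ _ h1.1 _ h1.2
    exact ⟨this.1, hS _ h1.1, h2, by rw [← h2]; exact this.2.2⟩
  have hN : 1 < N := by
    obtain ⟨a, b, c, -⟩ := key u hu
    nlinarith [a.two_le]
  have h3 : (U.filter (fun u => u.1 * u.2 = N)).card ≤ (N.primeFactors.filter (fun q => N ≤ q ^ j)).card := by
    apply Finset.card_le_card_of_injOn (fun u => u.2)
    · intro v hv
      obtain ⟨a, b, c, d⟩ := key v hv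
      simp only [Finset.coe_filter, Set.mem_ofPred_eq, Nat.mem_primeFactors]
      exact ⟨⟨a, ⟨v.1, by rw [← c]; ring⟩, by omega⟩, d⟩
    · intro v hv w hw h
      obtain ⟨a, b, c, d⟩ := key v hv
      obtain ⟨a', b', c', d'⟩ := key w hw
      obtain ⟨v1, v2⟩ := v
      obtain ⟨w1, w2⟩ := w
      simp only at h c c' a ⊢
      subst h
      have : v1 = w1 := Nat.eq_of_mul_eq_mul_right a.pos (c.trans c'.symm)
      subst this; rfl
  exact_mod_cast h3.trans (primeDiv_card hN)

/-- primes in `(u, w]` -/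
noncomputable def PI (u w : ℝ) : Finset ℕ := (Nat.primesLE ⌊w⌋₊).filter (fun p : ℕ => u < p)

lemma mem_PI {u w : ℝ} (hw : 0 ≤ w) {p : ℕ} : p ∈ PI u w ↔ p.Prime ∧ (p:ℝ) ≤ w ∧ u < p := by
  unfold PI
  rw [Finset.mem_filter, Nat.mem_primesLE, Nat.le_floor_iff hw]; tauto

lemma mertens_int : ∃ C, 0 ≤ C ∧ ∀ u w, 1 ≤ u → u ≤ w → log w - log u - C ≤ ∑ p ∈ PI u w, log p / p := by
  obtain ⟨C, hC, h⟩ := mertens_one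
  refine ⟨2 * C + log 2, by have := Real.log_nonneg (show (1:ℝ) ≤ 2 by norm_num); linarith, fun u w hu huw => ?_⟩
  have fl : ∀ y : ℝ, 1 ≤ y → 1 ≤ ⌊y⌋₊ ∧ log y - log 2 ≤ log ⌊y⌋₊ ∧ log ⌊y⌋₊ ≤ log y := by
    intro y hy
    have h1 : 1 ≤ ⌊y⌋₊ := Nat.le_floor (by exact_mod_cast hy)
    have h1' : (1:ℝ) ≤ ⌊y⌋₊ := by exact_mod_cast h1
    have h2 := Nat.lt_floor_add_one y
    refine ⟨h1, ?_, Real.log_le_log (by linarith) (Nat.floor_le (by linarith))⟩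
    rw [← Real.log_div (by linarith) (by norm_num)]
    exact Real.log_le_log (by linarith) (by linarith)
  obtain ⟨u1, u2, u3⟩ := fl u hu
  obtain ⟨w1, w2, w3⟩ := fl w (hu.trans huw)
  have a1 := abs_le.1 (h _ u1)
  have a2 := abs_le.1 (h _ w1)
  have hsplit := Finset.sum_filter_add_sum_filter_not (Nat.primesLE ⌊w⌋₊) (fun p : ℕ => u < p) (fun p : ℕ => log p / p)
  have hle : ∑ p ∈ (Nat.primesLE ⌊w⌋₊).filter (fun p : ℕ => ¬ u < p), log p / p ≤ ∑ p ∈ Nat.primesLE ⌊u⌋₊, log p / (p:ℝ) := by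
    apply Finset.sum_le_sum_of_subset_of_nonneg
    · intro p hp
      rw [Finset.mem_filter, Nat.mem_primesLE, not_lt] at hp
      exact Nat.mem_primesLE.2 ⟨Nat.le_floor hp.2, hp.1.2⟩
    · intro p _ _
      exact div_nonneg (Real.log_natCast_nonneg p) (Nat.cast_nonneg p)
  unfold PI
  linarith [a1.1, a1.2, a2.1, a2.2]

lemma recip_int : ∃ l0, 0 < l0 ∧ ∀ l, l0 ≤ l → 1 / 6 ≤ ∑ q ∈ PI (exp (l / 3)) (exp (l / 2)), 1 / (q:ℝ) := by
  obtain ⟨C, hC, h⟩ := mertens_int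
  refine ⟨12 * C + 1, by linarith, fun l hl => ?_⟩
  have hl0 : 0 < l := by linarith
  have h1 := h (exp (l/3)) (exp (l/2)) (Real.one_le_exp (by positivity)) (Real.exp_le_exp.2 (by linarith))
  rw [Real.log_exp, Real.log_exp] at h1
  have h2 : ∑ p ∈ PI (exp (l/3)) (exp (l/2)), log p / p ≤ ∑ p ∈ PI (exp (l/3)) (exp (l/2)), l / 2 * (1 / (p:ℝ)) := by
    apply Finset.sum_le_sum
    intro p hp
    rw [mem_PI (exp_pos _).le] at hp
    have hp0 : (0:ℝ) < p := by exact_mod_cast hp.1.pos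
    have := (Real.log_le_iff_le_exp hp0).2 hp.2.1
    rw [mul_one_div]; gcongr
  rw [← Finset.mul_sum] at h2
  nlinarith

lemma count_int : ∃ K, 1 ≤ K ∧ ∀ y, K ≤ y → 1 < y → y / (K * log y) ≤ ((PI (y / K) y).card : ℝ) := by
  obtain ⟨C, hC, h⟩ := mertens_int
  have hK : 1 ≤ exp (C + 1) := Real.one_le_exp (by linarith)
  refine ⟨exp (C + 1), hK, fun y hy hy1 => ?_⟩
  set K := exp (C + 1)
  have hy0 : 0 < y := by linarith
  have hly : 0 < log y := Real.log_pos hy1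
  have h1 := h (y / K) y (by rwa [one_le_div (by linarith)]) (div_le_self hy0.le hK)
  rw [Real.log_div hy0.ne' (by positivity), Real.log_exp] at h1
  have h2 : ∑ p ∈ PI (y/K) y, log p / p ≤ ∑ p ∈ PI (y/K) y, log y / (y / K) := by
    apply Finset.sum_le_sum
    intro p hp
    rw [mem_PI hy0.le] at hp
    have hp0 : (0:ℝ) < p := by exact_mod_cast hp.1.pos
    have hp1 : (1:ℝ) ≤ p := by exact_mod_cast hp.1.pos
    have : 0 < y / K := by positivity
    have := Real.log_le_log hp0 hp.2.1
    have := hp.2.2.le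
    gcongr
  rw [Finset.sum_const, nsmul_eq_mul] at h2
  rw [div_le_iff₀ (by positivity)]
  have h3 : 1 ≤ ((PI (y/K) y).card : ℝ) * (log y / (y / K)) := by linarith
  have h4 : ((PI (y/K) y).card : ℝ) * (log y / (y / K)) = ((PI (y/K) y).card : ℝ) * (K * log y) / y := by field_simp
  rw [h4, le_div_iff₀ hy0] at h3
  linarith

lemma fw_le_fw_mul (k : ℕ) {m n : ℕ} (hm : m ≠ 0) (hn : n ≠ 0) : fw k n ≤ fw k (m * n) := by
  unfold fw
  gcongr
  exact Dvd.intro_left m rfl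

open Classical in
noncomputable def SV (t L M : ℝ) : Finset ℕ :=
  (Finset.Icc 1 ⌊exp L⌋₊).filter (fun n => IsDense n t ∧ M ≤ ell t n ∧ ell t n ≤ 0.9 * L)

noncomputable def VV (k : ℕ) (t L M : ℝ) : ℝ := ∑ n ∈ SV t L M, fw k n / n

lemma mul_exp_ell {t : ℝ} (ht : 2 ≤ t) {n : ℕ} (hn : 0 < n) : exp (ell t n) = t * n := by
  have : (0:ℝ) < n := by exact_mod_cast hn
  unfold ell; rw [Real.exp_log (by positivity)]

lemma ell_mul {t : ℝ} (ht : 2 ≤ t) {n q : ℕ} (hn : 0 < n) (hq : 0 < q) : ell t (n * q) = ell t n + log q := by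
  have : (0:ℝ) < n := by exact_mod_cast hn
  have : (0:ℝ) < q := by exact_mod_cast hq
  unfold ell
  push_cast
  rw [← mul_assoc, Real.log_mul (by positivity) (by positivity)]

lemma mem_SV {t L M : ℝ} (ht : 2 ≤ t) (hL : 0 ≤ L) {n : ℕ} :
    n ∈ SV t L M ↔ IsDense n t ∧ M ≤ ell t n ∧ ell t n ≤ 0.9 * L := by
  classical
  unfold SV
  rw [Finset.mem_filter, Finset.mem_Icc, Nat.le_floor_iff (exp_pos _).le]
  refine ⟨fun h => h.2, fun h => ⟨⟨h.1.1, ?_⟩, h⟩⟩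
  have h1 := mul_exp_ell ht h.1.1
  have h2 : exp (ell t n) ≤ exp L := Real.exp_le_exp.2 (by linarith [h.2.2])
  have : (0:ℝ) ≤ n := Nat.cast_nonneg n
  nlinarith

lemma VV_step {l0 : ℝ} (hl0 : 0 < l0) (hr : ∀ l, l0 ≤ l → 1 / 6 ≤ ∑ q ∈ PI (exp (l / 3)) (exp (l / 2)), 1 / (q:ℝ))
    {k : ℕ} {t L M : ℝ} (ht : 2 ≤ t) (hM : M ≤ 0.6 * L) (hM0 : l0 ≤ 3 / 4 * M) :
    VV k t L (3 / 4 * M) ≤ 25 * VV k t L M := by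
  classical
  have hL : 0 ≤ L := by linarith
  have h1 := push_sum (S := (SV t L (3/4*M)).filter (fun n => ¬ M ≤ ell t n)) (R := SV t L M)
    (Q := fun n => PI (exp (ell t n / 3)) (exp (ell t n / 2))) (j := 4) (g := fun n => fw k n / n)
    (fun n => div_nonneg (fw_nonneg _ _) (Nat.cast_nonneg n))
    (fun n hn => ((mem_SV ht hL).1 (Finset.mem_filter.1 hn).1).1.1) (by
      intro n hn q hq
      rw [Finset.mem_filter, mem_SV ht hL, not_le] at hn
      obtain ⟨⟨hd, hlo, -⟩, hhi⟩ := hn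
      rw [mem_PI (exp_pos _).le] at hq
      obtain ⟨hp, hq1, hq2⟩ := hq
      have hq0 : (0:ℝ) < q := by exact_mod_cast hp.pos
      have e0 : 0 < ell t n := by linarith
      have e1 := mul_exp_ell ht hd.1
      have lq1 := (Real.log_le_iff_le_exp hq0).2 hq1
      have lq2 := (Real.lt_log_iff_exp_lt hq0).2 hq2
      have hn0 : (0:ℝ) ≤ n := Nat.cast_nonneg n
      refine ⟨hp, (mem_SV ht hL).2 ⟨hd.mul_prime hp ?_, ?_, ?_⟩, ?_⟩
      · rw [← e1]; exact hq1.trans (Real.exp_le_exp.2 (by linarith))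
      · rw [ell_mul ht hd.1 hp.pos]; linarith
      · rw [ell_mul ht hd.1 hp.pos]; linarith
      · have : (n:ℝ) ≤ q ^ 3 := by
          calc (n:ℝ) ≤ t * n := by nlinarith
            _ = exp (ell t n / 3) ^ 3 := by rw [← e1, ← Real.exp_nat_mul]; congr 1; push_cast; ring
            _ ≤ q ^ 3 := by gcongr
        have : n ≤ q ^ 3 := by exact_mod_cast this
        rw [pow_succ q 3]; gcongr)
  have h2 : ∑ n ∈ (SV t L (3/4*M)).filter (fun n => ¬ M ≤ ell t n), fw k n / n * (1 / 6) ≤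
      ∑ n ∈ (SV t L (3/4*M)).filter (fun n => ¬ M ≤ ell t n), ∑ q ∈ PI (exp (ell t n / 3)) (exp (ell t n / 2)), fw k (n * q) / ((n * q : ℕ):ℝ) := by
    apply Finset.sum_le_sum
    intro n hn
    rw [Finset.mem_filter, mem_SV ht hL, not_le] at hn
    obtain ⟨⟨hd, hlo, -⟩, hhi⟩ := hn
    calc fw k n / n * (1 / 6) ≤ fw k n / n * ∑ q ∈ PI (exp (ell t n / 3)) (exp (ell t n / 2)), 1 / (q:ℝ) := by
          apply mul_le_mul_of_nonneg_left (hr _ (by linarith))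
          exact div_nonneg (fw_nonneg _ _) (Nat.cast_nonneg n)
      _ ≤ _ := by
          rw [Finset.mul_sum]
          apply Finset.sum_le_sum
          intro q hq
          rw [mem_PI (exp_pos _).le] at hq
          rw [div_mul_div_comm, mul_one]
          push_cast
          gcongr
          rw [mul_comm]
          exact fw_le_fw_mul k hq.1.ne_zero hd.1.ne'
  rw [← Finset.sum_mul] at h2
  have h3 : VV k t L (3/4*M) ≤ VV k t L M + ∑ n ∈ (SV t L (3/4*M)).filter (fun n => ¬ M ≤ ell t n), fw k n / n := by
    unfold VV
    rw [← Finset.sum_filter_add_sum_filter_not (SV t L (3/4*M)) (fun n => M ≤ ell t n)]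
    apply add_le_add_left
    apply Finset.sum_le_sum_of_subset_of_nonneg
    · intro n hn
      rw [Finset.mem_filter, mem_SV ht hL] at hn
      exact (mem_SV ht hL).2 ⟨hn.1.1, hn.2, hn.1.2.2⟩
    · intro n _ _
      exact div_nonneg (fw_nonneg _ _) (Nat.cast_nonneg n)
  change _ ≤ ((4:ℕ):ℝ) * VV k t L M at h1
  have h4 := h2.trans h1
  push_cast at h4
  linarith

lemma VV_iter {l0 : ℝ} (hl0 : 0 < l0) (hr : ∀ l, l0 ≤ l → 1 / 6 ≤ ∑ q ∈ PI (exp (l / 3)) (exp (l / 2)), 1 / (q:ℝ))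
    {k : ℕ} {t L : ℝ} (ht : 2 ≤ t) (j : ℕ) (hM0 : l0 ≤ (3 / 4) ^ j * (0.6 * L)) :
    VV k t L ((3 / 4) ^ j * (0.6 * L)) ≤ 25 ^ j * VV k t L (0.6 * L) := by
  induction j with
  | zero => simp
  | succ j ih =>
    have e : ((3:ℝ) / 4) ^ (j+1) * (0.6 * L) = 3 / 4 * ((3 / 4) ^ j * (0.6 * L)) := by ring
    rw [e] at hM0 ⊢
    have hp : (0:ℝ) < (3/4) ^ j := by positivity
    have hp1 : ((3:ℝ)/4) ^ j ≤ 1 := pow_le_one₀ (by norm_num) (by norm_num)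
    have h0 : l0 ≤ (3 / 4) ^ j * (0.6 * L) := by linarith
    have hL : 0 < 0.6 * L := by
      by_contra h
      push Not at h
      nlinarith [mul_nonneg hp.le (neg_nonneg.2 h)]
    have := VV_step (k := k) hl0 hr ht (M := (3/4) ^ j * (0.6 * L)) (L := L) (by nlinarith) hM0
    have := ih h0
    rw [pow_succ]; linarith

lemma VV_anti (k : ℕ) {t L M M' : ℝ} (ht : 2 ≤ t) (hL : 0 ≤ L) (h : M ≤ M') : VV k t L M' ≤ VV k t L M := by
  apply Finset.sum_le_sum_of_subset_of_nonneg
  · intro n hn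
    rw [mem_SV ht hL] at hn ⊢
    exact ⟨hn.1, by linarith [hn.2.1], hn.2.2⟩
  · intro n _ _
    exact div_nonneg (fw_nonneg _ _) (Nat.cast_nonneg n)

lemma final_step {K : ℝ} (hK1 : 1 ≤ K) (hK : ∀ y, K ≤ y → 1 < y → y / (K * log y) ≤ ((PI (y / K) y).card : ℝ))
    {k : ℕ} {t x : ℝ} (ht : 2 ≤ t) (hx : 1 < x) (htL : log t ≤ 0.1 * log x) (hKL : log K ≤ 0.05 * log x) :
    x / (20 * K * log x) * VV k t (log x) (0.6 * log x) ≤ TT k x t := by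
  classical
  have hx0 : 0 < x := by linarith
  have hL : 0 < log x := Real.log_pos hx
  set L := log x with hLd
  have hK0 : 0 < K := by linarith
  have pre : ∀ n ∈ SV t L (0.6 * L), IsDense n t ∧ (1:ℝ) ≤ n ∧ x / n ≤ t * n ∧ exp (0.05 * L) ≤ x / n / K ∧ K ≤ x / n ∧ 1 < x / n := by
    intro n hn
    obtain ⟨hd, h1, h2⟩ := (mem_SV ht hL.le).1 hn
    have hn1 : (1:ℝ) ≤ n := by exact_mod_cast hd.1
    have hn0 : (0:ℝ) < n := by linarith
    have hel : ell t n = log t + log n := by unfold ell; rw [Real.log_mul (by positivity) (by positivity)]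
    have hlt := log_t_ge ht
    have hlx : log (x / n) = L - log n := by rw [Real.log_div (by positivity) (by positivity)]
    have hxn : 0 < x / n := by positivity
    have a2 : exp (0.05 * L) ≤ x / n / K := by
      rw [← Real.le_log_iff_exp_le (by positivity), Real.log_div (by positivity) (by positivity), hlx]; linarith
    have a3 : 1 < exp (0.05 * L) := Real.one_lt_exp_iff.2 (by linarith)
    have a4 : K ≤ x / n := by
      have : 1 ≤ x / n / K := by linarith
      rwa [one_le_div hK0] at this
    refine ⟨hd, hn1, ?_, a2, a4, ?_⟩
    · rw [← Real.log_le_log_iff hxn (by positivity), hlx]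
      unfold ell at hel h1
      linarith
    · have := div_le_self hxn.le hK1
      linarith
  have h1 := push_sum (S := SV t L (0.6 * L)) (R := (Finset.Icc 1 ⌊x⌋₊).filter (fun n => IsDense n t))
    (Q := fun n => PI (x / n / K) (x / n)) (j := 20) (g := fun n => fw k n)
    (fun n => fw_nonneg _ _) (fun n hn => (pre n hn).1.1) (by
      intro n hn q hq
      obtain ⟨hd, hn1, hxt, he, -, h1x⟩ := pre n hn
      rw [mem_PI (by linarith)] at hq
      obtain ⟨hp, hq1, hq2⟩ := hq
      have hq0 : (0:ℝ) < q := by exact_mod_cast hp.pos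
      have hnq : (n:ℝ) * q ≤ x := by rw [le_div_iff₀ (by linarith)] at hq1; linarith
      refine ⟨hp, Finset.mem_filter.2 ⟨Finset.mem_Icc.2 ⟨Nat.mul_pos hd.1 hp.pos, Nat.le_floor (by push_cast; exact hnq)⟩, hd.mul_prime hp (hq1.trans hxt)⟩, ?_⟩
      have : (n:ℝ) * q ≤ q ^ 20 := by
        calc (n:ℝ) * q ≤ x := hnq
          _ = exp (0.05 * L) ^ 20 := by
              rw [← Real.exp_nat_mul, show ((20:ℕ):ℝ) * (0.05 * L) = L by push_cast; ring, hLd, Real.exp_log hx0]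
          _ ≤ q ^ 20 := by gcongr; linarith
      exact_mod_cast this)
  have h2 : ∑ n ∈ SV t L (0.6 * L), x / (K * L) * (fw k n / n) ≤ ∑ n ∈ SV t L (0.6 * L), ∑ q ∈ PI (x / n / K) (x / n), fw k (n * q) := by
    apply Finset.sum_le_sum
    intro n hn
    obtain ⟨hd, hn1, -, -, h4, h5⟩ := pre n hn
    have hc := hK _ h4 h5
    have hlog : 0 < log (x / n) := Real.log_pos h5
    have hlog2 : log (x / n) ≤ L := Real.log_le_log (by linarith) (div_le_self hx0.le hn1)
    have hf := fw_nonneg k n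
    calc x / (K * L) * (fw k n / n) = (x / n) / (K * L) * fw k n := by field_simp
      _ ≤ (x / n) / (K * log (x / n)) * fw k n := by gcongr
      _ ≤ ((PI (x / n / K) (x / n)).card : ℝ) * fw k n := by gcongr
      _ = ∑ q ∈ PI (x / n / K) (x / n), fw k n := by rw [Finset.sum_const, nsmul_eq_mul]
      _ ≤ _ := by
          apply Finset.sum_le_sum
          intro q hq
          rw [mem_PI (by linarith)] at hq
          rw [mul_comm]
          exact fw_le_fw_mul k hq.1.ne_zero hd.1.ne'
  rw [← Finset.mul_sum] at h2
  change _ ≤ ((20:ℕ):ℝ) * TT k x t at h1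
  have h3 := h2.trans h1
  push_cast at h3
  have e : x / (20 * K * L) * VV k t L (0.6 * L) = (x / (K * L) * VV k t L (0.6 * L)) / 20 := by field_simp
  rw [e]
  unfold VV
  linarith

lemma VV_window {k : ℕ} (hk : k = 1 ∨ k = 2) {α β : ℝ} (hα : 0 < α) (hβ : α < β) (h : Hdata k α β) :
    ∃ θ c t0, 0 < θ ∧ θ ≤ 0.8 ∧ 0 < c ∧ 2 ≤ t0 ∧ ∀ t L, t0 ≤ t → log t ≤ θ * L →
      c * (L ^ k * (log t / L) ^ α) ≤ VV k t L (θ * L) := by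
  obtain ⟨A, c, t0, hA, hc, ht0, hw⟩ := window hk hα hβ h
  obtain ⟨_, Cp, _, hCp, hPP⟩ := PP_one_bounds
  have hA0 : 0 < A := by linarith
  set θ := 0.8 / A ^ 2 with hθ
  have hθ0 : 0 < θ := by positivity
  refine ⟨θ, c * (θ / Cp) ^ k, t0, hθ0, div_le_self (by norm_num) (one_le_pow₀ hA), by positivity, ht0, fun t L htt htL => ?_⟩
  have ht : 2 ≤ t := ht0.trans htt
  have hlt0 : 0 < log t := by linarith [log_t_ge ht]
  have hL : 0 < L := pos_of_mul_pos_right (lt_of_lt_of_le hlt0 htL) hθ0.le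
  have e1 : 0.8 * L / A / A = θ * L := by rw [hθ]; field_simp
  have e2 : A * (0.8 * L / A) = 0.8 * L := by field_simp
  have h1 := hw t htt (0.8 * L / A) (by
    rw [le_div_iff₀ hA0]
    calc A * log t * A = log t * A ^ 2 := by ring
      _ ≤ θ * L * A ^ 2 := by gcongr
      _ = _ := by rw [hθ]; field_simp)
  rw [e1, e2, tsum_eq_sum (s := SV t L (θ * L)) (by
    intro n hn
    rw [mem_SV ht hL.le] at hn
    by_cases hd : IsDense n t
    · rw [if_neg (fun hh => hn ⟨hd, hh.1, by linarith [hh.2]⟩), mul_zero]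
    · rw [nu_zero_of_not hd, zero_mul])] at h1
  have h2 : ∑ n ∈ SV t L (θ * L), nu k t n * (if θ * L ≤ ell t n ∧ ell t n ≤ 0.8 * L then 1 else 0) ≤
      ∑ n ∈ SV t L (θ * L), (Cp / (θ * L)) ^ k * (fw k n / n) := by
    apply Finset.sum_le_sum
    intro n hn
    obtain ⟨hd, hlo, -⟩ := (mem_SV ht hL.le).1 hn
    have hn1 : (1:ℝ) ≤ n := by exact_mod_cast hd.1
    have htn : 2 ≤ t * n := by nlinarith
    have hp := (hPP (t * n) htn).2
    have hel : 0 < log (t * n) := Real.log_pos (by linarith)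
    have hp0 := PP_pos (y := t * n) (s := 1) (by norm_num)
    have hp1 : PP (t * n) 1 ≤ Cp / (θ * L) := by
      rw [le_div_iff₀ (by positivity)]
      refine le_trans ?_ hp
      gcongr; exact hlo
    calc _ ≤ nu k t n := by
          have := nu_nonneg k t n
          split_ifs <;> simp [this]
      _ = fw k n / n * PP (t * n) 1 ^ k := nu_dense hd
      _ ≤ fw k n / n * (Cp / (θ * L)) ^ k := by
          have := div_nonneg (fw_nonneg k n) (Nat.cast_nonneg (α := ℝ) n)
          gcongr
      _ = _ := by ring
  rw [← Finset.mul_sum] at h2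
  have h3 : (log t / L) ^ α ≤ (log t / (0.8 * L / A)) ^ α := by
    gcongr
    refine (div_le_self (by positivity) hA).trans (by linarith)
  have h4 : c * (log t / L) ^ α ≤ (Cp / (θ * L)) ^ k * VV k t L (θ * L) := by
    refine le_trans ?_ (h1.trans h2)
    gcongr
  calc c * (θ / Cp) ^ k * (L ^ k * (log t / L) ^ α) = (θ * L / Cp) ^ k * (c * (log t / L) ^ α) := by
        rw [show θ * L / Cp = θ / Cp * L by ring, mul_pow]; ring
    _ ≤ (θ * L / Cp) ^ k * ((Cp / (θ * L)) ^ k * VV k t L (θ * L)) := by gcongr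
    _ = _ := by rw [← mul_assoc, ← mul_pow]; field_simp; simp

lemma lower_main {k : ℕ} (hk : k = 1 ∨ k = 2) {α β : ℝ} (hα : 0 < α) (hβ : α < β) (h : Hdata k α β) :
    ∃ θ c t0 L1, 0 < θ ∧ θ ≤ 0.1 ∧ 0 < c ∧ 2 ≤ t0 ∧ 0 < L1 ∧ ∀ t x, t0 ≤ t → 1 < x → L1 ≤ log x → log t ≤ θ * log x →
      c * (x * log x ^ (k - 1) * (log t / log x) ^ α) ≤ TT k x t := by
  obtain ⟨θ, c, t0, hθ, hθ1, hc, ht0, hV⟩ := VV_window hk hα hβ h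
  obtain ⟨l0, hl0, hr⟩ := recip_int
  obtain ⟨K, hK1, hK⟩ := count_int
  obtain ⟨j, hj⟩ := exists_pow_lt_of_lt_one hθ (show (3/4:ℝ) < 1 by norm_num)
  set P : ℝ := (3/4) ^ j with hP
  have hP0 : 0 < P := by positivity
  have hK0 : 0 < K := by linarith
  refine ⟨θ / 8, c / (20 * K * 25 ^ j), t0, l0 / (P * 0.6) + log K / 0.05 + 1, by positivity, by linarith, by positivity, ht0, ?_, ?_⟩
  · have := Real.log_nonneg hK1
    positivity
  intro t x htt hx hL1 htL
  have hlK := Real.log_nonneg hK1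
  have q1 : 0 ≤ l0 / (P * 0.6) := by positivity
  have q2 : 0 ≤ log K / 0.05 := by positivity
  set L := log x with hL
  have hL0 : 0 < L := by linarith
  have ht := ht0.trans htt
  have hx0 : 0 < x := by linarith
  have hlt := log_t_ge ht
  have c1 : l0 ≤ P * (0.6 * L) := by
    have : l0 / (P * 0.6) ≤ L := by linarith
    rw [div_le_iff₀ (by positivity)] at this; linarith
  have c2 : log K ≤ 0.05 * L := by
    have : log K / 0.05 ≤ L := by linarith
    rw [div_le_iff₀ (by norm_num)] at this; linarith
  have a1 := hV t L htt (by nlinarith)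
  have a2 := VV_anti k ht hL0.le (show P * (0.6 * L) ≤ θ * L by nlinarith)
  have a3 := VV_iter (k := k) hl0 hr ht j c1
  have a4 := final_step (k := k) hK1 hK ht hx (by nlinarith) c2
  have a5 : c * (L ^ k * (log t / L) ^ α) / 25 ^ j ≤ VV k t L (0.6 * L) := by
    rw [div_le_iff₀ (by positivity)]; linarith
  refine le_trans ?_ a4
  calc c / (20 * K * 25 ^ j) * (x * L ^ (k - 1) * (log t / L) ^ α) = x / (20 * K * L) * (c * (L ^ k * (log t / L) ^ α) / 25 ^ j) := by
        have : L ^ k = L ^ (k - 1) * L := by rcases hk with rfl | rfl <;> simp [pow_two]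
        rw [this]; field_simp
    _ ≤ _ := by gcongr

lemma TT_mono (k : ℕ) {x t t' : ℝ} (h : t ≤ t') : TT k x t ≤ TT k x t' := by
  classical
  unfold TT
  apply Finset.sum_le_sum_of_subset_of_nonneg
  · intro n hn
    rw [Finset.mem_filter] at hn ⊢
    exact ⟨hn.1, hn.2.mono h⟩
  · intro n _ _; exact fw_nonneg _ _

lemma one_le_TT (k : ℕ) {x t : ℝ} (hx : 1 ≤ x) : 1 ≤ TT k x t := by
  classical
  unfold TT
  have h1 : 1 ∈ (Finset.Icc 1 ⌊x⌋₊).filter (fun n => IsDense n t) :=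
    Finset.mem_filter.2 ⟨Finset.mem_Icc.2 ⟨le_rfl, Nat.le_floor (by simpa using hx)⟩, isDense_one t⟩
  refine le_trans ?_ (Finset.single_le_sum (f := fun n => fw k n) (fun _ _ => fw_nonneg _ _) h1)
  exact one_le_fw k one_ne_zero

lemma TT_two_pow (k J : ℕ) {x t t0 : ℝ} (hx : 0 ≤ x) (ht : 2 ≤ t) (hJ : t0 ≤ 2 ^ J) : TT k (x / 2 ^ J) t0 ≤ TT k x t := by
  classical
  unfold TT
  calc _ ≤ ∑ n ∈ (Finset.Icc 1 ⌊x / 2 ^ J⌋₊).filter (fun n => IsDense n t0), fw k (2 ^ J * n) := by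
        apply Finset.sum_le_sum
        intro n hn
        exact fw_le_fw_mul k (by positivity) (Finset.mem_filter.1 hn).2.1.ne'
    _ = ∑ m ∈ ((Finset.Icc 1 ⌊x / 2 ^ J⌋₊).filter (fun n => IsDense n t0)).image (fun n => 2 ^ J * n), fw k m := by
        rw [Finset.sum_image]
        intro a _ b _ hab
        exact Nat.eq_of_mul_eq_mul_left (by positivity) hab
    _ ≤ _ := by
        apply Finset.sum_le_sum_of_subset_of_nonneg
        · intro m hm
          obtain ⟨n, hn, rfl⟩ := Finset.mem_image.1 hm
          rw [Finset.mem_filter, Finset.mem_Icc, Nat.le_floor_iff (by positivity), le_div_iff₀ (by positivity)] at hn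
          refine Finset.mem_filter.2 ⟨Finset.mem_Icc.2 ⟨Nat.mul_pos (by positivity) hn.1.1, Nat.le_floor ?_⟩, hn.2.two_pow_mul ht hJ⟩
          push_cast; linarith [hn.1.2]
        · intro n _ _; exact fw_nonneg _ _

lemma TT_lower {k : ℕ} (hk : k = 1 ∨ k = 2) {α β : ℝ} (hα : 0 < α) (hβ : α < β) (h : Hdata k α β) :
    ∃ c, 0 < c ∧ ∀ t x, 2 ≤ t → t ≤ x → c * (x * log x ^ (k - 1) * (log t / log x) ^ α) ≤ TT k x t := by
  obtain ⟨θ, c, t0, L1, hθ, hθ1, hc, ht0, hL1, hlow⟩ := lower_main hk hα hβ h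
  have hlt0 := log_t_ge ht0
  -- all t ≥ t0
  obtain ⟨c2, L2, hc2, hL2, hlow2⟩ : ∃ c2 L2, 0 < c2 ∧ 0 < L2 ∧ ∀ t x, t0 ≤ t → t ≤ x → L2 ≤ log x →
      c2 * (x * log x ^ (k - 1) * (log t / log x) ^ α) ≤ TT k x t := by
    refine ⟨c * θ ^ α, L1 + log t0 / θ, by positivity, by positivity, fun t x htt htx hLx => ?_⟩
    have ht := ht0.trans htt
    have hx1 : 1 < x := by linarith
    have hx0 : 0 < x := by linarith
    have q : 0 ≤ log t0 / θ := by positivity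
    have hL0 : 0 < log x := by linarith
    have hltx : log t ≤ log x := Real.log_le_log (by linarith) htx
    have hlt := log_t_ge ht
    by_cases hc1 : log t ≤ θ * log x
    · refine le_trans ?_ (hlow t x htt hx1 (by linarith) hc1)
      have : θ ^ α ≤ 1 := Real.rpow_le_one hθ.le (by linarith) hα.le
      have : c * θ ^ α ≤ c := by nlinarith
      gcongr
    · push Not at hc1
      have e1 : log (exp (θ * log x)) = θ * log x := Real.log_exp _
      have h1 : t0 ≤ exp (θ * log x) := by
        rw [← Real.log_le_iff_le_exp (by linarith)]
        have : log t0 / θ ≤ log x := by linarith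
        rw [div_le_iff₀ hθ] at this; linarith
      have h2 := hlow _ x h1 hx1 (by linarith) e1.le
      have h3 : exp (θ * log x) ≤ t := by rw [← Real.le_log_iff_exp_le (by linarith)]; exact hc1.le
      refine le_trans ?_ (h2.trans (TT_mono k h3))
      rw [e1, mul_div_cancel_right₀ _ hL0.ne']
      have : (log t / log x) ^ α ≤ 1 := Real.rpow_le_one (by positivity) (by rw [div_le_one hL0]; exact hltx) hα.le
      calc c * θ ^ α * (x * log x ^ (k - 1) * (log t / log x) ^ α) ≤ c * θ ^ α * (x * log x ^ (k - 1) * 1) := by gcongr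
        _ = _ := by ring
  obtain ⟨J, hJ⟩ := pow_unbounded_of_one_lt t0 (show (1:ℝ) < 2 by norm_num)
  have hl2 := log_t_ge (le_refl (2:ℝ))
  set L3 := 2 * L2 + 2 * (J * log 2) + 2 * log t0 + 1 with hL3
  have hJl : 0 ≤ J * log 2 := by positivity
  have hL31 : 1 ≤ L3 := by linarith
  set c3 := 1 / (exp L3 * L3) with hc3
  have hc30 : 0 < c3 := by positivity
  set c4 := c2 / (2 ^ J * 2) with hc4
  have hc40 : 0 < c4 := by positivity
  have hc42 : c4 ≤ c2 := div_le_self hc2.le (by have := one_le_pow₀ (n := J) (show (1:ℝ) ≤ 2 by norm_num); linarith)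
  refine ⟨min c3 c4, lt_min hc30 hc40, fun t x ht htx => ?_⟩
  have hx0 : 0 < x := by linarith
  have hlt := log_t_ge ht
  have hltx : log t ≤ log x := Real.log_le_log (by linarith) htx
  have hL0 : 0 < log x := by linarith
  have hv1 : (log t / log x) ^ α ≤ 1 := Real.rpow_le_one (by positivity) (by rw [div_le_one hL0]; exact hltx) hα.le
  by_cases hs : log x ≤ L3
  · have hxe : x ≤ exp L3 := by rwa [← Real.log_le_iff_le_exp hx0]
    have hpk : log x ^ (k - 1) ≤ L3 := by rcases hk with rfl | rfl <;> simp <;> linarith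
    calc _ ≤ c3 * (exp L3 * L3 * 1) := by
          gcongr
          exact min_le_left _ _
      _ = 1 := by rw [hc3]; field_simp
      _ ≤ _ := one_le_TT k (by linarith)
  push Not at hs
  by_cases htt : t0 ≤ t
  · refine le_trans ?_ (hlow2 t x htt htx (by linarith))
    gcongr
    exact (min_le_right _ _).trans hc42
  push Not at htt
  have hx' : log (x / 2 ^ J) = log x - J * log 2 := by
    rw [Real.log_div hx0.ne' (by positivity), Real.log_pow]
  have hxp : 0 < x / 2 ^ J := by positivity
  have h1 := hlow2 t0 (x / 2 ^ J) le_rfl (by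
    rw [← Real.log_le_log_iff (by linarith) hxp, hx']; linarith) (by rw [hx']; linarith)
  refine le_trans ?_ (h1.trans (TT_two_pow k J hx0.le ht hJ.le))
  rw [hx']
  have hM1 : log x / 2 ≤ log x - J * log 2 := by linarith
  have hM2 : log x - J * log 2 ≤ log x := by linarith
  have hM0 : 0 < log x - J * log 2 := by linarith
  have hlog0 : log t ≤ log t0 := Real.log_le_log (by linarith) htt.le
  have hr : (log t / log x) ^ α ≤ (log t0 / (log x - J * log 2)) ^ α := by gcongr
  have hpk : log x ^ (k - 1) / 2 ≤ (log x - J * log 2) ^ (k - 1) := by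
    rcases hk with rfl | rfl
    · norm_num
    · simpa using hM1
  calc _ ≤ c4 * (x * log x ^ (k - 1) * (log t / log x) ^ α) := by gcongr; exact min_le_right _ _
    _ = c2 * (x / 2 ^ J * (log x ^ (k - 1) / 2) * (log t / log x) ^ α) := by rw [hc4]; field_simp
    _ ≤ _ := by gcongr

theorem cor_order_of_magnitude (ξ : ℝ → ℝ)
    (hξ0 : ∀ u : ℝ, u < 1 → ξ u = 0)
    (hξ : ∀ u : ℝ, 1 ≤ u → u * ξ u = 2 + 2 * ∫ t in (1:ℝ)..(u - 1), ξ t)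
    (δ : ℝ) (hδ1 : 0.713611 < δ) (hδ2 : δ < 0.713614)
    (hδeq : 0 = 1 + (∫ v in Set.Ioi (0:ℝ),
          (ξ v - (v + 2) * Real.exp (-2 * Real.eulerMascheroniConstant)) *
            (v + 1) ^ (-δ - 1)) +
        Real.exp (-2 * Real.eulerMascheroniConstant) / δ +
        Real.exp (-2 * Real.eulerMascheroniConstant) / (δ - 1)) :
    ∃ c C : ℝ, 0 < c ∧ 0 < C ∧ ∀ x t : ℝ, 2 ≤ t → t ≤ x →
      c * (x * (Real.log x / Real.log t) ^ δ * Real.log t) ≤ T x t ∧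
      T x t ≤ C * (x * (Real.log x / Real.log t) ^ δ * Real.log t) ∧
      c * ((Real.log x / Real.log t) ^ δ * Real.log x) ≤ T x t / D x t ∧
      T x t / D x t ≤ C * ((Real.log x / Real.log t) ^ δ * Real.log x) := by
  have hz := (kap_int_zero hξ0 hξ hδ1 hδ2 hδeq).2
  have hz' : ∫ x in Set.Ioi (0:ℝ), (1 - kap 2 x) * x ^ (δ - 2) = 0 := by
    rw [← neg_eq_zero, ← integral_neg]
    refine Eq.trans ?_ hz
    congr 1; funext x; ring
  have H2 := Hdata_two (by linarith) (by linarith) hz'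
  have hα : 0 < 1 - δ := by linarith
  have hk1 : (1:ℕ) = 1 ∨ (1:ℕ) = 2 := Or.inl rfl
  have hk2 : (2:ℕ) = 1 ∨ (2:ℕ) = 2 := Or.inr rfl
  obtain ⟨B1, hB1, hN1⟩ := NN_bound hk1 one_pos Hdata_one
  obtain ⟨B2, hB2, hN2⟩ := NN_bound hk2 hα H2
  obtain ⟨C1, hC1, hu1⟩ := TT_upper hk1 one_pos le_rfl (by norm_num) hB1 hN1
  obtain ⟨C2, hC2, hu2⟩ := TT_upper hk2 hα (by linarith) (fun _ => by linarith) hB2 hN2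
  obtain ⟨c1, hc1, hl1⟩ := TT_lower hk1 one_pos one_lt_two Hdata_one
  obtain ⟨c2, hc2, hl2⟩ := TT_lower hk2 hα (by linarith) H2
  refine ⟨min c2 (c2 / C1), max C2 (C2 / c1), lt_min hc2 (by positivity), lt_max_of_lt_left hC2, fun x t ht htx => ?_⟩
  have eT : TT 2 x t = T x t := by unfold TT T fw; simp
  have eD : TT 1 x t = D x t := by unfold TT D fw; simp
  have hx0 : 0 < x := by linarith
  have hlt : 0 < log t := by linarith [log_t_ge ht]
  have hL : 0 < log x := by linarith [log_t_ge (ht.trans htx)]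
  have u1 := hu1 t x ht htx
  have u2 := hu2 t x ht htx
  have l1 := hl1 t x ht htx
  have l2 := hl2 t x ht htx
  rw [eD] at u1 l1
  rw [eT] at u2 l2
  have d1 : log x ^ (((1:ℕ):ℝ) - 1 - 1) = (log x)⁻¹ := by rw [← Real.rpow_neg_one]; norm_num
  have p1 : log x ^ (((2:ℕ):ℝ) - 1 - (1 - δ)) * log t ^ (1 - δ) = (log x / log t) ^ δ * log t := by
    rw [Real.div_rpow hL.le hlt.le, Real.rpow_sub hlt, Real.rpow_one, show ((2:ℕ):ℝ) - 1 - (1 - δ) = δ by push_cast; ring]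
    field_simp
  have p2 : log x ^ (2 - 1) * (log t / log x) ^ (1 - δ) = (log x / log t) ^ δ * log t := by
    rw [← p1, Real.div_rpow hlt.le hL.le, show ((2:ℕ):ℝ) - 1 - (1 - δ) = 1 - (1 - δ) by push_cast; ring, Real.rpow_sub hL 1, Real.rpow_one]
    simp only [Nat.add_one_sub_one, pow_one]; field_simp; congr 1; ring
  rw [mul_assoc x, p1, ← mul_assoc x] at u2
  rw [mul_assoc x, p2, ← mul_assoc x] at l2
  rw [d1, Real.rpow_one] at u1
  rw [Real.rpow_one, Nat.sub_self, pow_zero, mul_one] at l1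
  set V := (log x / log t) ^ δ with hV
  have hV0 : 0 < V := by positivity
  have hD : 0 < D x t := lt_of_lt_of_le (by positivity) l1
  refine ⟨le_trans (by gcongr; exact min_le_left _ _) l2, le_trans u2 (by gcongr; exact le_max_left _ _), ?_, ?_⟩
  · rw [le_div_iff₀ hD]
    calc _ ≤ c2 / C1 * (V * log x) * (C1 * (x * (log x)⁻¹ * log t)) := by
          gcongr; exact min_le_right _ _
      _ = c2 * (x * V * log t) := by field_simp
      _ ≤ _ := l2
  · rw [div_le_iff₀ hD]
    calc _ ≤ _ := u2
      _ = C2 / c1 * (V * log x) * (c1 * (x * (log t / log x))) := by field_simp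
      _ ≤ _ := by gcongr; exact le_max_right _ _
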